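/- Let Ω be a domain in ℝ^n, n ≥ 3, x₀ ∈ Ω, R > 0 with the closure of B_{2R}(x₀) contained in Ω, p > 1, l > n/2, f ∈ C²(Ω), and let u ∈ C¹ up to the closure of B_{2R}(x₀) be a weak solution of −Δ_p u = f in B_{2R}(x₀). Fix 0 < k ≤ 1, indices i, j ∈ {1,…,n}, and set ŝ := 1/k. Then there exists 𝔠 = 𝔠(k, l, n) > 0 such that if |p − 2| < 𝔠, the following holds: for every ν with 2l/(l−1) < ν < 2n/(n−2) there exists a constant C > 0 (depending only on k, n, l, ν, R, p, the L^∞-norm of ∇u on B_{2R}(x₀) and the W^{2,l}-norm of f on B_{2R}(x₀), but independent of ε and of q) such that for every ε ∈ (0,1), every u_ε ∈ C³(B_{2R}(x₀)) which is continuous up to the closure, solves the regularized problem in B_{2R}(x₀) and equals u on ∂B_{2R}(x₀), every q ≥ 1/k and all 0 < h' < h < R: ‖g_ε‖_{L^{2*q}(B_{h'}(x₀))}^q ≤ C · (q/(h − h')) · ‖g_ε‖_{L^{ν(q−ŝ)}(B_h(x₀))}^{q−ŝ}, where 2* = 2n/(n−2) and g_ε(x) := (ε + |∇u_ε(x)|²)^{k/2}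 |u_{ε,ij}(x)|. -/

import Mathlib

open MeasureTheory Metric Real Set
open scoped RealInnerProductSpace ENNReal Topology

noncomputable section

abbrev Euc (n : ℕ) : Type := EuclideanSpace ℝ (Fin n)

/-- The `i`-th partial derivative of `u`. -/
noncomputable def pd {n : ℕ} (i : Fin n) (u : Euc n → ℝ) (x : Euc n) : ℝ :=
  fderiv ℝ u x (EuclideanSpace.single i 1)

/-- The second partial derivative `u_{ij} = ∂²u/∂xⱼ∂xᵢ`. -/
noncomputable def pd2 {n : ℕ} (i j : Fin n) (u : Euc n → ℝ) (x : Euc n) : ℝ :=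
  fderiv ℝ (pd i u) x (EuclideanSpace.single j 1)

/-- Frobenius norm of the Hessian matrix of `u` at `x`. -/
noncomputable def hessNorm {n : ℕ} (u : Euc n → ℝ) (x : Euc n) : ℝ :=
  Real.sqrt (∑ i : Fin n, ∑ j : Fin n, pd2 i j u x ^ 2)

/-- `u` is a weak solution of `-Δ_p u = f` on `Ω`. -/
def IsWeakPSol {n : ℕ} (p : ℝ) (f u : Euc n → ℝ) (Ω : Set (Euc n)) : Prop :=
  ∀ ψ : Euc n → ℝ, ContDiff ℝ (⊤ : ℕ∞) ψ → HasCompactSupport ψ → tsupport ψ ⊆ Ω →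
    (∫ x in Ω, ‖gradient u x‖ ^ (p - 2) * ⟪gradient u x, gradient ψ x⟫) =
      ∫ x in Ω, f x * ψ x

/-- `u` solves the regularized problem `-div((ε + |∇u|²)^((p-2)/2) ∇u) = f` pointwise on `B`. -/
def SolvesReg {n : ℕ} (p ε : ℝ) (f u : Euc n → ℝ) (B : Set (Euc n)) : Prop :=
  ∀ x ∈ B,
    -(∑ i : Fin n,
        fderiv ℝ (fun y => (((ε + ‖gradient u y‖ ^ 2) ^ ((p - 2) / 2)) • gradient u y) i) x
          (EuclideanSpace.single i 1)) = f x

/-- The weighted function `g_ε(x) = (ε + |∇u(x)|²)^(k/2) |u_{ij}(x)|`. -/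
noncomputable def gfun {n : ℕ} (k ε : ℝ) (i j : Fin n) (u : Euc n → ℝ) (x : Euc n) : ℝ :=
  (ε + ‖gradient u x‖ ^ 2) ^ (k / 2) * |pd2 i j u x|

/-- The `L^e` norm of `g` on the set `s`. -/
noncomputable def lpOn {n : ℕ} (g : Euc n → ℝ) (e : ℝ) (s : Set (Euc n)) : ℝ :=
  (∫ x in s, g x ^ e) ^ (1 / e)

section base
variable {n : ℕ}

lemma gradient_apply' (u : Euc n → ℝ) (x : Euc n) (i : Fin n) : gradient u x i = pd i u x := by
  have h : ⟪gradient u x, EuclideanSpace.single i (1:ℝ)⟫ = fderiv ℝ u x (EuclideanSpace.single i 1) := by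
    simp [gradient]
  rw [pd, ← h, EuclideanSpace.inner_single_right]; simp

lemma normsq_gradient (u : Euc n → ℝ) (x : Euc n) : ‖gradient u x‖ ^ 2 = ∑ i, pd i u x ^ 2 := by
  rw [EuclideanSpace.norm_sq_eq]
  simp [gradient_apply']

lemma norm_fderiv_sq (u : Euc n → ℝ) (x : Euc n) : ‖fderiv ℝ u x‖ ^ 2 = ∑ i, pd i u x ^ 2 := by
  rw [← normsq_gradient]; simp [gradient]

lemma fderiv_eq_sum (u : Euc n → ℝ) (x y : Euc n) : fderiv ℝ u x y = ∑ i, y i * pd i u x := by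
  have : y = ∑ i, y i • EuclideanSpace.single i (1:ℝ) := by
    ext j; simp [Finset.sum_apply, Pi.single_apply]
  conv_lhs => rw [this]
  simp [pd]

lemma pd_add {i : Fin n} {f g : Euc n → ℝ} {x : Euc n} (hf : DifferentiableAt ℝ f x)
    (hg : DifferentiableAt ℝ g x) : pd i (fun y => f y + g y) x = pd i f x + pd i g x := by
  simp [pd, fderiv_fun_add hf hg]

lemma pd_sub {i : Fin n} {f g : Euc n → ℝ} {x : Euc n} (hf : DifferentiableAt ℝ f x)
    (hg : DifferentiableAt ℝ g x) : pd i (fun y => f y - g y) x = pd i f x - pd i g x := by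
  simp [pd, fderiv_fun_sub hf hg]

lemma pd_mul {i : Fin n} {f g : Euc n → ℝ} {x : Euc n} (hf : DifferentiableAt ℝ f x)
    (hg : DifferentiableAt ℝ g x) :
    pd i (fun y => f y * g y) x = pd i f x * g x + f x * pd i g x := by
  simp [pd, fderiv_fun_mul hf hg]; ring

lemma pd_neg {i : Fin n} {f : Euc n → ℝ} {x : Euc n} :
    pd i (fun y => - f y) x = - pd i f x := by
  simp [pd, fderiv_fun_neg]

lemma pd_const_mul {i : Fin n} {f : Euc n → ℝ} {x : Euc n} (c : ℝ) (hf : DifferentiableAt ℝ f x) :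
    pd i (fun y => c * f y) x = c * pd i f x := by
  simp [pd, fderiv_const_mul hf]

lemma pd_const {i : Fin n} {x : Euc n} (c : ℝ) : pd i (fun _ => c) x = 0 := by
  simp [pd]

lemma pd_sum {i : Fin n} {ι : Type*} {t : Finset ι} {f : ι → Euc n → ℝ} {x : Euc n}
    (hf : ∀ j ∈ t, DifferentiableAt ℝ (f j) x) :
    pd i (fun y => ∑ j ∈ t, f j y) x = ∑ j ∈ t, pd i (f j) x := by
  simp [pd, fderiv_fun_sum hf]

/-- chain rule -/
lemma pd_comp {i : Fin n} {f : Euc n → ℝ} {x : Euc n} {h : ℝ → ℝ} {h' : ℝ}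
    (hh : HasDerivAt h h' (f x)) (hf : DifferentiableAt ℝ f x) :
    pd i (fun y => h (f y)) x = h' * pd i f x := by
  have := (hh.comp_hasFDerivAt x hf.hasFDerivAt).fderiv
  simp only [Function.comp_def] at this
  simp [pd, this]

lemma pd_pow {i : Fin n} {f : Euc n → ℝ} {x : Euc n} (m : ℕ) (hf : DifferentiableAt ℝ f x) :
    pd i (fun y => f y ^ m) x = m * f x ^ (m - 1) * pd i f x :=
  pd_comp (h := fun t => t ^ m) (hasDerivAt_pow m (f x)) hf

lemma pd_rpow {i : Fin n} {f : Euc n → ℝ} {x : Euc n} (r : ℝ) (hf : DifferentiableAt ℝ f x)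
    (h0 : 0 < f x) :
    pd i (fun y => f y ^ r) x = r * f x ^ (r - 1) * pd i f x :=
  pd_comp (h := fun t => t ^ r) (Real.hasDerivAt_rpow_const (Or.inl h0.ne')) hf

lemma pd_congr {i : Fin n} {f g : Euc n → ℝ} {x : Euc n} (h : f =ᶠ[𝓝 x] g) :
    pd i f x = pd i g x := by
  simp [pd, h.fderiv_eq]

lemma pd_eventuallyEq {i : Fin n} {f g : Euc n → ℝ} {x : Euc n} (h : f =ᶠ[𝓝 x] g) :
    pd i f =ᶠ[𝓝 x] pd i g := by
  filter_upwards [h.eventuallyEq_nhds] with y hy using pd_congr hy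

lemma contDiff_pd {k m : WithTop ℕ∞} {f : Euc n → ℝ} (hf : ContDiff ℝ k f) (hm : m + 1 ≤ k)
    (i : Fin n) : ContDiff ℝ m (pd i f) :=
  (hf.fderiv_right hm).clm_apply contDiff_const

lemma pd_comm {f : Euc n → ℝ} (hf : ContDiff ℝ 2 f) (i j : Fin n) (x : Euc n) :
    pd i (pd j f) x = pd j (pd i f) x := by
  have hd : DifferentiableAt ℝ (fderiv ℝ f) x :=
    ((hf.fderiv_right (m := 1) (by norm_num)).differentiable (by norm_num)).differentiableAt
  have key : ∀ a b : Fin n, pd a (pd b f) x =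
      fderiv ℝ (fderiv ℝ f) x (EuclideanSpace.single a 1) (EuclideanSpace.single b 1) := by
    intro a b
    have : pd b f = fun y => fderiv ℝ f y (EuclideanSpace.single b 1) := rfl
    rw [pd, this, fderiv_clm_apply hd (by fun_prop)]
    simp
  rw [key, key]
  exact (hf.contDiffAt.isSymmSndFDerivAt (by simp)) _ _

lemma hcs_pd {f : Euc n → ℝ} (hf : HasCompactSupport f) (i : Fin n) : HasCompactSupport (pd i f) :=
  hf.fderiv_apply ℝ (EuclideanSpace.single i 1)

lemma tsupport_pd_subset (f : Euc n → ℝ) (i : Fin n) : tsupport (pd i f) ⊆ tsupport f :=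
  tsupport_fderiv_apply_subset ℝ (EuclideanSpace.single i (1:ℝ))

lemma cont_pd {f : Euc n → ℝ} (hf : ContDiff ℝ 1 f) (i : Fin n) : Continuous (pd i f) :=
  (contDiff_pd (m := 0) hf (by norm_num) i).continuous

/-- integration by parts -/
lemma ibp {f g : Euc n → ℝ} (hf : ContDiff ℝ 1 f) (hg : ContDiff ℝ 1 g)
    (hc : HasCompactSupport g) (i : Fin n) :
    ∫ x, f x * pd i g x = - ∫ x, pd i f x * g x := by
  refine integral_mul_fderiv_eq_neg_fderiv_mul_of_integrable ?_ ?_ ?_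
    (fun x _ => (hf.differentiable (by norm_num)) x) (fun x _ => (hg.differentiable (by norm_num)) x)
  · exact ((cont_pd hf i).mul hg.continuous).integrable_of_hasCompactSupport hc.mul_left
  · exact (hf.continuous.mul (cont_pd hg i)).integrable_of_hasCompactSupport (hcs_pd hc i).mul_left
  · exact (hf.continuous.mul hg.continuous).integrable_of_hasCompactSupport hc.mul_left

end base

section heat
variable {n : ℕ}

def gam (z : Euc n) : ℝ := Real.exp (-π * ‖z‖ ^ 2)

def Hs (s : ℝ) (φ : Euc n → ℝ) (x : Euc n) : ℝ := ∫ z, φ (x + s • z) * gam z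

/-- smooth compactly supported functions -/
def Cc (φ : Euc n → ℝ) : Prop := ContDiff ℝ (⊤ : ℕ∞) φ ∧ HasCompactSupport φ

lemma gam_pos (z : Euc n) : 0 < gam z := Real.exp_pos _

lemma gam_le_one (z : Euc n) : gam z ≤ 1 := by
  rw [gam, Real.exp_le_one_iff]
  have := Real.pi_pos
  nlinarith [sq_nonneg ‖z‖]

lemma gam_contDiff : ContDiff ℝ 1 (gam : Euc n → ℝ) := by
  unfold gam
  exact Real.contDiff_exp.comp (contDiff_const.mul (contDiff_norm_sq ℝ))

lemma gam_cont : Continuous (gam : Euc n → ℝ) := gam_contDiff.continuous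

lemma gam_moment (N : ℕ) : Integrable (fun z : Euc n => (1 + ‖z‖) ^ N * gam z) := by
  have h1 : Integrable (fun z : Euc n => Real.exp (-(1:ℝ) * ‖z‖ ^ 2)) := by
    have := GaussianFourier.integrable_cexp_neg_mul_sq_norm_add (V := Euc n) (b := 1) (by simp) 0 0
    have h2 := this.norm
    refine h2.congr (Filter.Eventually.of_forall fun z => ?_)
    simp [Complex.norm_exp, ← Complex.ofReal_pow]
  refine (h1.const_mul (N.factorial * Real.exp 2)).mono' ?_ (Filter.Eventually.of_forall fun z => ?_)
  · exact ((by fun_prop : Continuous fun z : Euc n => (1 + ‖z‖) ^ N).mul gam_cont).aestronglyMeasurable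
  · have h3 := Real.pow_div_factorial_le_exp (1 + ‖z‖) (by positivity) N
    rw [div_le_iff₀ (by positivity)] at h3
    have h4 : Real.exp (1 + ‖z‖) * gam z ≤ Real.exp 2 * Real.exp (-(1:ℝ) * ‖z‖ ^ 2) := by
      rw [gam, ← Real.exp_add, ← Real.exp_add, Real.exp_le_exp]
      have := Real.pi_gt_three
      nlinarith [sq_nonneg (‖z‖ - 1), sq_nonneg ‖z‖]
    rw [Real.norm_of_nonneg (by have := gam_pos z; positivity)]
    calc (1 + ‖z‖) ^ N * gam z ≤ (Real.exp (1 + ‖z‖) * N.factorial) * gam z := by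
          gcongr; exact (gam_pos z).le
      _ = N.factorial * (Real.exp (1 + ‖z‖) * gam z) := by ring
      _ ≤ N.factorial * (Real.exp 2 * Real.exp (-(1:ℝ) * ‖z‖ ^ 2)) := by gcongr
      _ = _ := by ring

lemma gam_integrable : Integrable (gam : Euc n → ℝ) := by simpa using gam_moment (n := n) 0

lemma gam_int : ∫ z : Euc n, gam z = 1 := by
  have := GaussianFourier.integral_rexp_neg_mul_sq_norm (V := Euc n) Real.pi_pos
  simpa [gam, div_self Real.pi_ne_zero] using this

lemma pd_gam (i : Fin n) (z : Euc n) : pd i gam z = -(2 * π) * z i * gam z := by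
  have h1 : HasFDerivAt (fun z : Euc n => ‖z‖ ^ 2) (2 • innerSL ℝ z) z :=
    (hasStrictFDerivAt_norm_sq z).hasFDerivAt
  have h2 : HasFDerivAt (gam : Euc n → ℝ) _ z := (h1.const_mul (-π)).exp
  rw [pd, h2.fderiv]
  simp [gam, EuclideanSpace.inner_single_right]
  ring

lemma Cc.pd {φ : Euc n → ℝ} (h : Cc φ) (i : Fin n) : Cc (pd i φ) :=
  ⟨contDiff_pd (k := (⊤ : ℕ∞)) h.1 (by rfl) i, hcs_pd h.2 i⟩

lemma Cc.cont {φ : Euc n → ℝ} (h : Cc φ) : Continuous φ := h.1.continuous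

lemma Cc.diff {φ : Euc n → ℝ} (h : Cc φ) : Differentiable ℝ φ := h.1.differentiable (by simp)

lemma Cc.decay {φ : Euc n → ℝ} (h : Cc φ) (N : ℕ) :
    ∃ C, 0 ≤ C ∧ ∀ x, |φ x| * (1 + ‖x‖) ^ N ≤ C := by
  obtain ⟨C, hC⟩ := (h.cont.mul (by fun_prop : Continuous fun x : Euc n => (1 + ‖x‖) ^ N)).bounded_above_of_compact_support
    (h.2.mul_right)
  refine ⟨C, (norm_nonneg _).trans (hC 0), fun x => ?_⟩
  have : ‖φ x * (1 + ‖x‖) ^ N‖ ≤ C := hC x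
  rwa [norm_mul, Real.norm_eq_abs, Real.norm_of_nonneg (by positivity)] at this

lemma Cc.bdd {φ : Euc n → ℝ} (h : Cc φ) : ∃ C, 0 ≤ C ∧ ∀ x, |φ x| ≤ C := by
  simpa using h.decay 0

lemma Hs_integrable {φ : Euc n → ℝ} (h : Cc φ) (s : ℝ) (x : Euc n) :
    Integrable (fun z => φ (x + s • z) * gam z) := by
  obtain ⟨C, hC0, hC⟩ := h.bdd
  refine (gam_integrable.const_mul C).mono' ?_ (Filter.Eventually.of_forall fun z => ?_)
  · exact ((h.cont.comp (by fun_prop)).mul gam_cont).aestronglyMeasurable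
  · rw [norm_mul, Real.norm_eq_abs, Real.norm_of_nonneg (gam_pos z).le]
    have := hC (x + s • z)
    have := gam_pos z
    gcongr

lemma Hs_decay {φ : Euc n → ℝ} (h : Cc φ) (N : ℕ) (T : ℝ) (hT : 0 ≤ T) :
    ∃ C, 0 ≤ C ∧ ∀ s, |s| ≤ T → ∀ x, |Hs s φ x| * (1 + ‖x‖) ^ N ≤ C := by
  obtain ⟨C, hC0, hC⟩ := h.decay N
  refine ⟨∫ z : Euc n, C * (1 + T) ^ N * ((1 + ‖z‖) ^ N * gam z), ?_, fun s hs x => ?_⟩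
  · exact integral_nonneg fun z => by have := gam_pos z; positivity
  · have h1 : |Hs s φ x| ≤ ∫ z, |φ (x + s • z)| * gam z := by
      refine (abs_integral_le_integral_abs).trans (le_of_eq ?_)
      refine integral_congr_ae (Filter.Eventually.of_forall fun z => ?_)
      simp only [abs_mul, abs_of_pos (gam_pos z)]
    refine (mul_le_mul_of_nonneg_right h1 (by positivity)).trans ?_
    rw [← integral_mul_const]
    refine integral_mono_of_nonneg (Filter.Eventually.of_forall fun z => ?_)
      ((gam_moment N).const_mul _) (Filter.Eventually.of_forall fun z => ?_)
    · have := gam_pos z; simp only [Pi.zero_apply]; positivity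
    · have h2 : 1 + ‖x‖ ≤ (1 + ‖x + s • z‖) * ((1 + T) * (1 + ‖z‖)) := by
        have h3 : ‖x‖ ≤ ‖x + s • z‖ + T * ‖z‖ := by
          calc ‖x‖ = ‖(x + s • z) - s • z‖ := by simp
            _ ≤ ‖x + s • z‖ + ‖s • z‖ := norm_sub_le _ _
            _ ≤ _ := by
              rw [norm_smul, Real.norm_eq_abs]; gcongr
        have := norm_nonneg z
        have := norm_nonneg (x + s • z)
        have h5 : 0 ≤ ‖x + s • z‖ * (T + ‖z‖ + T * ‖z‖) := by positivity
        nlinarith [mul_nonneg hT (norm_nonneg z)]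
      have h4 := pow_le_pow_left₀ (by positivity) h2 N
      rw [mul_pow, mul_pow] at h4
      have h6 := hC (x + s • z)
      have := gam_pos z
      simp only
      calc |φ (x + s • z)| * gam z * (1 + ‖x‖) ^ N
          ≤ |φ (x + s • z)| * gam z * ((1 + ‖x + s • z‖) ^ N * ((1 + T) ^ N * (1 + ‖z‖) ^ N)) := by
            gcongr
        _ = (|φ (x + s • z)| * (1 + ‖x + s • z‖) ^ N) * ((1 + T) ^ N * (1 + ‖z‖) ^ N * gam z) := by ring
        _ ≤ C * ((1 + T) ^ N * (1 + ‖z‖) ^ N * gam z) := by gcongr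
        _ = _ := by ring

lemma Cc.fderiv_bdd {φ : Euc n → ℝ} (h : Cc φ) : ∃ C, 0 ≤ C ∧ ∀ x, ‖fderiv ℝ φ x‖ ≤ C := by
  obtain ⟨C, hC⟩ := (h.1.continuous_fderiv (by simp)).bounded_above_of_compact_support
    (h.2.fderiv ℝ)
  exact ⟨C, (norm_nonneg _).trans (hC 0), hC⟩

lemma Hs_hasFDerivAt {φ : Euc n → ℝ} (h : Cc φ) (s : ℝ) (x : Euc n) :
    HasFDerivAt (Hs s φ) (∫ z, gam z • fderiv ℝ φ (x + s • z)) x := by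
  obtain ⟨C, hC0, hC⟩ := h.fderiv_bdd
  refine hasFDerivAt_integral_of_dominated_of_fderiv_le (s := univ) (bound := fun z => C * gam z)
    (F' := fun x z => gam z • fderiv ℝ φ (x + s • z)) Filter.univ_mem ?_ (Hs_integrable h s x) ?_ ?_ ?_ ?_
  · exact Filter.Eventually.of_forall fun y => (Hs_integrable h s y).1
  · exact (gam_cont.smul ((h.1.continuous_fderiv (by simp)).comp (by fun_prop))).aestronglyMeasurable
  · refine Filter.Eventually.of_forall fun z y _ => ?_
    rw [norm_smul, Real.norm_of_nonneg (gam_pos z).le, mul_comm]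
    have := gam_pos z
    gcongr; exact hC _
  · exact gam_integrable.const_mul C
  · refine Filter.Eventually.of_forall fun z y _ => ?_
    have h1 : HasFDerivAt (fun y => φ (y + s • z)) (fderiv ℝ φ (y + s • z)) y := by
      have := ((h.diff (y + s • z)).hasFDerivAt).comp y ((hasFDerivAt_id y).add_const (s • z))
      rw [ContinuousLinearMap.comp_id] at this
      exact this
    exact h1.mul_const (gam z)

lemma Hs_diff {φ : Euc n → ℝ} (h : Cc φ) (s : ℝ) : Differentiable ℝ (Hs s φ) :=
  fun x => (Hs_hasFDerivAt h s x).differentiableAt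

lemma pd_Hs {φ : Euc n → ℝ} (h : Cc φ) (s : ℝ) (i : Fin n) : pd i (Hs s φ) = Hs s (pd i φ) := by
  ext x
  rw [pd, (Hs_hasFDerivAt h s x).fderiv, ContinuousLinearMap.integral_apply]
  · simp [Hs, pd, mul_comm]
  · obtain ⟨C, hC0, hC⟩ := h.fderiv_bdd
    refine (gam_integrable.const_mul C).mono' ?_ (Filter.Eventually.of_forall fun z => ?_)
    · exact (gam_cont.smul ((h.1.continuous_fderiv (by simp)).comp (by fun_prop))).aestronglyMeasurable
    · rw [norm_smul, Real.norm_of_nonneg (gam_pos z).le, mul_comm]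
      have := gam_pos z
      gcongr; exact hC _

def lap (φ : Euc n → ℝ) (x : Euc n) : ℝ := ∑ i, pd i (pd i φ) x

lemma Cc.lap {φ : Euc n → ℝ} (h : Cc φ) : Cc (lap φ) := by
  refine ⟨ContDiff.sum fun i _ => ((h.pd i).pd i).1, ?_⟩
  refine h.2.mono' ?_
  intro x hx
  by_contra hc
  apply hx
  unfold _root_.lap
  refine Finset.sum_eq_zero fun i _ => ?_
  exact image_eq_zero_of_notMem_tsupport fun hh => hc (tsupport_pd_subset _ i (tsupport_pd_subset _ i hh))

lemma stein {φ : Euc n → ℝ} (h : Cc φ) (s : ℝ) (x : Euc n) (i : Fin n) :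
    Integrable (fun z => z i * φ (x + s • z) * gam z) ∧
    ∫ z, z i * φ (x + s • z) * gam z = s / (2 * π) * Hs s (pd i φ) x := by
  have hint : Integrable (fun z => z i * φ (x + s • z) * gam z) := by
    obtain ⟨C, hC0, hC⟩ := h.bdd
    refine ((gam_moment 1).const_mul C).mono' ?_ (Filter.Eventually.of_forall fun z => ?_)
    · exact (((by fun_prop : Continuous fun z : Euc n => z i).mul
        (h.cont.comp (by fun_prop))).mul gam_cont).aestronglyMeasurable
    · rw [norm_mul, norm_mul, Real.norm_of_nonneg (gam_pos z).le]
      have h1 := hC (x + s • z)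
      have h2 := gam_pos z
      have h3 : ‖z i‖ ≤ 1 + ‖z‖ := (PiLp.norm_apply_le z i).trans (by linarith)
      rw [Real.norm_eq_abs (φ _)]
      calc ‖z i‖ * |φ (x + s • z)| * gam z ≤ (1 + ‖z‖) * C * gam z := by gcongr
        _ = _ := by ring
  refine ⟨hint, ?_⟩
  have hpd : ∀ z, pd i (fun z => φ (x + s • z)) z = s * pd i φ (x + s • z) := by
    intro z
    have h1 : HasFDerivAt (fun z => φ (x + s • z)) _ z :=
      ((h.diff (x + s • z)).hasFDerivAt).comp z (((hasFDerivAt_id z).const_smul s).const_add x)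
    rw [pd, h1.fderiv]
    simp [pd]
  have key := integral_mul_fderiv_eq_neg_fderiv_mul_of_integrable (μ := (volume : Measure (Euc n)))
    (f := fun z => φ (x + s • z)) (g := gam) (v := EuclideanSpace.single i 1) ?_ ?_
    (Hs_integrable h s x) (fun z _ => (h.diff.comp (by fun_prop)) z)
    (fun z _ => (gam_contDiff.differentiable (by norm_num)) z)
  · change ∫ z, φ (x + s • z) * pd i gam z = - ∫ z, pd i (fun z => φ (x + s • z)) z * gam z at key
    simp only [hpd, pd_gam] at key
    have e1 : ∀ z : Euc n, φ (x + s • z) * (-(2 * π) * z i * gam z) =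
      -(2 * π) * (z i * φ (x + s • z) * gam z) := fun z => by ring
    have e2 : ∀ z : Euc n, s * pd i φ (x + s • z) * gam z = s * (pd i φ (x + s • z) * gam z) :=
      fun z => by ring
    simp only [e1, e2, integral_const_mul] at key
    rw [Hs]
    have := Real.pi_pos
    field_simp
    linarith
  · change Integrable fun z => pd i (fun z => φ (x + s • z)) z * gam z
    simp only [hpd, mul_assoc]
    exact (Hs_integrable (h.pd i) s x).const_mul s
  · change Integrable fun z => φ (x + s • z) * pd i gam z
    simp only [pd_gam]
    refine (hint.const_mul (-(2 * π))).congr (Filter.Eventually.of_forall fun z => ?_)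
    simp only; ring

lemma Hs_hasDerivAt {φ : Euc n → ℝ} (h : Cc φ) (x : Euc n) (s : ℝ) :
    HasDerivAt (fun s => Hs s φ x) (s / (2 * π) * Hs s (lap φ) x) s := by
  obtain ⟨C, hC0, hC⟩ := h.fderiv_bdd
  have hl : s / (2 * π) * Hs s (lap φ) x = ∫ z, fderiv ℝ φ (x + s • z) z * gam z := by
    have e : ∀ z, fderiv ℝ φ (x + s • z) z * gam z = ∑ i, z i * pd i φ (x + s • z) * gam z := by
      intro z; rw [fderiv_eq_sum, Finset.sum_mul]
    simp only [e]
    rw [integral_finsetSum _ fun i _ => (stein (h.pd i) s x i).1]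
    simp only [fun i => (stein (h.pd i) s x i).2, ← Finset.mul_sum]
    congr 1
    rw [Hs]
    simp only [lap, Finset.sum_mul]
    rw [integral_finsetSum _ fun i _ => (Hs_integrable ((h.pd i).pd i) s x)]
    rfl
  rw [hl]
  refine (hasDerivAt_integral_of_dominated_loc_of_deriv_le (s := univ)
    (bound := fun z => C * ((1 + ‖z‖) ^ 1 * gam z)) (F := fun s z => φ (x + s • z) * gam z)
    (F' := fun s z => fderiv ℝ φ (x + s • z) z * gam z) Filter.univ_mem ?_ (Hs_integrable h s x) ?_ ?_ ?_ ?_).2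
  · exact Filter.Eventually.of_forall fun y => (Hs_integrable h y x).1
  · refine Continuous.aestronglyMeasurable ?_
    have h1 : Continuous fun z : Euc n => fderiv ℝ φ (x + s • z) :=
      (h.1.continuous_fderiv (by simp)).comp (by fun_prop)
    exact (h1.clm_apply continuous_id).mul gam_cont
  · refine Filter.Eventually.of_forall fun z y _ => ?_
    rw [norm_mul, Real.norm_of_nonneg (gam_pos z).le, ← mul_assoc]
    have := gam_pos z
    gcongr
    refine (ContinuousLinearMap.le_opNorm _ _).trans ?_
    gcongr
    · exact hC _
    · rw [pow_one]; linarith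
  · exact (gam_moment 1).const_mul C
  · refine Filter.Eventually.of_forall fun z y _ => ?_
    have h2 : HasDerivAt (fun y : ℝ => x + y • z) z y := by
      simpa using ((hasDerivAt_id y).smul_const z).const_add x
    exact (((h.diff (x + y • z)).hasFDerivAt).comp_hasDerivAt y h2).mul_const (gam z)

lemma Hs_zero (φ : Euc n → ℝ) : Hs 0 φ = φ := by
  ext x; simp [Hs, integral_const_mul, gam_int]

lemma Hs_sup {φ : Euc n → ℝ} (h : Cc φ) {s : ℝ} (hs : 0 < s) (x : Euc n) :
    |Hs s φ x| ≤ (s ^ n)⁻¹ * ∫ y, |φ y| := by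
  have hi : Integrable fun y => |φ y| := (h.cont.integrable_of_hasCompactSupport h.2).abs
  have h1 : ∫ z, |φ (x + s • z)| = (s ^ n)⁻¹ * ∫ y, |φ y| := by
    rw [Measure.integral_comp_smul (μ := volume) (fun z => |φ (x + z)|) s,
      integral_add_left_eq_self (fun z => |φ z|) x]
    simp [abs_of_pos hs]
  rw [← h1]
  refine (abs_integral_le_integral_abs).trans ?_
  refine integral_mono_of_nonneg (Filter.Eventually.of_forall fun z => abs_nonneg _) ?_
    (Filter.Eventually.of_forall fun z => ?_)
  · exact (hi.comp_add_left x).comp_smul hs.ne'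
  · simp only [abs_mul, abs_of_pos (gam_pos z)]
    exact mul_le_of_le_one_right (abs_nonneg _) (gam_le_one z)

lemma Hs_L1 {φ : Euc n → ℝ} (h : Cc φ) (s : ℝ) : ∫ x, |Hs s φ x| ≤ ∫ x, |φ x| := by
  have hi : Integrable φ := h.cont.integrable_of_hasCompactSupport h.2
  have hm : AEStronglyMeasurable (Hs s φ) := (Hs_diff h s).continuous.aestronglyMeasurable
  simp only [← Real.norm_eq_abs]
  rw [integral_norm_eq_lintegral_enorm hm, integral_norm_eq_lintegral_enorm hi.1]
  refine ENNReal.toReal_mono hi.2.ne ?_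
  calc ∫⁻ x, ‖Hs s φ x‖ₑ ≤ ∫⁻ x, ∫⁻ z, ‖φ (x + s • z) * gam z‖ₑ :=
        lintegral_mono fun x => enorm_integral_le_lintegral_enorm _
    _ = ∫⁻ z, ∫⁻ x, ‖φ (x + s • z) * gam z‖ₑ := by
        rw [lintegral_lintegral_swap]
        refine Continuous.aemeasurable ?_
        have h1 : Continuous fun q : Euc n × Euc n => φ (q.1 + s • q.2) := h.cont.comp (by fun_prop)
        have h2 : Continuous fun q : Euc n × Euc n => gam q.2 := gam_cont.comp (by fun_prop)
        exact (h1.mul h2).enorm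
    _ = ∫⁻ z, ‖gam z‖ₑ * ∫⁻ x, ‖φ x‖ₑ := by
        congr 1; ext z
        simp only [enorm_mul]
        have hmm : Measurable fun x : Euc n => ‖φ (x + s • z)‖ₑ :=
          (h.cont.comp (by fun_prop : Continuous fun x : Euc n => x + s • z)).measurable.enorm
        rw [lintegral_mul_const _ hmm,
          lintegral_add_right_eq_self (fun x => ‖φ x‖ₑ), mul_comm]
    _ = ∫⁻ x, ‖φ x‖ₑ := by
        rw [lintegral_mul_const _ gam_cont.measurable.enorm]
        have : ∫⁻ z : Euc n, ‖gam z‖ₑ = 1 := by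
          have h1 := ofReal_integral_norm_eq_lintegral_enorm (gam_integrable (n := n))
          rw [← h1]
          simp only [Real.norm_of_nonneg (gam_pos _).le, gam_int, ENNReal.ofReal_one]
        rw [this, one_mul]

end heat

section bell
variable {n : ℕ}

structure Bell (b b1 b2 b11 b12 b22 α β : ℝ × ℝ → ℝ) (κ : ℝ) : Prop where
  d0 : ∀ z, HasFDerivAt b (b1 z • ContinuousLinearMap.fst ℝ ℝ ℝ + b2 z • ContinuousLinearMap.snd ℝ ℝ ℝ) z
  d1 : ∀ z, HasFDerivAt b1 (b11 z • ContinuousLinearMap.fst ℝ ℝ ℝ + b12 z • ContinuousLinearMap.snd ℝ ℝ ℝ) z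
  d2 : ∀ z, HasFDerivAt b2 (b12 z • ContinuousLinearMap.fst ℝ ℝ ℝ + b22 z • ContinuousLinearMap.snd ℝ ℝ ℝ) z
  c11 : Continuous b11
  c12 : Continuous b12
  c22 : Continuous b22
  nonneg : ∀ z, 0 ≤ b z
  zero : b (0, 0) = 0
  κ0 : 0 ≤ κ
  α0 : ∀ z, 0 ≤ α z
  β0 : ∀ z, 0 ≤ β z
  αβ : ∀ z, κ ^ 2 ≤ α z * β z
  conv : ∀ z x y, α z * x ^ 2 + β z * y ^ 2 ≤ b11 z * x ^ 2 + 2 * b12 z * x * y + b22 z * y ^ 2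

def om (x : Euc n) : ℝ := ((1 + ‖x‖) ^ (n + 1))⁻¹

lemma om_pos (x : Euc n) : 0 < om x := by unfold om; positivity

lemma om_le_one (x : Euc n) : om x ≤ 1 := by
  unfold om
  exact inv_le_one_of_one_le₀ (one_le_pow₀ (by linarith [norm_nonneg x]))

lemma om_int : Integrable (om : Euc n → ℝ) := by
  have := integrable_one_add_norm (E := Euc n) (μ := volume) (r := (n + 1 : ℕ)) (by simp)
  refine this.congr (Filter.Eventually.of_forall fun x => ?_)
  simp only [om]
  rw [Real.rpow_neg (by positivity), Real.rpow_natCast]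

lemma Hs_om {φ : Euc n → ℝ} (h : Cc φ) (T : ℝ) (hT : 0 ≤ T) :
    ∃ C, 0 ≤ C ∧ ∀ s, |s| ≤ T → ∀ x, |Hs s φ x| ≤ C * om x := by
  obtain ⟨C, hC0, hC⟩ := Hs_decay h (n + 1) T hT
  refine ⟨C, hC0, fun s hs x => ?_⟩
  rw [om, ← div_eq_mul_inv, le_div_iff₀ (by positivity)]
  exact hC s hs x

lemma cont_bdd {c : ℝ × ℝ → ℝ} (hc : Continuous c) (M : ℝ) :
    ∃ C, 0 ≤ C ∧ ∀ x y, |x| ≤ M → |y| ≤ M → |c (x, y)| ≤ C := by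
  obtain ⟨C, hC⟩ := (isCompact_closedBall (0 : ℝ × ℝ) M).exists_bound_of_continuousOn hc.continuousOn
  refine ⟨|C|, abs_nonneg _, fun x y hx hy => (hC (x, y) ?_).trans (le_abs_self C)⟩
  simp [Prod.norm_def, hx, hy]

lemma int_of_om {f : Euc n → ℝ} (hf : Continuous f) {C : ℝ} (h : ∀ x, |f x| ≤ C * om x) :
    Integrable f :=
  (om_int.const_mul C).mono' hf.aestronglyMeasurable (Filter.Eventually.of_forall h)

lemma ibpD {f g : Euc n → ℝ} (i : Fin n) (hf : Differentiable ℝ f) (hg : Differentiable ℝ g)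
    (hf' : Continuous (pd i f)) (hg' : Continuous (pd i g)) {A B : ℝ}
    (h1 : ∀ x, |f x| ≤ A) (h2 : ∀ x, |pd i f x| ≤ A) (h3 : ∀ x, |g x| ≤ B * om x)
    (h4 : ∀ x, |pd i g x| ≤ B * om x) :
    ∫ x, f x * pd i g x = - ∫ x, pd i f x * g x := by
  have hA : 0 ≤ A := (abs_nonneg _).trans (h1 0)
  have key : ∀ {p q : Euc n → ℝ}, Continuous p → Continuous q → (∀ x, |p x| ≤ A) →
      (∀ x, |q x| ≤ B * om x) → Integrable (fun x => p x * q x) := by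
    intro p q hp hq h5 h6
    refine int_of_om (C := A * B) (hp.mul hq) fun x => ?_
    rw [abs_mul, mul_assoc]
    exact mul_le_mul (h5 x) (h6 x) (abs_nonneg _) hA
  exact integral_mul_fderiv_eq_neg_fderiv_mul_of_integrable (key hf' hg.continuous h2 h3)
    (key hf.continuous hg' h1 h4) (key hf.continuous hg.continuous h1 h3)
    (fun x _ => hf x) (fun x _ => hg x)

lemma Hs_cont {φ : Euc n → ℝ} (h : Cc φ) (s : ℝ) : Continuous (Hs s φ) := (Hs_diff h s).continuous

lemma Hs_lap {φ : Euc n → ℝ} (h : Cc φ) (s : ℝ) (x : Euc n) :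
    Hs s (lap φ) x = ∑ l, Hs s (pd l (pd l φ)) x := by
  rw [Hs]
  simp only [lap, Finset.sum_mul]
  rw [integral_finsetSum _ fun i _ => (Hs_integrable ((h.pd i).pd i) s x)]
  rfl

lemma ibpH {φ ψ : Euc n → ℝ} (hφ : Cc φ) (hψ : Cc ψ) (s : ℝ) (i : Fin n) :
    ∫ x, Hs s φ x * Hs s (pd i ψ) x = - ∫ x, Hs s (pd i φ) x * Hs s ψ x := by
  obtain ⟨A1, hA1, h1⟩ := Hs_om hφ |s| (abs_nonneg s)
  obtain ⟨A2, hA2, h2⟩ := Hs_om (hφ.pd i) |s| (abs_nonneg s)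
  obtain ⟨B1, hB1, h3⟩ := Hs_om hψ |s| (abs_nonneg s)
  obtain ⟨B2, hB2, h4⟩ := Hs_om (hψ.pd i) |s| (abs_nonneg s)
  have := ibpD (f := Hs s φ) (g := Hs s ψ) i (Hs_diff hφ s) (Hs_diff hψ s)
    (by rw [pd_Hs hφ]; exact Hs_cont (hφ.pd i) s) (by rw [pd_Hs hψ]; exact Hs_cont (hψ.pd i) s)
    (A := A1 + A2) (B := B1 + B2) (fun x => ?_) (fun x => ?_) (fun x => ?_) (fun x => ?_)
  · rwa [pd_Hs hφ, pd_Hs hψ] at this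
  · nlinarith [h1 s le_rfl x, om_le_one x, om_pos x]
  · rw [pd_Hs hφ]; nlinarith [h2 s le_rfl x, om_le_one x, om_pos x]
  · nlinarith [h3 s le_rfl x, om_le_one x, om_pos x]
  · rw [pd_Hs hψ]; nlinarith [h4 s le_rfl x, om_le_one x, om_pos x]

lemma intH {φ ψ : Euc n → ℝ} (hφ : Cc φ) (hψ : Cc ψ) (s : ℝ) :
    Integrable fun x => Hs s φ x * Hs s ψ x := by
  obtain ⟨A1, hA1, h1⟩ := Hs_om hφ |s| (abs_nonneg s)
  obtain ⟨B1, hB1, h3⟩ := Hs_om hψ |s| (abs_nonneg s)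
  refine int_of_om (C := A1 * B1) ((Hs_cont hφ s).mul (Hs_cont hψ s)) fun x => ?_
  rw [abs_mul, mul_assoc]
  exact mul_le_mul ((h1 s le_rfl x).trans (mul_le_of_le_one_right hA1 (om_le_one x))) (h3 s le_rfl x)
    (abs_nonneg _) hA1

variable {b b1 b2 b11 b12 b22 α β : ℝ × ℝ → ℝ} {κ : ℝ}

lemma Bell.hd (hb : Bell b b1 b2 b11 b12 b22 α β κ) {F G : ℝ → ℝ} {F' G' t : ℝ}
    (hF : HasDerivAt F F' t) (hG : HasDerivAt G G' t) :
    HasDerivAt (fun t => b (F t, G t)) (b1 (F t, G t) * F' + b2 (F t, G t) * G') t := by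
  have := (hb.d0 (F t, G t)).comp_hasDerivAt t (hF.prodMk hG)
  simpa [Function.comp_def] using this

lemma pd_c {c c1 c2 : ℝ × ℝ → ℝ}
    (hc : ∀ z, HasFDerivAt c (c1 z • ContinuousLinearMap.fst ℝ ℝ ℝ + c2 z • ContinuousLinearMap.snd ℝ ℝ ℝ) z)
    {F G : Euc n → ℝ} (hF : Differentiable ℝ F) (hG : Differentiable ℝ G) (l : Fin n) :
    Differentiable ℝ (fun x => c (F x, G x)) ∧
    pd l (fun x => c (F x, G x)) = fun x => c1 (F x, G x) * pd l F x + c2 (F x, G x) * pd l G x := by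
  have key : ∀ x, HasFDerivAt (fun x => c (F x, G x)) _ x := fun x =>
    (hc (F x, G x)).comp x ((hF x).hasFDerivAt.prodMk (hG x).hasFDerivAt)
  refine ⟨fun x => (key x).differentiableAt, ?_⟩
  ext x
  rw [pd, (key x).fderiv]
  simp [pd]

/-- integration by parts for `c(F,G) ΔK` -/
lemma ibp_c {c c1 c2 : ℝ × ℝ → ℝ}
    (hc : ∀ z, HasFDerivAt c (c1 z • ContinuousLinearMap.fst ℝ ℝ ℝ + c2 z • ContinuousLinearMap.snd ℝ ℝ ℝ) z)
    (hc1 : Continuous c1) (hc2 : Continuous c2)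
    {f g k : Euc n → ℝ} (hf : Cc f) (hg : Cc g) (hk : Cc k) (s : ℝ) (l : Fin n) :
    Integrable (fun x => c (Hs s f x, Hs s g x) * Hs s (pd l (pd l k)) x) ∧
    Integrable (fun x => (c1 (Hs s f x, Hs s g x) * Hs s (pd l f) x + c2 (Hs s f x, Hs s g x) * Hs s (pd l g) x) * Hs s (pd l k) x) ∧
    ∫ x, c (Hs s f x, Hs s g x) * Hs s (pd l (pd l k)) x =
      - ∫ x, (c1 (Hs s f x, Hs s g x) * Hs s (pd l f) x + c2 (Hs s f x, Hs s g x) * Hs s (pd l g) x) * Hs s (pd l k) x := by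
  have bd : ∀ {φ : Euc n → ℝ}, Cc φ → ∃ A, 0 ≤ A ∧ ∀ x, |Hs s φ x| ≤ A ∧ |Hs s φ x| ≤ A * om x := by
    intro φ h
    obtain ⟨A1, hA1, h1⟩ := Hs_om h |s| (abs_nonneg s)
    exact ⟨A1, hA1, fun x => ⟨(h1 s le_rfl x).trans (mul_le_of_le_one_right hA1 (om_le_one x)), h1 s le_rfl x⟩⟩
  obtain ⟨A1, hA1, h1⟩ := bd hf
  obtain ⟨A2, hA2, h2⟩ := bd hg
  obtain ⟨A3, hA3, h3⟩ := bd (hf.pd l)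
  obtain ⟨A4, hA4, h4⟩ := bd (hg.pd l)
  obtain ⟨B1, hB1, h5⟩ := bd (hk.pd l)
  obtain ⟨B2, hB2, h6⟩ := bd ((hk.pd l).pd l)
  have cc : Continuous c := continuous_iff_continuousAt.2 fun z => (hc z).continuousAt
  obtain ⟨D0, hD0, e0⟩ := cont_bdd cc (A1 + A2)
  obtain ⟨D1, hD1, e1⟩ := cont_bdd hc1 (A1 + A2)
  obtain ⟨D2, hD2, e2⟩ := cont_bdd hc2 (A1 + A2)
  have hF : ∀ x, |Hs s f x| ≤ A1 + A2 := fun x => by linarith [(h1 x).1]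
  have hG : ∀ x, |Hs s g x| ≤ A1 + A2 := fun x => by linarith [(h2 x).1]
  have cF := Hs_cont hf s
  have cG := Hs_cont hg s
  obtain ⟨P1, P2⟩ := pd_c hc (Hs_diff hf s) (Hs_diff hg s) l
  rw [pd_Hs hf, pd_Hs hg] at P2
  have cP : Continuous fun x => c1 (Hs s f x, Hs s g x) * Hs s (pd l f) x + c2 (Hs s f x, Hs s g x) * Hs s (pd l g) x := by
    have := Hs_cont (hf.pd l) s
    have := Hs_cont (hg.pd l) s
    fun_prop
  have bP : ∀ x, |c1 (Hs s f x, Hs s g x) * Hs s (pd l f) x + c2 (Hs s f x, Hs s g x) * Hs s (pd l g) x| ≤ D1 * A3 + D2 * A4 := by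
    intro x
    refine (abs_add_le _ _).trans ?_
    rw [abs_mul, abs_mul]
    have := e1 _ _ (hF x) (hG x)
    have := e2 _ _ (hF x) (hG x)
    have := (h3 x).1
    have := (h4 x).1
    gcongr
  have b0 := fun x => e0 _ _ (hF x) (hG x)
  refine ⟨?_, ?_, ?_⟩
  · refine int_of_om (C := D0 * B2) (P1.continuous.mul (Hs_cont ((hk.pd l).pd l) s)) fun x => ?_
    rw [abs_mul, mul_assoc]
    exact mul_le_mul (b0 x) (h6 x).2 (abs_nonneg _) hD0
  · refine int_of_om (C := (D1 * A3 + D2 * A4) * B1) (cP.mul (Hs_cont (hk.pd l) s)) fun x => ?_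
    rw [abs_mul, mul_assoc]
    exact mul_le_mul (bP x) (h5 x).2 (abs_nonneg _) (by positivity)
  · have := ibpD (f := fun x => c (Hs s f x, Hs s g x)) (g := Hs s (pd l k)) l P1 (Hs_diff (hk.pd l) s)
      (by rw [P2]; exact cP) (by rw [pd_Hs (hk.pd l)]; exact Hs_cont ((hk.pd l).pd l) s)
      (A := D0 + (D1 * A3 + D2 * A4)) (B := B1 + B2)
      (fun x => (b0 x).trans (by have : 0 ≤ D1 * A3 + D2 * A4 := by positivity
                                 linarith))
      (fun x => by rw [P2]; exact (bP x).trans (by linarith))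
      (fun x => (h5 x).2.trans (by have := (om_pos x).le; gcongr; linarith))
      (fun x => by rw [pd_Hs (hk.pd l)]
                   exact (h6 x).2.trans (by have := (om_pos x).le; gcongr; linarith))
    rwa [pd_Hs (hk.pd l), P2] at this

end bell

section bell2
variable {n : ℕ} {b b1 b2 b11 b12 b22 α β : ℝ × ℝ → ℝ} {κ : ℝ}

lemma Cc.comm {φ : Euc n → ℝ} (h : Cc φ) (i j : Fin n) :
    _root_.pd i (_root_.pd j φ) = _root_.pd j (_root_.pd i φ) :=
  funext fun x => pd_comm (h.1.of_le (by norm_cast)) i j x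

lemma Cc.lap_pd {φ : Euc n → ℝ} (h : Cc φ) (i : Fin n) : _root_.lap (_root_.pd i φ) = _root_.pd i (_root_.lap φ) := by
  ext x
  unfold _root_.lap
  rw [pd_sum fun l _ => ((h.pd l).pd l).diff x]
  refine Finset.sum_congr rfl fun l _ => ?_
  rw [h.comm l i, (h.pd l).comm l i]

lemma quad_ab {a c k x y : ℝ} (ha : 0 ≤ a) (hc : 0 ≤ c) (hk : 0 ≤ k) (h : k ^ 2 ≤ a * c) :
    0 ≤ a * x ^ 2 + c * y ^ 2 + 2 * k * x * y := by
  rcases ha.eq_or_lt with h0 | h0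
  · subst h0
    have : k = 0 := by nlinarith
    subst this; nlinarith [mul_nonneg hc (sq_nonneg y)]
  · have : 0 ≤ a * (a * x ^ 2 + c * y ^ 2 + 2 * k * x * y) := by
      nlinarith [sq_nonneg (a * x + k * y), mul_nonneg (sub_nonneg.2 h) (sq_nonneg y)]
    exact nonneg_of_mul_nonneg_right this h0

lemma Bell.J_nonpos (hb : Bell b b1 b2 b11 b12 b22 α β κ) {v g : Euc n → ℝ} (hv : Cc v) (hg : Cc g)
    (i j : Fin n) (s : ℝ) :
    ∫ x, (b1 (Hs s (lap v) x, Hs s g x) * Hs s (lap (lap v)) x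
      + b2 (Hs s (lap v) x, Hs s g x) * Hs s (lap g) x
      + κ * (Hs s (lap (pd i (pd j v))) x * Hs s g x + Hs s (pd i (pd j v)) x * Hs s (lap g) x)) ≤ 0 := by
  have hf := hv.lap
  set f := lap v with hfdef
  have c1 : Continuous b1 := continuous_iff_continuousAt.2 fun z => (hb.d1 z).continuousAt
  have c2 : Continuous b2 := continuous_iff_continuousAt.2 fun z => (hb.d2 z).continuousAt
  have I1 := fun l => ibp_c hb.d1 hb.c11 hb.c12 hf hg hf s l
  have I2 := fun l => ibp_c hb.d2 hb.c12 hb.c22 hf hg hg s l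
  have hw := (hv.pd j).pd i
  set w := pd i (pd j v) with hwdef
  have hlw : lap w = pd i (pd j f) := by
    rw [hwdef, (hv.pd j).lap_pd, hv.lap_pd]
  have i3 : ∫ x, Hs s (lap w) x * Hs s g x = - ∫ x, Hs s (pd j f) x * Hs s (pd i g) x := by
    rw [hlw]
    have := ibpH (hf.pd j) hg s i
    linarith
  have i4 : ∫ x, Hs s w x * Hs s (lap g) x = ∫ x, Hs s (lap w) x * Hs s g x := by
    simp only [Hs_lap hg, Hs_lap hw, Finset.mul_sum, Finset.sum_mul]
    rw [integral_finsetSum _ fun l _ => intH hw ((hg.pd l).pd l) s,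
      integral_finsetSum _ fun l _ => intH ((hw.pd l).pd l) hg s]
    refine Finset.sum_congr rfl fun l _ => ?_
    rw [ibpH hw (hg.pd l), ibpH (hw.pd l) hg, neg_neg]
  have e1 : ∀ x, b1 (Hs s f x, Hs s g x) * Hs s (lap f) x = ∑ l, b1 (Hs s f x, Hs s g x) * Hs s (pd l (pd l f)) x := by
    intro x; rw [Hs_lap hf, Finset.mul_sum]
  have e2 : ∀ x, b2 (Hs s f x, Hs s g x) * Hs s (lap g) x = ∑ l, b2 (Hs s f x, Hs s g x) * Hs s (pd l (pd l g)) x := by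
    intro x; rw [Hs_lap hg, Finset.mul_sum]
  have n1 : Integrable fun x => b1 (Hs s f x, Hs s g x) * Hs s (lap f) x := by
    simp only [e1]; exact integrable_finsetSum _ fun l _ => (I1 l).1
  have n2 : Integrable fun x => b2 (Hs s f x, Hs s g x) * Hs s (lap g) x := by
    simp only [e2]; exact integrable_finsetSum _ fun l _ => (I2 l).1
  have n3 := intH hw.lap hg s
  have n4 := intH hw hg.lap s
  have n12 : Integrable fun x => b1 (Hs s f x, Hs s g x) * Hs s (lap f) x + b2 (Hs s f x, Hs s g x) * Hs s (lap g) x := n1.add n2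
  have n34 : Integrable fun x => κ * (Hs s (lap w) x * Hs s g x + Hs s w x * Hs s (lap g) x) := (n3.add n4).const_mul κ
  rw [integral_add n12 n34, integral_add n1 n2, integral_const_mul,
    integral_add n3 n4, i4, i3]
  simp only [e1, e2]
  rw [integral_finsetSum _ fun l _ => (I1 l).1, integral_finsetSum _ fun l _ => (I2 l).1,
    ← Finset.sum_add_distrib]
  have n5 := intH (hf.pd j) (hg.pd i) s
  have : 0 ≤ ∫ x, (∑ l, ((b11 (Hs s f x, Hs s g x) * Hs s (pd l f) x + b12 (Hs s f x, Hs s g x) * Hs s (pd l g) x) * Hs s (pd l f) x + (b12 (Hs s f x, Hs s g x) * Hs s (pd l f) x + b22 (Hs s f x, Hs s g x) * Hs s (pd l g) x) * Hs s (pd l g) x)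
      + 2 * κ * (Hs s (pd j f) x * Hs s (pd i g) x)) := by
    refine integral_nonneg fun x => ?_
    simp only [Pi.zero_apply]
    set z := (Hs s f x, Hs s g x)
    have h1 : ∀ l, α z * Hs s (pd l f) x ^ 2 + β z * Hs s (pd l g) x ^ 2 ≤
      (b11 z * Hs s (pd l f) x + b12 z * Hs s (pd l g) x) * Hs s (pd l f) x + (b12 z * Hs s (pd l f) x + b22 z * Hs s (pd l g) x) * Hs s (pd l g) x := by
      intro l
      have := hb.conv z (Hs s (pd l f) x) (Hs s (pd l g) x)
      linarith
    have h2 := Finset.sum_le_sum fun l (_ : l ∈ Finset.univ) => h1 l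
    rw [Finset.sum_add_distrib] at h2
    have h3 := Finset.single_le_sum (f := fun l => α z * Hs s (pd l f) x ^ 2)
      (fun l _ => mul_nonneg (hb.α0 z) (sq_nonneg _)) (Finset.mem_univ j)
    have h4 := Finset.single_le_sum (f := fun l => β z * Hs s (pd l g) x ^ 2)
      (fun l _ => mul_nonneg (hb.β0 z) (sq_nonneg _)) (Finset.mem_univ i)
    have h5 := quad_ab (x := Hs s (pd j f) x) (y := Hs s (pd i g) x) (hb.α0 z) (hb.β0 z) hb.κ0 (hb.αβ z)
    linarith
  have I12 : ∀ l, Integrable fun x => (b11 (Hs s f x, Hs s g x) * Hs s (pd l f) x + b12 (Hs s f x, Hs s g x) * Hs s (pd l g) x) * Hs s (pd l f) x + (b12 (Hs s f x, Hs s g x) * Hs s (pd l f) x + b22 (Hs s f x, Hs s g x) * Hs s (pd l g) x) * Hs s (pd l g) x := fun l => (I1 l).2.1.add (I2 l).2.1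
  rw [integral_add (integrable_finsetSum _ fun l _ => I12 l) (n5.const_mul _),
    integral_finsetSum _ fun l _ => I12 l, integral_const_mul] at this
  have e3 : ∑ l, ((∫ x, b1 (Hs s f x, Hs s g x) * Hs s (pd l (pd l f)) x) + ∫ x, b2 (Hs s f x, Hs s g x) * Hs s (pd l (pd l g)) x)
    = - ∑ l, ∫ x, ((b11 (Hs s f x, Hs s g x) * Hs s (pd l f) x + b12 (Hs s f x, Hs s g x) * Hs s (pd l g) x) * Hs s (pd l f) x + (b12 (Hs s f x, Hs s g x) * Hs s (pd l f) x + b22 (Hs s f x, Hs s g x) * Hs s (pd l g) x) * Hs s (pd l g) x) := by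
    rw [← Finset.sum_neg_distrib]
    refine Finset.sum_congr rfl fun l _ => ?_
    rw [(I1 l).2.2, (I2 l).2.2, integral_add (I1 l).2.1 (I2 l).2.1]
    ring
  rw [e3]
  linarith

lemma Bell.lip (hb : Bell b b1 b2 b11 b12 b22 α β κ) (M : ℝ) :
    ∃ C, 0 ≤ C ∧ ∀ x y, |x| ≤ M → |y| ≤ M → |b (x, y)| ≤ C * (|x| + |y|) := by
  have c1 : Continuous b1 := continuous_iff_continuousAt.2 fun z => (hb.d1 z).continuousAt
  have c2 : Continuous b2 := continuous_iff_continuousAt.2 fun z => (hb.d2 z).continuousAt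
  obtain ⟨C1, h1, hC1⟩ := cont_bdd c1 M
  obtain ⟨C2, h2, hC2⟩ := cont_bdd c2 M
  refine ⟨C1 + C2, by positivity, fun x y hx hy => ?_⟩
  have hM : 0 ≤ M := (abs_nonneg _).trans hx
  have := (convex_closedBall (0 : ℝ × ℝ) M).norm_image_sub_le_of_norm_hasFDerivWithin_le (C := C1 + C2)
    (x := (0, 0)) (y := (x, y)) (fun z _ => (hb.d0 z).hasFDerivWithinAt) (fun z hz => ?_)
    (by simp [hM]) (by simp [Prod.norm_def, hx, hy])
  · rw [hb.zero, sub_zero, Real.norm_eq_abs] at this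
    refine this.trans ?_
    gcongr
    simp only [Prod.mk_zero_zero, sub_zero, Prod.norm_def, Real.norm_eq_abs]
    exact max_le (by linarith [abs_nonneg y]) (by linarith [abs_nonneg x])
  · simp only [mem_closedBall, dist_zero_right, Prod.norm_def, Real.norm_eq_abs, sup_le_iff] at hz
    refine (norm_add_le _ _).trans ?_
    rw [norm_smul, norm_smul]
    have a1 := hC1 z.1 z.2 hz.1 hz.2
    have a2 := hC2 z.1 z.2 hz.1 hz.2
    have a3 := ContinuousLinearMap.norm_fst_le ℝ ℝ ℝ
    have a4 := ContinuousLinearMap.norm_snd_le ℝ ℝ ℝ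
    simp only [Prod.mk.eta, ← Real.norm_eq_abs] at a1 a2
    nlinarith [norm_nonneg (b1 z), norm_nonneg (b2 z)]

lemma Bell.psi_deriv (hb : Bell b b1 b2 b11 b12 b22 α β κ) {f g w : Euc n → ℝ} (hf : Cc f) (hg : Cc g)
    (hw : Cc w) (s : ℝ) :
    Integrable (fun x => b (Hs s f x, Hs s g x)) ∧
    HasDerivAt (fun s => ∫ x, (b (Hs s f x, Hs s g x) + κ * (Hs s w x * Hs s g x)))
      (s / (2 * π) * ∫ x, (b1 (Hs s f x, Hs s g x) * Hs s (lap f) x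
      + b2 (Hs s f x, Hs s g x) * Hs s (lap g) x
      + κ * (Hs s (lap w) x * Hs s g x + Hs s w x * Hs s (lap g) x))) s := by
  have c0 : Continuous b := continuous_iff_continuousAt.2 fun z => (hb.d0 z).continuousAt
  have c1 : Continuous b1 := continuous_iff_continuousAt.2 fun z => (hb.d1 z).continuousAt
  have c2 : Continuous b2 := continuous_iff_continuousAt.2 fun z => (hb.d2 z).continuousAt
  set T := |s| + 1 with hT
  have hT0 : 0 ≤ T := by positivity
  have bd : ∀ {φ : Euc n → ℝ}, Cc φ → ∃ A, 0 ≤ A ∧ ∀ r, |r| ≤ T → ∀ x, |Hs r φ x| ≤ A ∧ |Hs r φ x| ≤ A * om x := by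
    intro φ h
    obtain ⟨A1, hA1, h1⟩ := Hs_om h T hT0
    exact ⟨A1, hA1, fun r hr x => ⟨(h1 r hr x).trans (mul_le_of_le_one_right hA1 (om_le_one x)), h1 r hr x⟩⟩
  obtain ⟨A1, hA1, h1⟩ := bd hf
  obtain ⟨A2, hA2, h2⟩ := bd hg
  obtain ⟨A3, hA3, h3⟩ := bd hf.lap
  obtain ⟨A4, hA4, h4⟩ := bd hg.lap
  obtain ⟨A5, hA5, h5⟩ := bd hw
  obtain ⟨A6, hA6, h6⟩ := bd hw.lap
  obtain ⟨D0, hD0, e0⟩ := hb.lip (A1 + A2)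
  obtain ⟨D1, hD1, e1⟩ := cont_bdd c1 (A1 + A2)
  obtain ⟨D2, hD2, e2⟩ := cont_bdd c2 (A1 + A2)
  have hF : ∀ r, |r| ≤ T → ∀ x, |Hs r f x| ≤ A1 + A2 := fun r hr x => by linarith [(h1 r hr x).1]
  have hG : ∀ r, |r| ≤ T → ∀ x, |Hs r g x| ≤ A1 + A2 := fun r hr x => by linarith [(h2 r hr x).1]
  have hsT : |s| ≤ T := by linarith
  have cb : ∀ r, Continuous fun x => b (Hs r f x, Hs r g x) := fun r =>
    c0.comp ((Hs_cont hf r).prodMk (Hs_cont hg r))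
  have hbint : Integrable (fun x => b (Hs s f x, Hs s g x)) := by
    refine int_of_om (C := D0 * (A1 + A2)) (cb s) fun x => ?_
    refine (e0 _ _ (hF s hsT x) (hG s hsT x)).trans ?_
    rw [mul_assoc, add_mul]
    have := (h1 s hsT x).2
    have := (h2 s hsT x).2
    gcongr
  refine ⟨hbint, ?_⟩
  rw [← integral_const_mul]
  have hcF : ∀ r, Continuous fun x => b1 (Hs r f x, Hs r g x) * Hs r (lap f) x
      + b2 (Hs r f x, Hs r g x) * Hs r (lap g) x
      + κ * (Hs r (lap w) x * Hs r g x + Hs r w x * Hs r (lap g) x) := by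
    intro r
    have := Hs_cont hf r
    have := Hs_cont hg r
    have := Hs_cont hw r
    have := Hs_cont hf.lap r
    have := Hs_cont hg.lap r
    have := Hs_cont hw.lap r
    fun_prop
  refine (hasDerivAt_integral_of_dominated_loc_of_deriv_le (s := Metric.ball s 1)
    (bound := fun x => T * (D1 * A3 + D2 * A4 + κ * (A6 * A2 + A5 * A4)) * om x)
    (F := fun r x => b (Hs r f x, Hs r g x) + κ * (Hs r w x * Hs r g x))
    (F' := fun r x => r / (2 * π) * (b1 (Hs r f x, Hs r g x) * Hs r (lap f) x
      + b2 (Hs r f x, Hs r g x) * Hs r (lap g) x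
      + κ * (Hs r (lap w) x * Hs r g x + Hs r w x * Hs r (lap g) x)))
    (Metric.ball_mem_nhds s one_pos) ?_ ?_ ?_ ?_ ?_ ?_).2
  · exact Filter.Eventually.of_forall fun r => ((cb r).add (continuous_const.mul ((Hs_cont hw r).mul (Hs_cont hg r)))).aestronglyMeasurable
  · exact hbint.add ((intH hw hg s).const_mul κ)
  · exact (continuous_const.mul (hcF s)).aestronglyMeasurable
  · refine Filter.Eventually.of_forall fun x r hr => ?_
    have hrT : |r| ≤ T := by
      rw [mem_ball, Real.dist_eq] at hr
      have := abs_sub_abs_le_abs_sub r s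
      linarith
    rw [norm_mul, mul_assoc]
    have q1 : ‖r / (2 * π)‖ ≤ T := by
      rw [norm_div, Real.norm_eq_abs, Real.norm_of_nonneg (by positivity), div_le_iff₀ (by positivity)]
      nlinarith [Real.pi_gt_three]
    refine mul_le_mul q1 ?_ (norm_nonneg _) hT0
    have ho := om_pos x
    have hκ := hb.κ0
    have a1 : |b1 (Hs r f x, Hs r g x) * Hs r (lap f) x| ≤ D1 * (A3 * om x) := by
      rw [abs_mul]; exact mul_le_mul (e1 _ _ (hF r hrT x) (hG r hrT x)) (h3 r hrT x).2 (abs_nonneg _) hD1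
    have a2 : |b2 (Hs r f x, Hs r g x) * Hs r (lap g) x| ≤ D2 * (A4 * om x) := by
      rw [abs_mul]; exact mul_le_mul (e2 _ _ (hF r hrT x) (hG r hrT x)) (h4 r hrT x).2 (abs_nonneg _) hD2
    have a3 : |Hs r (lap w) x * Hs r g x| ≤ A6 * (A2 * om x) := by
      rw [abs_mul]; exact mul_le_mul (h6 r hrT x).1 (h2 r hrT x).2 (abs_nonneg _) hA6
    have a4 : |Hs r w x * Hs r (lap g) x| ≤ A5 * (A4 * om x) := by
      rw [abs_mul]; exact mul_le_mul (h5 r hrT x).1 (h4 r hrT x).2 (abs_nonneg _) hA5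
    have a5 := (abs_add_le (Hs r (lap w) x * Hs r g x) (Hs r w x * Hs r (lap g) x)).trans (add_le_add a3 a4)
    have a6 : |κ * (Hs r (lap w) x * Hs r g x + Hs r w x * Hs r (lap g) x)| ≤ κ * (A6 * (A2 * om x) + A5 * (A4 * om x)) := by
      rw [abs_mul, abs_of_nonneg hκ]; gcongr
    rw [Real.norm_eq_abs]
    refine (abs_add_le _ _).trans ?_
    refine (add_le_add ((abs_add_le _ _).trans (add_le_add a1 a2)) a6).trans (le_of_eq ?_)
    ring
  · exact om_int.const_mul _
  · refine Filter.Eventually.of_forall fun x r hr => ?_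
    have dF := Hs_hasDerivAt hf x r
    have dG := Hs_hasDerivAt hg x r
    have dW := Hs_hasDerivAt hw x r
    refine ((hb.hd dF dG).add ((dW.mul dG).const_mul κ)).congr_deriv ?_
    ring

lemma Bell.main (hb : Bell b b1 b2 b11 b12 b22 α β κ) (hn : n ≠ 0) {v g : Euc n → ℝ} (hv : Cc v) (hg : Cc g)
    (i j : Fin n) : 0 ≤ ∫ x, (b (lap v x, g x) + κ * (pd i (pd j v) x * g x)) := by
  have hf := hv.lap
  have hw := (hv.pd j).pd i
  set Ψ : ℝ → ℝ := fun s => ∫ x, (b (Hs s (lap v) x, Hs s g x) + κ * (Hs s (pd i (pd j v)) x * Hs s g x)) with hΨ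
  have hd := fun s => (hb.psi_deriv hf hg hw s).2
  have hanti : AntitoneOn Ψ (Ici 0) := by
    refine antitoneOn_of_deriv_nonpos (convex_Ici 0) (fun s _ => (hd s).continuousAt.continuousWithinAt)
      (fun s _ => (hd s).differentiableAt.differentiableWithinAt) fun s hs => ?_
    rw [(hd s).deriv]
    rw [interior_Ici] at hs
    exact mul_nonpos_of_nonneg_of_nonpos (div_nonneg (le_of_lt hs) (by positivity)) (hb.J_nonpos hv hg i j s)
  have hΨ0 : Ψ 0 = ∫ x, (b (lap v x, g x) + κ * (pd i (pd j v) x * g x)) := by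
    simp only [hΨ, Hs_zero]
  rw [← hΨ0]
  set A := ∫ y, |pd i (pd j v) y|
  set B := ∫ y, |g y|
  have hlow : ∀ s : ℝ, 1 ≤ s → -(κ * (A * B)) * s⁻¹ ≤ Ψ 0 := by
    intro s hs
    have hs0 : 0 < s := by linarith
    refine le_trans ?_ (hanti (by simp) (show s ∈ Ici (0:ℝ) from hs0.le) hs0.le)
    have hA : 0 ≤ A := integral_nonneg fun _ => abs_nonneg _
    have hB : 0 ≤ B := integral_nonneg fun _ => abs_nonneg _
    have i1 := intH hw hg s
    have h1 : Ψ s = (∫ x, b (Hs s (lap v) x, Hs s g x)) + κ * ∫ x, Hs s (pd i (pd j v)) x * Hs s g x := by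
      simp only [hΨ]
      rw [integral_add (hb.psi_deriv hf hg hw s).1 (i1.const_mul κ), integral_const_mul]
    have h2 : 0 ≤ ∫ x, b (Hs s (lap v) x, Hs s g x) := integral_nonneg fun _ => hb.nonneg _
    have h3 : |∫ x, Hs s (pd i (pd j v)) x * Hs s g x| ≤ s⁻¹ * A * B := by
      refine (abs_integral_le_integral_abs).trans ?_
      have : ∫ x, |Hs s (pd i (pd j v)) x * Hs s g x| ≤ ∫ x, s⁻¹ * A * |Hs s g x| := by
        refine integral_mono_of_nonneg (Filter.Eventually.of_forall fun _ => abs_nonneg _) ?_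
          (Filter.Eventually.of_forall fun x => ?_)
        · obtain ⟨C, _, hC⟩ := Hs_om hg |s| (abs_nonneg s)
          exact (int_of_om (Hs_cont hg s) (hC s le_rfl)).abs.const_mul _
        · simp only [abs_mul]
          gcongr
          refine (Hs_sup hw hs0 x).trans ?_
          gcongr
          exact le_self_pow₀ hs hn
      refine this.trans ?_
      rw [integral_const_mul]
      gcongr
      exact Hs_L1 hg s
    rw [h1]
    have h4 := (abs_le.1 h3).1
    have := mul_le_mul_of_nonneg_left h4 hb.κ0
    linarith
  have hlim : Filter.Tendsto (fun s : ℝ => -(κ * (A * B)) * s⁻¹) Filter.atTop (𝓝 0) := by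
    simpa using tendsto_inv_atTop_zero.const_mul (-(κ * (A * B)))
  exact le_of_tendsto hlim (Filter.eventually_atTop.2 ⟨1, fun s hs => hlow s hs⟩)

end bell2

section bf
def PP (η : ℝ) (M : ℕ) (z : ℝ × ℝ) : ℝ := η ^ 2 + z.2 ^ 2 + z.1 ^ (2 * M + 2)

lemma PP_pos {η : ℝ} (h : 0 < η) (M : ℕ) (z : ℝ × ℝ) : 0 < PP η M z := by
  have : 0 ≤ z.1 ^ (2 * M + 2) := (even_two_mul (M+1)).pow_nonneg _
  unfold PP; positivity

lemma PP_d (η : ℝ) (M : ℕ) (z : ℝ × ℝ) : HasFDerivAt (PP η M)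
    (((2 * M + 2 : ℝ) * z.1 ^ (2 * M + 1)) • ContinuousLinearMap.fst ℝ ℝ ℝ + (2 * z.2) • ContinuousLinearMap.snd ℝ ℝ ℝ) z := by
  have hF : HasFDerivAt (fun z : ℝ × ℝ => z.1) (ContinuousLinearMap.fst ℝ ℝ ℝ) z := hasFDerivAt_fst
  have hG : HasFDerivAt (fun z : ℝ × ℝ => z.2) (ContinuousLinearMap.snd ℝ ℝ ℝ) z := hasFDerivAt_snd
  refine (((hG.pow 2).const_add (η ^ 2)).add (hF.pow (2 * M + 2))).congr_fderiv ?_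
  ext <;> simp

/-- product derivative helper -/
lemma d_mul {f g : ℝ × ℝ → ℝ} {f1 f2 g1 g2 h1 h2 : ℝ} {z : ℝ × ℝ}
    (hf : HasFDerivAt f (f1 • ContinuousLinearMap.fst ℝ ℝ ℝ + f2 • ContinuousLinearMap.snd ℝ ℝ ℝ) z)
    (hg : HasFDerivAt g (g1 • ContinuousLinearMap.fst ℝ ℝ ℝ + g2 • ContinuousLinearMap.snd ℝ ℝ ℝ) z)
    (e1 : f z * g1 + g z * f1 = h1) (e2 : f z * g2 + g z * f2 = h2) :
    HasFDerivAt (fun z => f z * g z) (h1 • ContinuousLinearMap.fst ℝ ℝ ℝ + h2 • ContinuousLinearMap.snd ℝ ℝ ℝ) z := by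
  refine (hf.mul hg).congr_fderiv ?_
  ext <;> simp <;> linarith

lemma d_add {f g : ℝ × ℝ → ℝ} {f1 f2 g1 g2 h1 h2 : ℝ} {z : ℝ × ℝ}
    (hf : HasFDerivAt f (f1 • ContinuousLinearMap.fst ℝ ℝ ℝ + f2 • ContinuousLinearMap.snd ℝ ℝ ℝ) z)
    (hg : HasFDerivAt g (g1 • ContinuousLinearMap.fst ℝ ℝ ℝ + g2 • ContinuousLinearMap.snd ℝ ℝ ℝ) z)
    (e1 : f1 + g1 = h1) (e2 : f2 + g2 = h2) :
    HasFDerivAt (fun z => f z + g z) (h1 • ContinuousLinearMap.fst ℝ ℝ ℝ + h2 • ContinuousLinearMap.snd ℝ ℝ ℝ) z := by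
  refine (hf.add hg).congr_fderiv ?_
  ext <;> simp <;> linarith

lemma d_rpow {f : ℝ × ℝ → ℝ} {f1 f2 : ℝ} {z : ℝ × ℝ} (a : ℝ)
    (hf : HasFDerivAt f (f1 • ContinuousLinearMap.fst ℝ ℝ ℝ + f2 • ContinuousLinearMap.snd ℝ ℝ ℝ) z) (h0 : 0 < f z) :
    HasFDerivAt (fun z => f z ^ a) ((a * f z ^ (a - 1) * f1) • ContinuousLinearMap.fst ℝ ℝ ℝ + (a * f z ^ (a - 1) * f2) • ContinuousLinearMap.snd ℝ ℝ ℝ) z := by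
  refine (hf.rpow_const (Or.inl h0.ne')).congr_fderiv ?_
  ext <;> simp

lemma d_F (N : ℕ) (A : ℝ) (z : ℝ × ℝ) : HasFDerivAt (fun z : ℝ × ℝ => A * z.1 ^ (N + 1))
    ((A * (N + 1) * z.1 ^ N) • ContinuousLinearMap.fst ℝ ℝ ℝ + (0:ℝ) • ContinuousLinearMap.snd ℝ ℝ ℝ) z := by
  have hF : HasFDerivAt (fun z : ℝ × ℝ => z.1) (ContinuousLinearMap.fst ℝ ℝ ℝ) z := hasFDerivAt_fst
  refine ((hF.pow (N + 1)).const_mul A).congr_fderiv ?_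
  ext <;> simp; ring

lemma d_G (A : ℝ) (z : ℝ × ℝ) : HasFDerivAt (fun z : ℝ × ℝ => A * z.2)
    ((0:ℝ) • ContinuousLinearMap.fst ℝ ℝ ℝ + A • ContinuousLinearMap.snd ℝ ℝ ℝ) z := by
  have hG : HasFDerivAt (fun z : ℝ × ℝ => z.2) (ContinuousLinearMap.snd ℝ ℝ ℝ) z := hasFDerivAt_snd
  refine (hG.const_mul A).congr_fderiv ?_
  ext <;> simp

def QQ (η : ℝ) (z : ℝ × ℝ) : ℝ := η ^ 2 + z.2 ^ 2

lemma QQ_d (η : ℝ) (z : ℝ × ℝ) : HasFDerivAt (QQ η)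
    ((0:ℝ) • ContinuousLinearMap.fst ℝ ℝ ℝ + (2 * z.2) • ContinuousLinearMap.snd ℝ ℝ ℝ) z := by
  have hG : HasFDerivAt (fun z : ℝ × ℝ => z.2) (ContinuousLinearMap.snd ℝ ℝ ℝ) z := hasFDerivAt_snd
  refine ((hG.pow 2).const_add (η ^ 2)).congr_fderiv ?_
  ext <;> simp

set_option maxHeartbeats 1000000 in
lemma bell_exists (M : ℕ) (hM : 1 ≤ M) : ∃ K : ℝ, 0 ≤ K ∧ ∀ η : ℝ, 0 < η → ∃ b1 b2 b11 b12 b22 α β : ℝ × ℝ → ℝ,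
    Bell (fun z => 1 * z.1 ^ 2 * PP η M z ^ ((M:ℝ) / (2 * (M + 1)))
      + K * ((QQ η z) ^ (((M:ℝ) + 2) / (2 * (M + 1))) - (η ^ 2) ^ (((M:ℝ) + 2) / (2 * (M + 1))))) b1 b2 b11 b12 b22 α β 1 := by
  set a : ℝ := (M:ℝ) / (2 * (M + 1)) with ha
  set c : ℝ := ((M:ℝ) + 2) / (2 * (M + 1)) with hc
  have hM' : (1:ℝ) ≤ M := by exact_mod_cast hM
  have hM1 : (0:ℝ) < M + 1 := by positivity
  have hca : c - 1 = -a := by rw [ha, hc]; field_simp; ring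
  have ha0 : 0 ≤ a := by positivity
  have ha1 : a ≤ 1 / 2 := by rw [ha, div_le_div_iff₀ (by positivity) (by norm_num)]; nlinarith
  have he : 1 / ((M:ℝ) + 1) = 1 - 2 * a := by rw [ha]; field_simp; ring
  set N : ℝ := 2 * M + 2 with hN
  set K : ℝ := (M + 1) * (3 + (2 + N) ^ 2) with hK
  have hK0 : 0 ≤ K := by positivity
  refine ⟨K, hK0, fun η hη => ?_⟩
  have hP := fun z => PP_pos hη M z
  have hQ : ∀ z, 0 < QQ η z := fun z => by unfold QQ; positivity
  have hcP : Continuous (PP η M) := by unfold PP; fun_prop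
  have hcQ : Continuous (QQ η) := by unfold QQ; fun_prop
  have hrP : ∀ r : ℝ, Continuous fun z => PP η M z ^ r := fun r => hcP.rpow_const fun z => Or.inl (hP z).ne'
  have hrQ : ∀ r : ℝ, Continuous fun z => QQ η z ^ r := fun r => hcQ.rpow_const fun z => Or.inl (hQ z).ne'
  refine ⟨fun z => 2 * z.1 ^ (0 + 1) * PP η M z ^ a + a * N * z.1 ^ (2 * M + 2 + 1) * PP η M z ^ (a - 1),
    fun z => 2 * a * z.1 ^ (1 + 1) * (1 * z.2 * PP η M z ^ (a - 1)) + 2 * K * c * z.2 * QQ η z ^ (c - 1),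
    fun z => 2 * PP η M z ^ a + a * N * (N + 3) * z.1 ^ (2 * M + 2) * PP η M z ^ (a - 1)
      - a * N * N * (1 - a) * z.1 ^ (2 * (2 * M + 2)) * PP η M z ^ (a - 1 - 1),
    fun z => 4 * a * (z.1 * z.2) * PP η M z ^ (a - 1) - 2 * a * (1 - a) * N * z.1 ^ (2 * M + 2) * (z.1 * z.2) * PP η M z ^ (a - 1 - 1),
    fun z => 2 * a * z.1 ^ 2 * PP η M z ^ (a - 1) - 4 * a * (1 - a) * z.1 ^ 2 * z.2 ^ 2 * PP η M z ^ (a - 1 - 1)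
      + K * (2 * c * QQ η z ^ (c - 1) - 4 * c * (1 - c) * z.2 ^ 2 * QQ η z ^ (c - 1 - 1)),
    fun z => PP η M z ^ a, fun z => PP η M z ^ (-a), ?_, ?_, ?_, ?_, ?_, ?_, ?_, ?_, ?_, ?_, ?_, ?_, ?_⟩
  · intro z
    have hq : HasFDerivAt (fun z => K * (QQ η z ^ c - (η ^ 2) ^ c))
        ((0:ℝ) • ContinuousLinearMap.fst ℝ ℝ ℝ + (2 * K * c * z.2 * QQ η z ^ (c - 1)) • ContinuousLinearMap.snd ℝ ℝ ℝ) z := by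
      refine (((d_rpow c (QQ_d η z) (hQ z)).sub_const ((η ^ 2) ^ c)).const_mul K).congr_fderiv ?_
      ext <;> simp; ring
    refine d_add (d_mul (d_F 1 1 z) (d_rpow a (PP_d η M z) (hP z)) rfl rfl) hq ?_ ?_
    · push_cast; ring
    · ring
  · intro z
    refine d_add (d_mul (d_F 0 2 z) (d_rpow a (PP_d η M z) (hP z)) rfl rfl)
      (d_mul (d_F (2 * M + 2) (a * N) z) (d_rpow (a-1) (PP_d η M z) (hP z)) rfl rfl) ?_ ?_
    · push_cast; simp only [hN]; ring
    · push_cast; simp only [hN]; ring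
  · intro z
    refine d_add (d_mul (d_F 1 (2 * a) z) (d_mul (d_G 1 z) (d_rpow (a-1) (PP_d η M z) (hP z)) rfl rfl) rfl rfl)
      (d_mul (d_G (2 * K * c) z) (d_rpow (c-1) (QQ_d η z) (hQ z)) rfl rfl) ?_ ?_
    · push_cast; simp only [hN]; ring
    · push_cast; ring
  · have := hrP a; have := hrP (a-1); have := hrP (a-1-1); fun_prop
  · have := hrP a; have := hrP (a-1); have := hrP (a-1-1); fun_prop
  · have := hrP (a-1); have := hrP (a-1-1); have := hrQ (c-1); have := hrQ (c-1-1); fun_prop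
  · intro z
    have h1 := (rpow_pos_of_pos (hP z) a).le
    have h2 : (η ^ 2) ^ c ≤ QQ η z ^ c := rpow_le_rpow (by positivity) (by unfold QQ; linarith [sq_nonneg z.2]) (by positivity)
    have := mul_nonneg hK0 (sub_nonneg.2 h2)
    positivity
  · simp [QQ]
  · norm_num
  · intro z; exact (rpow_pos_of_pos (hP z) _).le
  · intro z; exact (rpow_pos_of_pos (hP z) _).le
  · intro z; rw [← rpow_add (hP z)]; simp
  · intro z x y
    set P := PP η M z with hPd
    have P0 : 0 < P := hP z
    set W := P ^ (a - 1) with hW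
    set V := P ^ (-a) with hV
    have W0 : 0 < W := rpow_pos_of_pos P0 _
    have V0 : 0 < V := rpow_pos_of_pos P0 _
    have eW : P ^ a = P * W := by rw [hW, rpow_sub_one P0.ne']; field_simp
    have eW2 : P ^ (a - 1 - 1) = W / P := by rw [rpow_sub_one P0.ne']
    have eV : P * W * V = 1 := by rw [← eW, hV, ← rpow_add P0]; simp
    have FN0 : 0 ≤ z.1 ^ (2 * M + 2) := (even_two_mul (M+1)).pow_nonneg _
    have hFN : z.1 ^ (2 * M + 2) ≤ P := by rw [hPd]; unfold PP; linarith [sq_nonneg z.2, sq_nonneg η]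
    have hG2 : z.2 ^ 2 ≤ P := by rw [hPd]; unfold PP; linarith [sq_nonneg η]
    have hQP : QQ η z ≤ P := by rw [hPd]; unfold PP QQ; linarith
    have hF2 : z.1 ^ 2 ≤ P ^ (1 - 2 * a) := by
      have : z.1 ^ 2 = (z.1 ^ (2 * M + 2)) ^ (1 - 2 * a) := by
        rw [← he, show 2 * M + 2 = 2 * (M + 1) by ring, pow_mul, one_div]
        have := Real.pow_rpow_inv_natCast (sq_nonneg z.1) (Nat.succ_ne_zero M)
        push_cast at this
        exact this.symm
      rw [this]
      exact rpow_le_rpow FN0 hFN (by linarith)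
    have eV2 : P ^ (1 - 2 * a) * W = V := by rw [hW, hV, ← rpow_add P0]; ring_nf
    have hFV : z.1 ^ 2 * W ≤ V := by rw [← eV2]; gcongr
    have hFG : |z.1 * z.2| * W ≤ 1 := by
      rw [← abs_of_pos W0, ← abs_mul, ← sq_le_one_iff_abs_le_one]
      calc (z.1 * z.2 * W) ^ 2 = (z.1 ^ 2 * W) * (z.2 ^ 2 * W) := by ring
        _ ≤ V * (P * W) := by gcongr
        _ = 1 := by rw [← eV]; ring
    obtain ⟨ρ, hρ⟩ : ∃ ρ, ρ = z.1 ^ (2 * M + 2) / P := ⟨_, rfl⟩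
    have ρ0 : 0 ≤ ρ := by rw [hρ]; positivity
    have ρ1 : ρ ≤ 1 := by rw [hρ]; exact (div_le_one P0).2 hFN
    have eF : z.1 ^ (2 * M + 2) = ρ * P := by rw [hρ]; field_simp
    rw [pow_mul' z.1 2, eF, eW, eW2]
    have t11 : 2 * (P * W) ≤ 2 * (P * W) + a * N * (N + 3) * (ρ * P) * W - a * N * N * (1 - a) * (ρ * P) ^ 2 * (W / P) := by
      have : a * N * (N + 3) * (ρ * P) * W - a * N * N * (1 - a) * (ρ * P) ^ 2 * (W / P) = a * N * ρ * (P * W) * ((N + 3) - N * (1 - a) * ρ) := by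
        field_simp
      have h2 : 0 ≤ (N + 3) - N * (1 - a) * ρ := by
        have : (1 - a) * ρ ≤ 1 := mul_le_one₀ (by linarith) ρ0 ρ1
        have hN0 : 0 ≤ N := by positivity
        have := mul_le_mul_of_nonneg_left this hN0
        linarith
      have : 0 ≤ a * N * ρ * (P * W) * ((N + 3) - N * (1 - a) * ρ) := by positivity
      linarith
    have t12 : |4 * a * (z.1 * z.2) * W - 2 * a * (1 - a) * N * (ρ * P) * (z.1 * z.2) * (W / P)| ≤ 2 + N := by
      have : 4 * a * (z.1 * z.2) * W - 2 * a * (1 - a) * N * (ρ * P) * (z.1 * z.2) * (W / P) = (z.1 * z.2) * W * (4 * a - 2 * a * (1 - a) * N * ρ) := by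
        field_simp
      rw [this, abs_mul, abs_mul, abs_of_pos W0]
      have h2 : |4 * a - 2 * a * (1 - a) * N * ρ| ≤ 2 + N := by
        have hN0 : 0 ≤ N := by positivity
        have h3 : (1 - a) * ρ ≤ 1 := mul_le_one₀ (by linarith) ρ0 ρ1
        have h4 : 0 ≤ (1 - a) * ρ := mul_nonneg (by linarith) ρ0
        have h5 : 2 * a * ((1 - a) * ρ) ≤ 1 := mul_le_one₀ (by linarith) h4 h3
        have h6 : 0 ≤ 2 * a * ((1 - a) * ρ) := by positivity
        have h7 := mul_le_mul_of_nonneg_left h5 hN0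
        have h8 := mul_nonneg hN0 h6
        rw [abs_le]; constructor <;> linarith
      calc _ ≤ 1 * (2 + N) := mul_le_mul hFG h2 (abs_nonneg _) zero_le_one
        _ = _ := one_mul _
    have t22 : (1 + (2 + N) ^ 2) * V ≤ 2 * a * z.1 ^ 2 * W - 4 * a * (1 - a) * z.1 ^ 2 * z.2 ^ 2 * (W / P)
      + K * (2 * c * QQ η z ^ (c - 1) - 4 * c * (1 - c) * z.2 ^ 2 * QQ η z ^ (c - 1 - 1)) := by
      have q0 := hQ z
      have h1 : z.2 ^ 2 * QQ η z ^ (c - 1 - 1) ≤ QQ η z ^ (c - 1) := by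
        rw [rpow_sub_one q0.ne', mul_div_assoc', div_le_iff₀ q0, mul_comm]
        gcongr
        unfold QQ; linarith [sq_nonneg η]
      have h2 : V ≤ QQ η z ^ (c - 1) := by
        rw [hca, hV, rpow_neg P0.le, rpow_neg q0.le]
        gcongr
      have hc1 : c ≤ 1 := by linarith
      have hc0 : 1 / 2 ≤ c := by linarith
      have h3 : (2 * c * (2 * c - 1)) * QQ η z ^ (c - 1) ≤ 2 * c * QQ η z ^ (c - 1) - 4 * c * (1 - c) * z.2 ^ 2 * QQ η z ^ (c - 1 - 1) := by
        have : 4 * c * (1 - c) * (z.2 ^ 2 * QQ η z ^ (c - 1 - 1)) ≤ 4 * c * (1 - c) * QQ η z ^ (c - 1) :=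
          mul_le_mul_of_nonneg_left h1 (mul_nonneg (by linarith) (by linarith))
        linarith
      have h4 : 2 * c - 1 = 1 / (M + 1) := by rw [he]; linarith
      have h5 : (1 / (M + 1)) * V ≤ (2 * c * (2 * c - 1)) * QQ η z ^ (c - 1) := by
        have : 1 / ((M:ℝ) + 1) ≤ 2 * c * (2 * c - 1) := by
          rw [h4]; exact le_mul_of_one_le_left (by positivity) (by linarith)
        exact mul_le_mul this h2 V0.le (le_trans (by positivity) this)
      have h6 : (3 + (2 + N) ^ 2) * V ≤ K * (2 * c * QQ η z ^ (c - 1) - 4 * c * (1 - c) * z.2 ^ 2 * QQ η z ^ (c - 1 - 1)) := by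
        refine le_trans (le_of_eq ?_) (mul_le_mul_of_nonneg_left (h5.trans h3) hK0)
        rw [hK]; field_simp
      have h7 : 4 * a * (1 - a) * z.1 ^ 2 * z.2 ^ 2 * (W / P) ≤ 2 * V := by
        have e : 4 * a * (1 - a) * z.1 ^ 2 * z.2 ^ 2 * (W / P) = (4 * a * (1 - a)) * ((z.1 ^ 2 * W) * (z.2 ^ 2 / P)) := by ring
        rw [e]
        have : z.2 ^ 2 / P ≤ 1 := (div_le_one P0).2 hG2
        refine mul_le_mul (by linarith [mul_nonneg ha0 ha0]) ?_ (by positivity) (by norm_num)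
        calc _ ≤ V * 1 := mul_le_mul hFV this (by positivity) V0.le
          _ = V := mul_one V
      have h8 : 0 ≤ 2 * a * z.1 ^ 2 * W := by positivity
      linarith
    set B := 4 * a * (z.1 * z.2) * W - 2 * a * (1 - a) * N * (ρ * P) * (z.1 * z.2) * (W / P)
    have hB2 : B ^ 2 ≤ (2 + N) ^ 2 := sq_le_sq' (abs_le.1 t12).1 (abs_le.1 t12).2
    have k1 := mul_le_mul_of_nonneg_right t11 (sq_nonneg x)
    have k2 := mul_le_mul_of_nonneg_right t22 (sq_nonneg y)
    have k3 : 0 ≤ P * W * x ^ 2 + B ^ 2 * V * y ^ 2 + 2 * B * x * y := by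
      have : P * W * x ^ 2 + B ^ 2 * V * y ^ 2 + 2 * B * x * y = P * W * (x + B * V * y) ^ 2 := by
        linear_combination (-(B ^ 2 * V * y ^ 2) - 2 * B * x * y) * eV
      rw [this]; positivity
    have k4 : B ^ 2 * (V * y ^ 2) ≤ (2 + N) ^ 2 * (V * y ^ 2) := by gcongr
    linarith
end bf

section cz
variable {n : ℕ}

lemma bf_upper (M : ℕ) (hM : 1 ≤ M) (hMe : Even M) {η : ℝ} (hη : 0 < η) (F G : ℝ) :
    1 * F ^ 2 * PP η M (F, G) ^ ((M:ℝ) / (2 * (M + 1))) ≤ F ^ (M + 2)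
      + (G ^ 2) ^ (((M:ℝ) + 2) / (2 * (M + 1))) + (if F = 0 then 0 else (η ^ 2) ^ (((M:ℝ) + 2) / (2 * (M + 1)))) := by
  set a : ℝ := (M:ℝ) / (2 * (M + 1)) with ha
  set c : ℝ := ((M:ℝ) + 2) / (2 * (M + 1)) with hc
  have hFm : 0 ≤ F ^ (M + 2) := (hMe.add even_two).pow_nonneg _
  by_cases h : F = 0
  · have : 0 ≤ (G ^ 2) ^ c := by positivity
    subst h; simp [this]
  rw [if_neg h]
  have hM' : (1:ℝ) ≤ M := by exact_mod_cast hM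
  have he : 1 / ((M:ℝ) + 1) + a = c := by rw [ha, hc]; field_simp; ring
  have FN0 : 0 ≤ F ^ (2 * M + 2) := (even_two_mul (M+1)).pow_nonneg _
  have P0 := PP_pos hη M (F, G)
  set P := PP η M (F, G) with hPd
  have hFN : F ^ (2 * M + 2) ≤ P := by rw [hPd]; unfold PP; simp only; linarith [sq_nonneg G, sq_nonneg η]
  have e2 : F ^ 2 = (F ^ (2 * M + 2)) ^ (1 / ((M:ℝ) + 1)) := by
    rw [show 2 * M + 2 = 2 * (M + 1) by ring, pow_mul, one_div]
    have := Real.pow_rpow_inv_natCast (sq_nonneg F) (Nat.succ_ne_zero M)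
    push_cast at this
    exact this.symm
  have eM : F ^ (M + 2) = (F ^ (2 * M + 2)) ^ c := by
    rw [show 2 * M + 2 = 2 * (M + 1) by ring, ← (hMe.add even_two).pow_abs F, ← (even_two_mul (M+1)).pow_abs F, ← rpow_natCast, ← rpow_natCast,
      ← rpow_mul (abs_nonneg F), hc]
    congr 1; push_cast; field_simp
  have hc0 : 0 ≤ c := by positivity
  have hc1 : c ≤ 1 := by rw [hc, div_le_one (by positivity)]; linarith
  calc 1 * F ^ 2 * P ^ a ≤ P ^ (1 / ((M:ℝ) + 1)) * P ^ a := by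
        rw [one_mul, e2]; gcongr
    _ = P ^ c := by rw [← rpow_add P0, he]
    _ ≤ (η ^ 2 + G ^ 2) ^ c + (F ^ (2 * M + 2)) ^ c := by
        rw [hPd]; exact rpow_add_le_add_rpow (by positivity) FN0 hc0 hc1
    _ ≤ (η ^ 2) ^ c + (G ^ 2) ^ c + (F ^ (2 * M + 2)) ^ c := by
        gcongr; exact rpow_add_le_add_rpow (by positivity) (by positivity) hc0 hc1
    _ = _ := by rw [eM]; ring

lemma Cc.int {φ : Euc n → ℝ} (h : Cc φ) : Integrable φ := h.cont.integrable_of_hasCompactSupport h.2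

lemma Cc.pow {φ : Euc n → ℝ} (h : Cc φ) {m : ℕ} (hm : m ≠ 0) : Cc (fun x => φ x ^ m) := by
  refine ⟨h.1.pow m, h.2.comp_left (g := fun t : ℝ => t ^ m) (by simp [hm])⟩

lemma Cc.const_mul {φ : Euc n → ℝ} (h : Cc φ) (a : ℝ) : Cc (fun x => a * φ x) := by
  refine ⟨contDiff_const.mul h.1, h.2.comp_left (g := fun t : ℝ => a * t) (by simp)⟩

lemma cz_smooth (n : ℕ) (hn : n ≠ 0) (M : ℕ) (hM : 1 ≤ M) (hMe : Even M) : ∃ C : ℝ, 0 < C ∧ ∀ v : Euc n → ℝ, Cc v →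
    ∀ i j : Fin n, ∫ x, (pd i (pd j v) x) ^ (M + 2) ≤ C * ∫ x, (lap v x) ^ (M + 2) := by
  obtain ⟨K, hK0, hK⟩ := bell_exists M hM
  refine ⟨(K + 2) ^ (M + 2), by positivity, fun v hv i j => ?_⟩
  set w := pd i (pd j v) with hw
  have hwc : Cc w := (hv.pd j).pd i
  have hMc : Even (M + 2) := hMe.add even_two
  set Λ := K + 2 with hΛ
  set c : ℝ := ((M:ℝ) + 2) / (2 * (M + 1)) with hc
  have hc0 : 0 < c := by positivity
  have hv' := hv.const_mul Λ
  have elap : lap (fun x => Λ * v x) = fun x => Λ * lap v x := by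
    ext x
    unfold lap
    rw [Finset.mul_sum]
    refine Finset.sum_congr rfl fun l _ => ?_
    rw [show pd l (fun x => Λ * v x) = fun x => Λ * pd l v x from funext fun y => pd_const_mul _ (hv.diff y), pd_const_mul _ ((hv.pd l).diff x)]
  have ew : pd i (pd j (fun x => Λ * v x)) = fun x => Λ * w x := by
    ext x
    rw [show pd j (fun x => Λ * v x) = fun x => Λ * pd j v x from funext fun y => pd_const_mul _ (hv.diff y), pd_const_mul _ ((hv.pd j).diff x)]
  set g : Euc n → ℝ := fun x => -1 * w x ^ (M + 1) with hg
  have hgc : Cc g := (hwc.pow (by omega)).const_mul _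
  set S := tsupport (lap v)
  have hSc : IsCompact S := hv.lap.2
  set V := (volume S).toReal
  have key : ∀ t : ℝ, 0 < t → ∫ x, w x ^ (M + 2) ≤ Λ ^ (M + 2) * (∫ x, lap v x ^ (M + 2)) + t * V := by
    intro t ht
    set η := (t ^ (1 / c)) ^ ((1:ℝ) / 2)
    have hη : 0 < η := by positivity
    have eη : (η ^ 2) ^ c = t := by
      show (((t ^ (1 / c)) ^ ((1:ℝ) / 2)) ^ 2) ^ c = t
      rw [← rpow_natCast, ← rpow_mul (by positivity), ← rpow_mul ht.le, ← rpow_mul ht.le]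
      push_cast
      rw [show 1 / c * (1 / 2) * (2 * c) = 1 by field_simp, rpow_one]
    obtain ⟨b1, b2, b11, b12, b22, α, β, hb⟩ := hK η hη
    have h := hb.main hn hv' hgc i j
    set b := (fun z : ℝ × ℝ => 1 * z.1 ^ 2 * PP η M z ^ ((M:ℝ) / (2 * (M + 1)))
      + K * ((QQ η z) ^ c - (η ^ 2) ^ c)) with hbdef
    have cb : Continuous b := continuous_iff_continuousAt.2 fun z => (hb.d0 z).continuousAt
    rw [elap, ew] at h
    have ib : Integrable (fun x => b (Λ * lap v x, g x)) := by
      refine Continuous.integrable_of_hasCompactSupport (by have := hv.lap.cont; have := hgc.cont; fun_prop) ?_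
      exact HasCompactSupport.comp₂_left (m := fun x y => b (x, y)) (hv.lap.const_mul Λ).2 hgc.2 hb.zero
    have iw : Integrable fun x => 1 * (Λ * w x * g x) := by
      have : (fun x => 1 * (Λ * w x * g x)) = fun x => -Λ * w x ^ (M + 2) := by ext x; simp only [hg]; ring
      rw [this]; exact ((hwc.pow (by omega)).const_mul _).int
    have im := (hwc.pow (show M + 2 ≠ 0 by omega)).int
    have il := (hv.lap.pow (show M + 2 ≠ 0 by omega)).int
    have ii : Integrable (S.indicator fun _ => t) := by
      rw [integrable_indicator_iff hSc.isClosed.measurableSet]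
      exact integrableOn_const hSc.measure_lt_top.ne
    have h2 : ∫ x, (b (Λ * lap v x, g x) + 1 * (Λ * w x * g x)) ≤
        ∫ x, (Λ ^ (M + 2) * lap v x ^ (M + 2) + ((-1) * w x ^ (M + 2) + S.indicator (fun _ => t) x)) := by
      refine integral_mono (ib.add iw) ((il.const_mul _).add ((im.const_mul _).add ii)) fun x => ?_
      have h3 := bf_upper M hM hMe hη (Λ * lap v x) (g x)
      have h4 : QQ η (Λ * lap v x, g x) ^ c ≤ (η ^ 2) ^ c + (g x ^ 2) ^ c := by
        refine rpow_add_le_add_rpow (by positivity) (by positivity) hc0.le ?_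
        rw [hc, div_le_one (by positivity)]; linarith [(Nat.cast_nonneg M : (0:ℝ) ≤ M)]
      have h5 : (g x ^ 2) ^ c = w x ^ (M + 2) := by
        have : g x ^ 2 = |w x| ^ (2 * (M + 1)) := by
          rw [(even_two_mul (M+1)).pow_abs]; simp only [hg]; ring
        rw [this, ← hMc.pow_abs, ← rpow_natCast, ← rpow_natCast, ← rpow_mul (abs_nonneg _), hc]
        congr 1; push_cast; field_simp
      have h6 : (if Λ * lap v x = 0 then 0 else (η ^ 2) ^ c) ≤ S.indicator (fun _ => t) x := by
        by_cases h0 : lap v x = 0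
        · simp only [h0, mul_zero, if_true]; exact indicator_nonneg (fun _ _ => ht.le) _
        · rw [indicator_of_mem (subset_tsupport _ h0), if_neg (mul_ne_zero (by positivity) h0), eη]
      rw [h5] at h3 h4
      rw [mul_pow Λ (lap v x) (M + 2)] at h3
      have h7 : K * (QQ η (Λ * lap v x, g x) ^ c - (η ^ 2) ^ c) ≤ K * w x ^ (M + 2) := by gcongr; linarith
      have h8 : 1 * (Λ * w x * g x) = -Λ * w x ^ (M + 2) := by simp only [hg]; ring
      simp only [hbdef]
      rw [h8, hΛ]
      simp only [hΛ] at h3 h6 h7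
      linarith
    have ii' : Integrable fun x => (-1) * w x ^ (M + 2) + S.indicator (fun _ => t) x := (im.const_mul _).add ii
    rw [integral_add (il.const_mul _) ii', integral_add (im.const_mul _) ii, integral_const_mul, integral_const_mul,
      integral_indicator hSc.isClosed.measurableSet, setIntegral_const, smul_eq_mul] at h2
    have : volume.real S = V := rfl
    rw [this] at h2
    linarith
  refine le_of_forall_pos_le_add fun δ hδ => ?_
  have hV : 0 ≤ V := ENNReal.toReal_nonneg
  refine (key (δ / (V + 1)) (by positivity)).trans ?_
  gcongr
  rw [div_mul_eq_mul_div, div_le_iff₀ (by positivity)]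
  nlinarith
end cz

section moll
variable {n : ℕ}
open scoped Convolution

def mbump (n k : ℕ) : ContDiffBump (0 : Euc n) where
  rIn := 1 / (2 * ((k:ℝ) + 1))
  rOut := 1 / ((k:ℝ) + 1)
  rIn_pos := by positivity
  rIn_lt_rOut := by
    apply one_div_lt_one_div_of_lt <;> linarith [(Nat.cast_nonneg k : (0:ℝ) ≤ k)]

def JJ (k : ℕ) (v : Euc n → ℝ) : Euc n → ℝ :=
  ((mbump n k).normed volume) ⋆[ContinuousLinearMap.lsmul ℝ ℝ, volume] v

lemma JJ_supp (k : ℕ) (v : Euc n → ℝ) (x : Euc n) (h : JJ k v x ≠ 0) :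
    ∃ y, v y ≠ 0 ∧ dist x y < 1 / ((k:ℝ) + 1) := by
  have := support_convolution_subset (ContinuousLinearMap.lsmul ℝ ℝ) (Function.mem_support.2 h)
  rw [(mbump n k).support_normed_eq] at this
  obtain ⟨a, ha, y, hy, rfl⟩ := Set.mem_add.1 this
  refine ⟨y, hy, ?_⟩
  simpa [mbump, dist_eq_norm] using ha

lemma JJ_tsupport (k : ℕ) (v : Euc n → ℝ) : tsupport (JJ k v) ⊆ cthickening (1 / ((k:ℝ) + 1)) (tsupport v) := by
  refine closure_minimal (fun x hx => ?_) isClosed_cthickening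
  obtain ⟨y, hy, hd⟩ := JJ_supp k v x hx
  exact mem_cthickening_of_dist_le x y _ _ (subset_tsupport _ hy) hd.le

lemma JJ_Cc (k : ℕ) {v : Euc n → ℝ} (hv : Continuous v) (hc : HasCompactSupport v) : Cc (JJ k v) := by
  refine ⟨(mbump n k).hasCompactSupport_normed.contDiff_convolution_left _ (mbump n k).contDiff_normed
    hv.locallyIntegrable, ?_⟩
  exact IsCompact.of_isClosed_subset hc.isCompact.cthickening (isClosed_tsupport _) (JJ_tsupport k v)

lemma JJ_tendsto {v : Euc n → ℝ} (hv : Continuous v) (x : Euc n) :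
    Filter.Tendsto (fun k => JJ k v x) Filter.atTop (𝓝 (v x)) := by
  refine ContDiffBump.convolution_tendsto_right_of_continuous (φ := fun k => mbump n k) ?_ hv x
  exact tendsto_one_div_add_atTop_nhds_zero_nat

lemma JJ_bdd (k : ℕ) {v : Euc n → ℝ} (hv : Continuous v) {C : ℝ} (h : ∀ x, |v x| ≤ C) (x : Euc n) :
    |JJ k v x| ≤ 3 * C := by
  have := (mbump n k).dist_normed_convolution_le (μ := volume) (x₀ := x) (ε := 2 * C) hv.aestronglyMeasurable
    (fun y _ => by
      rw [Real.dist_eq]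
      exact (abs_sub _ _).trans (by linarith [h x, h y]))
  change dist (JJ k v x) (v x) ≤ _ at this
  rw [Real.dist_eq] at this
  have h1 := abs_sub_abs_le_abs_sub (JJ k v x) (v x)
  linarith [h x]

lemma JJ_pd (k : ℕ) {v : Euc n → ℝ} (hv : ContDiff ℝ 1 v) (hc : HasCompactSupport v) (i : Fin n) :
    pd i (JJ k v) = JJ k (pd i v) := by
  ext x
  have hl : LocallyIntegrable ((mbump n k).normed volume) (volume : Measure (Euc n)) :=
    (mbump n k).continuous_normed.locallyIntegrable
  unfold pd JJ
  rw [(hc.hasFDerivAt_convolution_right (ContinuousLinearMap.lsmul ℝ ℝ) hl hv x).fderiv,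
    convolution_precompR_apply _ hl (hc.fderiv ℝ) (hv.continuous_fderiv one_ne_zero)]

lemma hcs_bdd {v : Euc n → ℝ} (hv : Continuous v) (hc : HasCompactSupport v) : ∃ C, 0 ≤ C ∧ ∀ x, |v x| ≤ C := by
  obtain ⟨C, hC⟩ := hv.bounded_above_of_compact_support hc
  exact ⟨C, (norm_nonneg _).trans (hC 0), hC⟩

/-- convergence of integrals along bounded pointwise convergence with uniformly compact supports. -/
lemma tendsto_int {F : ℕ → Euc n → ℝ} {G : Euc n → ℝ} {K : Set (Euc n)} (hK : IsCompact K)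
    (hF : ∀ k, Continuous (F k)) {C : ℝ} (hC : ∀ k x, |F k x| ≤ C) (hs : ∀ k x, F k x ≠ 0 → x ∈ K)
    (ht : ∀ x, Filter.Tendsto (fun k => F k x) Filter.atTop (𝓝 (G x))) :
    Filter.Tendsto (fun k => ∫ x, F k x) Filter.atTop (𝓝 (∫ x, G x)) := by
  refine tendsto_integral_of_dominated_convergence (K.indicator fun _ => C) (fun k => (hF k).aestronglyMeasurable)
    ?_ (fun k => Filter.Eventually.of_forall fun x => ?_) (Filter.Eventually.of_forall ht)
  · rw [integrable_indicator_iff hK.measurableSet]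
    exact integrableOn_const hK.measure_lt_top.ne
  · by_cases hx : x ∈ K
    · rw [indicator_of_mem hx]; exact hC k x
    · rw [indicator_of_notMem hx, norm_le_zero_iff]; by_contra h; exact hx (hs k x h)

lemma cz (n : ℕ) (hn : n ≠ 0) (M : ℕ) (hM : 1 ≤ M) (hMe : Even M) : ∃ C : ℝ, 0 < C ∧ ∀ v : Euc n → ℝ,
    ContDiff ℝ 2 v → HasCompactSupport v →
    ∀ i j : Fin n, ∫ x, (pd i (pd j v) x) ^ (M + 2) ≤ C * ∫ x, (lap v x) ^ (M + 2) := by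
  obtain ⟨C, hC0, hC⟩ := cz_smooth n hn M hM hMe
  refine ⟨C, hC0, fun v hv hc i j => ?_⟩
  have hpd1 : ∀ l, ContDiff ℝ 1 (pd l v) := fun l => contDiff_pd hv (by norm_num) l
  have hv1 : ContDiff ℝ 1 v := hv.of_le (by norm_num)
  have e2 : ∀ k a b, pd a (pd b (JJ k v)) = JJ k (pd a (pd b v)) := fun k a b => by
    rw [JJ_pd k hv1 hc, JJ_pd k (hpd1 b) (hcs_pd hc b)]
  have hc2 : ∀ a b, Continuous (pd a (pd b v)) := fun a b => cont_pd (hpd1 b) a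
  have hcc : ∀ a b, HasCompactSupport (pd a (pd b v)) := fun a b => hcs_pd (hcs_pd hc b) a
  have hK : IsCompact (cthickening 1 (tsupport v)) := hc.isCompact.cthickening
  have hsub : ∀ a b k x, JJ k (pd a (pd b v)) x ≠ 0 → x ∈ cthickening 1 (tsupport v) := by
    intro a b k x hx
    have h1 : tsupport (pd a (pd b v)) ⊆ tsupport v := (tsupport_pd_subset _ a).trans (tsupport_pd_subset _ b)
    refine cthickening_mono ?_ _ (cthickening_subset_of_subset _ h1 (JJ_tsupport k _ (subset_tsupport _ hx)))
    rw [div_le_one (by positivity)]; linarith [(Nat.cast_nonneg k : (0:ℝ) ≤ k)]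
  choose B hB0 hB using fun a b => hcs_bdd (hc2 a b) (hcc a b)
  have lim1 : Filter.Tendsto (fun k => ∫ x, (pd i (pd j (JJ k v)) x) ^ (M + 2)) Filter.atTop
      (𝓝 (∫ x, (pd i (pd j v) x) ^ (M + 2))) := by
    simp only [e2]
    refine tendsto_int hK (fun k => (JJ_Cc k (hc2 i j) (hcc i j)).cont.pow _) (C := (3 * B i j) ^ (M + 2)) (fun k x => ?_) (fun k x hx => ?_) (fun x => ?_)
    · rw [abs_pow]; exact pow_le_pow_left₀ (abs_nonneg _) (JJ_bdd k (hc2 i j) (hB i j) x) _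
    · exact hsub i j k x fun h => hx (by rw [h]; simp)
    · exact (JJ_tendsto (hc2 i j) x).pow _
  have lim2 : Filter.Tendsto (fun k => ∫ x, (lap (JJ k v) x) ^ (M + 2)) Filter.atTop
      (𝓝 (∫ x, (lap v x) ^ (M + 2))) := by
    unfold lap
    simp only [e2]
    refine tendsto_int hK (fun k => ?_) (C := (∑ l, 3 * B l l) ^ (M + 2)) (fun k x => ?_) (fun k x hx => ?_) (fun x => ?_)
    · exact (continuous_finsetSum _ fun l _ => (JJ_Cc k (hc2 l l) (hcc l l)).cont).pow _
    · rw [abs_pow]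
      refine pow_le_pow_left₀ (abs_nonneg _) ((Finset.abs_sum_le_sum_abs _ _).trans ?_) _
      exact Finset.sum_le_sum fun l _ => JJ_bdd k (hc2 l l) (hB l l) x
    · have : ∑ l, JJ k (pd l (pd l v)) x ≠ 0 := fun h => hx (by rw [h]; simp)
      obtain ⟨l, _, hl⟩ := Finset.exists_ne_zero_of_sum_ne_zero this
      exact hsub l l k x hl
    · exact (tendsto_finsetSum _ fun l _ => JJ_tendsto (hc2 l l) x).pow _
  exact le_of_tendsto_of_tendsto' lim1 (lim2.const_mul C) fun k => hC _ (JJ_Cc k hv.continuous hc) i j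
end moll

section mx
variable {n : ℕ}

def sg (ε : ℝ) (u : Euc n → ℝ) (x : Euc n) : ℝ := ε + ∑ i, pd i u x ^ 2
def AA (p ε : ℝ) (u : Euc n → ℝ) (i : Fin n) (x : Euc n) : ℝ := sg ε u x ^ ((p - 2) / 2) * pd i u x

lemma sg_ge (ε : ℝ) (u : Euc n → ℝ) (x : Euc n) : ε ≤ sg ε u x := by
  unfold sg; linarith [Finset.sum_nonneg fun i (_ : i ∈ Finset.univ) => sq_nonneg (pd i u x)]

lemma sg_pos {ε : ℝ} (h : 0 < ε) (u : Euc n → ℝ) (x : Euc n) : 0 < sg ε u x := h.trans_le (sg_ge ε u x)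

lemma sq_le_sg {ε : ℝ} (h : 0 < ε) (u : Euc n → ℝ) (x : Euc n) (i : Fin n) : pd i u x ^ 2 ≤ sg ε u x := by
  unfold sg
  linarith [Finset.single_le_sum (f := fun i => pd i u x ^ 2) (fun i _ => sq_nonneg (pd i u x)) (Finset.mem_univ i)]

lemma pd_sg (ε : ℝ) {u : Euc n → ℝ} (hu : ContDiff ℝ 2 u) (i : Fin n) (x : Euc n) :
    pd i (sg ε u) x = 2 * ∑ j, pd j u x * pd i (pd j u) x := by
  have hd : ∀ j, DifferentiableAt ℝ (pd j u) x := fun j =>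
    (contDiff_pd (m := 1) hu (by norm_num) j).differentiable (by norm_num) x
  have : sg ε u = fun y => (fun _ => ε) y + (fun y => ∑ j, pd j u y ^ 2) y := rfl
  rw [this, pd_add (by fun_prop) (by fun_prop), pd_const, pd_sum (fun j _ => by have := hd j; fun_prop), zero_add, Finset.mul_sum]
  refine Finset.sum_congr rfl fun j _ => ?_
  rw [pd_pow 2 (hd j)]; push_cast; ring

lemma contDiff_sg (ε : ℝ) {u : Euc n → ℝ} {k m : WithTop ℕ∞} (hu : ContDiff ℝ k u) (h : m + 1 ≤ k) : ContDiff ℝ m (sg ε u) := by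
  unfold sg
  exact contDiff_const.add (ContDiff.sum fun i _ => (contDiff_pd hu h i).pow 2)

lemma contDiff_sgr {ε : ℝ} (hε : 0 < ε) {u : Euc n → ℝ} {k m : WithTop ℕ∞} (hu : ContDiff ℝ k u) (h : m + 1 ≤ k) (r : ℝ) :
    ContDiff ℝ m (fun x => sg ε u x ^ r) :=
  (contDiff_sg ε hu h).rpow_const_of_ne fun x => (sg_pos hε u x).ne'

lemma solves_AA {p ε : ℝ} {f u v : Euc n → ℝ} {x : Euc n} (h : v =ᶠ[𝓝 x] u)
    (hs : -(∑ i : Fin n,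
        fderiv ℝ (fun y => (((ε + ‖gradient u y‖ ^ 2) ^ ((p - 2) / 2)) • gradient u y) i) x
          (EuclideanSpace.single i 1)) = f x) : -(∑ i, pd i (AA p ε v i) x) = f x := by
  rw [← hs]
  congr 1
  refine Finset.sum_congr rfl fun i _ => ?_
  refine pd_congr ?_
  filter_upwards [h.eventuallyEq_nhds] with y hy
  simp only [AA, sg, PiLp.smul_apply, smul_eq_mul, gradient_apply', normsq_gradient]
  have : ∀ i, pd i v y = pd i u y := fun i => pd_congr hy
  simp only [this]

lemma nondiv {p ε : ℝ} (hε : 0 < ε) {u : Euc n → ℝ} (hu : ContDiff ℝ 2 u) (x : Euc n) :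
    ∑ i, pd i (AA p ε u i) x = sg ε u x ^ ((p - 2) / 2) *
      (lap u x + (p - 2) * (∑ i, ∑ j, pd i u x * pd j u x * pd i (pd j u) x) / sg ε u x) := by
  have s0 := sg_pos hε u x
  have hd : ∀ j, DifferentiableAt ℝ (pd j u) x := fun j =>
    (contDiff_pd (m := 1) hu (by norm_num) j).differentiable (by norm_num) x
  have hsd : DifferentiableAt ℝ (sg ε u) x := (contDiff_sg (m := 1) ε hu (by norm_num)).differentiable (by norm_num) x
  have : ∀ i, pd i (AA p ε u i) x = sg ε u x ^ ((p - 2) / 2) * pd i (pd i u) x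
      + sg ε u x ^ ((p - 2) / 2) * ((p - 2) / sg ε u x) * ∑ j, pd i u x * pd j u x * pd i (pd j u) x := by
    intro i
    unfold AA
    rw [pd_mul (hsd.rpow_const (Or.inl s0.ne')) (hd i), pd_rpow _ hsd s0, pd_sg ε hu, rpow_sub_one s0.ne']
    simp only [mul_assoc, ← Finset.mul_sum]
    field_simp
    ring
  simp only [this, Finset.sum_add_distrib, ← Finset.mul_sum, lap]
  ring

lemma glob {k : WithTop ℕ∞} {u : Euc n → ℝ} {x₀ : Euc n} {r ρ : ℝ} (hk : k ≤ (⊤:ℕ∞)) (h0 : 0 < ρ) (h : ρ < r) (hu : ContDiffOn ℝ k u (ball x₀ r)) :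
    ∃ v : Euc n → ℝ, ContDiff ℝ k v ∧ HasCompactSupport v ∧ (∀ x ∈ closedBall x₀ ρ, v x = u x) ∧
      (∀ x, |v x| ≤ |u x|) ∧ ∀ x ∉ ball x₀ r, v x = 0 := by
  let χ : ContDiffBump x₀ := ⟨ρ, (ρ + r) / 2, h0, by linarith⟩
  refine ⟨fun x => χ x * u x, ?_, χ.hasCompactSupport.mul_right, fun x hx => ?_, fun x => ?_, fun x hx => ?_⟩
  · rw [contDiff_iff_contDiffAt]
    intro x
    by_cases hx : x ∈ ball x₀ r
    · exact (χ.contDiff.contDiffAt.of_le hk).mul (hu.contDiffAt (isOpen_ball.mem_nhds hx))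
    · refine contDiffAt_const (c := (0:ℝ)) |>.congr_of_eventuallyEq ?_
      have : x ∉ tsupport χ := by
        rw [χ.tsupport_eq]
        intro hx'
        simp only [mem_closedBall, mem_ball, not_lt, χ] at hx hx'
        linarith
      filter_upwards [notMem_tsupport_iff_eventuallyEq.1 this] with y hy
      simp [hy]
  · simp [χ.one_of_mem_closedBall hx]
  · simp only [abs_mul, abs_of_nonneg χ.nonneg]
    exact mul_le_of_le_one_left (abs_nonneg _) χ.le_one
  · have : χ x = 0 := χ.zero_of_le_dist (by simp only [mem_ball, not_lt] at hx; simp only [χ]; linarith)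
    simp [this]

lemma second_deriv_nonpos {g g' : ℝ → ℝ} {D : ℝ} (h1 : ∀ t, HasDerivAt g (g' t) t) (h2 : HasDerivAt g' D 0)
    (hm : IsLocalMax g 0) : D ≤ 0 := by
  by_contra hD
  push Not at hD
  have e : deriv g = g' := funext fun t => (h1 t).deriv
  have hmin : IsLocalMin g 0 := by
    refine isLocalMin_of_deriv_deriv_pos (by rw [e, h2.deriv]; exact hD) (hm.deriv_eq_zero) (h1 0).continuousAt
  have hc : g =ᶠ[𝓝 0] fun _ => g 0 := by
    filter_upwards [hm, hmin] with t a b using le_antisymm a b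
  have h3 : g' =ᶠ[𝓝 0] fun _ => 0 := by
    filter_upwards [hc.eventuallyEq_nhds] with t ht
    rw [← (h1 t).deriv, ht.deriv_eq]; simp
  have := h3.deriv_eq
  rw [h2.deriv] at this
  simp at this; linarith

lemma hess_nonpos {W : Euc n → ℝ} (hW : ContDiff ℝ 2 W) {z : Euc n} (hm : IsLocalMax W z) (i j : Fin n) (a b : ℝ) :
    a ^ 2 * pd i (pd i W) z + 2 * a * b * pd i (pd j W) z + b ^ 2 * pd j (pd j W) z ≤ 0 := by
  set ξ : Euc n := a • EuclideanSpace.single i 1 + b • EuclideanSpace.single j 1 with hξ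
  have hline : ∀ t : ℝ, HasDerivAt (fun t : ℝ => z + t • ξ) ξ t := fun t => by
    simpa using ((hasDerivAt_id t).smul_const ξ).const_add z
  have hdir : ∀ (F : Euc n → ℝ) (hF : Differentiable ℝ F) (t : ℝ), HasDerivAt (fun t => F (z + t • ξ))
      (a * pd i F (z + t • ξ) + b * pd j F (z + t • ξ)) t := by
    intro F hF t
    have := (hF (z + t • ξ)).hasFDerivAt.comp_hasDerivAt t (hline t)
    refine this.congr_deriv ?_
    simp [hξ, pd]
  have hd : ∀ l, Differentiable ℝ (pd l W) := fun l => (contDiff_pd (m := 1) hW (by norm_num) l).differentiable (by norm_num)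
  have := second_deriv_nonpos (hdir W (hW.differentiable (by norm_num)))
    (((hdir _ (hd i) 0).const_mul a).add ((hdir _ (hd j) 0).const_mul b)) ?_
  · simp only [zero_smul, add_zero] at this
    rw [pd_comm hW j i] at this
    linarith
  · have hz : Filter.Tendsto (fun t : ℝ => z + t • ξ) (𝓝 0) (𝓝 z) := by
      have := (hline 0).continuousAt.tendsto; simpa using this
    filter_upwards [hz.eventually hm] with t ht
    simpa using ht
end mx

section mp
variable {n : ℕ}

def NN (y0 : Euc n) (x : Euc n) : ℝ := ∑ l, (x l - y0 l) ^ 2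

lemma coord_contDiff (l : Fin n) {k : WithTop ℕ∞} : ContDiff ℝ k (fun y : Euc n => y l) :=
  (EuclideanSpace.proj (𝕜 := ℝ) l).contDiff

lemma pd_coord (i l : Fin n) (x : Euc n) : pd i (fun y : Euc n => y l) x = if l = i then 1 else 0 := by
  have : (fun y : Euc n => y l) = ⇑(EuclideanSpace.proj (𝕜 := ℝ) l) := rfl
  rw [pd, this, ContinuousLinearMap.fderiv]
  simp [Pi.single_apply]

lemma pd_coord_sub (i l : Fin n) (c : ℝ) (x : Euc n) : pd i (fun y : Euc n => y l - c) x = if l = i then 1 else 0 := by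
  rw [pd_sub ((coord_contDiff (k := 1) l).differentiable (by norm_num) x) (by fun_prop), pd_coord, pd_const, sub_zero]

lemma NN_contDiff (y0 : Euc n) {k : WithTop ℕ∞} : ContDiff ℝ k (NN y0) := by
  unfold NN
  exact ContDiff.sum fun l _ => ((coord_contDiff l).sub contDiff_const).pow 2

lemma NN_eq (y0 x : Euc n) : NN y0 x = dist x y0 ^ 2 := by
  rw [EuclideanSpace.dist_eq, Real.sq_sqrt (by positivity)]
  simp [NN, Real.dist_eq, sq_abs]

lemma pd_NN (y0 : Euc n) (i : Fin n) : pd i (NN y0) = fun x => 2 * (x i - y0 i) := by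
  ext x
  have hd : ∀ l, DifferentiableAt ℝ (fun y : Euc n => y l - y0 l) x := fun l =>
    ((coord_contDiff (k := 1) l).sub contDiff_const).differentiable (by norm_num) x
  unfold NN
  have hd2 : ∀ l, DifferentiableAt ℝ (fun y : Euc n => (y l - y0 l) ^ 2) x := fun l => (hd l).pow 2
  rw [pd_sum fun l _ => hd2 l]
  have : ∀ l, pd i (fun y : Euc n => (y l - y0 l) ^ 2) x = if l = i then 2 * (x l - y0 l) else 0 := by
    intro l
    rw [pd_pow 2 (hd l), pd_coord_sub]
    split_ifs <;> simp
  simp [this]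

lemma pd_pd_NN (y0 : Euc n) (i j : Fin n) (x : Euc n) : pd i (pd j (NN y0)) x = if j = i then 2 else 0 := by
  rw [pd_NN, pd_const_mul _ (((coord_contDiff (k := 1) j).sub contDiff_const).differentiable (by norm_num) x), pd_coord_sub]
  split_ifs <;> simp

set_option maxHeartbeats 1000000 in
lemma sup_upper (hn : 1 ≤ n) {x₀ : Euc n} {R p F M0 : ℝ} (hR : 0 < R) (hp : |p - 2| ≤ 1 / 2) (hpn : |p - 2| * n ≤ 1 / 2) :
    ∃ K : ℝ, ∀ ε : ℝ, 0 < ε → ε < 1 → ∀ f u : Euc n → ℝ, ContDiffOn ℝ 2 u (ball x₀ (2 * R)) →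
      ContinuousOn u (closedBall x₀ (2 * R)) → SolvesReg p ε f u (ball x₀ (2 * R)) →
      (∀ x ∈ ball x₀ (2 * R), |f x| ≤ F) → (∀ x ∈ sphere x₀ (2 * R), u x ≤ M0) →
      ∀ x ∈ closedBall x₀ (2 * R), u x ≤ K := by
  set B := 1 + 100 * R ^ 2 with hB
  set K := 1 + 1 / R + F ^ 2 * B with hK
  have hB1 : 1 ≤ B := by rw [hB]; nlinarith [sq_nonneg R]
  have hFB : 0 ≤ F ^ 2 * B := by positivity
  have hRi : 0 < 1 / R := by positivity
  have hK1 : 1 ≤ K := by linarith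
  set y0 : Euc n := x₀ + (3 * R) • EuclideanSpace.single ⟨0, hn⟩ (1:ℝ) with hy0
  have hd0 : dist x₀ y0 = 3 * R := by
    rw [dist_eq_norm, hy0, sub_add_cancel_left, norm_neg, norm_smul]
    simp [hR.le]
  have hdist : ∀ x ∈ closedBall x₀ (2 * R), R ≤ dist x y0 ∧ dist x y0 ≤ 5 * R := by
    intro x hx
    have h1 := dist_triangle x₀ x y0
    have h2 := dist_triangle x x₀ y0
    rw [mem_closedBall] at hx
    rw [dist_comm x₀ x] at h1
    constructor <;> linarith
  have hN : ∀ x ∈ closedBall x₀ (2 * R), R ^ 2 ≤ NN y0 x ∧ NN y0 x ≤ 25 * R ^ 2 := by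
    intro x hx
    obtain ⟨h1, h2⟩ := hdist x hx
    rw [NN_eq]
    constructor <;> nlinarith
  refine ⟨M0 + K * (25 * R ^ 2), fun ε hε hε1 f u hu huc hs hf hM x hx => ?_⟩
  obtain ⟨z, hz, hzmax⟩ := (isCompact_closedBall x₀ (2 * R)).exists_isMaxOn ⟨x, hx⟩
    (huc.add (continuousOn_const.mul (NN_contDiff y0 (k := 0)).continuous.continuousOn) : ContinuousOn (fun x => u x + K * NN y0 x) _)
  have hKp : 0 ≤ K := by linarith
  by_cases hzb : z ∈ sphere x₀ (2 * R)
  · have h1 : u x + K * NN y0 x ≤ u z + K * NN y0 z := hzmax hx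
    have h2 := hM z hzb
    have h3 := mul_le_mul_of_nonneg_left (hN z hz).2 hKp
    have h4 := mul_nonneg hKp ((sq_nonneg R).trans (hN x hx).1)
    linarith
  exfalso
  have hzb' : z ∈ ball x₀ (2 * R) := by
    rw [mem_closedBall] at hz; rw [mem_sphere] at hzb; exact lt_of_le_of_ne hz hzb
  obtain ⟨ρ, hρ1, hρ2⟩ := exists_between (mem_ball.1 hzb')
  obtain ⟨v, hv, -, hvu, -⟩ := glob (by norm_cast) (dist_nonneg.trans_lt hρ1) hρ2 hu
  have hvu' : v =ᶠ[𝓝 z] u := by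
    filter_upwards [isOpen_ball.mem_nhds (mem_ball.2 hρ1)] with y hy using hvu y (ball_subset_closedBall hy)
  have heq := solves_AA hvu' (hs z hzb')
  rw [nondiv hε hv] at heq
  set W : Euc n → ℝ := fun x => v x + K * NN y0 x with hW
  have hWc : ContDiff ℝ 2 W := hv.add (contDiff_const.mul (NN_contDiff y0))
  have hWm : IsLocalMax W z := by
    filter_upwards [hvu', isOpen_ball.mem_nhds hzb'] with y hy hy2
    simp only [hW]
    rw [hy, hvu'.self_of_nhds]
    exact hzmax (ball_subset_closedBall hy2)
  have hpW : ∀ i, pd i W = fun x => pd i v x + K * pd i (NN y0) x := fun i => funext fun x => by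
    have d2 : DifferentiableAt ℝ (NN y0) x := (NN_contDiff y0 (k := 1)).differentiable (by norm_num) x
    rw [hW, pd_add (hv.differentiable (by norm_num) x) (d2.const_mul K), pd_const_mul K d2]
  have hpW2 : ∀ i j, pd i (pd j W) z = pd i (pd j v) z + K * (if j = i then 2 else 0) := fun i j => by
    have d1 : DifferentiableAt ℝ (pd j v) z := (contDiff_pd (m := 1) hv (by norm_num) j).differentiable (by norm_num) z
    have d2 : DifferentiableAt ℝ (pd j (NN y0)) z := (contDiff_pd (m := 1) (NN_contDiff (k := 2) y0) (by norm_num) j).differentiable (by norm_num) z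
    rw [hpW, pd_add d1 (d2.const_mul K), pd_const_mul K d2, pd_pd_NN]
  have hg0 : ∀ i, pd i v z = - (2 * K * (z i - y0 i)) := fun i => by
    have : pd i W z = 0 := by unfold pd; rw [hWm.fderiv_eq_zero]; simp
    rw [hpW, pd_NN] at this
    simp only at this
    linarith
  have hdiag : ∀ i, pd i (pd i W) z ≤ 0 := fun i => by
    have := hess_nonpos hWc hWm i i 1 0; linarith
  have habs : ∀ i j, |pd i (pd j W) z| ≤ -(pd i (pd i W) z + pd j (pd j W) z) / 2 := fun i j => by
    have h1 := hess_nonpos hWc hWm i j 1 1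
    have h2 := hess_nonpos hWc hWm i j 1 (-1)
    rw [abs_le]; constructor <;> linarith
  set s := sg ε v z with hsdef
  have s0 : 0 < s := sg_pos hε v z
  have hsN : s = ε + 4 * K ^ 2 * NN y0 z := by
    rw [hsdef, sg, NN, Finset.mul_sum]
    congr 1
    exact Finset.sum_congr rfl fun i _ => by rw [hg0]; ring
  have hgs : ∑ i, pd i v z ^ 2 ≤ s := by rw [hsdef, sg]; linarith
  set T := -∑ i, pd i (pd i W) z with hT
  have hT0 : 0 ≤ T := by rw [hT, neg_nonneg]; exact Finset.sum_nonpos fun i _ => hdiag i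
  have hlap : lap v z = -T - 2 * K * n := by
    have : ∀ i, pd i (pd i v) z = pd i (pd i W) z - 2 * K := fun i => by rw [hpW2]; simp; ring
    simp only [lap, this, Finset.sum_sub_distrib, Finset.sum_const, Finset.card_univ, Fintype.card_fin, nsmul_eq_mul]
    rw [hT]; ring
  set Q := ∑ i, ∑ j, pd i v z * pd j v z * pd i (pd j v) z with hQ
  have hQ1 : |Q| ≤ s * (n * T) + 2 * K * s := by
    have e : Q = (∑ i, ∑ j, pd i v z * pd j v z * pd i (pd j W) z) - 2 * K * ∑ i, pd i v z ^ 2 := by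
      have : ∀ i j, pd i v z * pd j v z * pd i (pd j v) z = pd i v z * pd j v z * pd i (pd j W) z - (if j = i then 2 * K * pd i v z ^ 2 else 0) := by
        intro i j
        rw [hpW2]
        split_ifs with h
        · subst h; ring
        · ring
      simp only [hQ, this, Finset.sum_sub_distrib, Finset.sum_ite_eq', Finset.sum_ite_eq, Finset.mem_univ, if_true, Finset.mul_sum]
    rw [e]
    refine (abs_sub _ _).trans (add_le_add ?_ ?_)
    · refine (Finset.abs_sum_le_sum_abs _ _).trans ?_
      have : ∀ i, |∑ j, pd i v z * pd j v z * pd i (pd j W) z| ≤ ∑ j, s * (-(pd i (pd i W) z + pd j (pd j W) z) / 2) := by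
        intro i
        refine (Finset.abs_sum_le_sum_abs _ _).trans (Finset.sum_le_sum fun j _ => ?_)
        rw [abs_mul]
        refine mul_le_mul ?_ (habs i j) (abs_nonneg _) s0.le
        rw [abs_mul]
        have h1 := sq_le_sg hε v z i
        have h2 := sq_le_sg hε v z j
        nlinarith [sq_nonneg (|pd i v z| - |pd j v z|), sq_abs (pd i v z), sq_abs (pd j v z)]
      refine (Finset.sum_le_sum fun i _ => this i).trans (le_of_eq ?_)
      simp only [← Finset.mul_sum, ← Finset.sum_div, Finset.sum_neg_distrib, Finset.sum_add_distrib, Finset.sum_const, Finset.card_univ, Fintype.card_fin, nsmul_eq_mul]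
      rw [hT]; ring
    · rw [abs_of_nonneg (by positivity)]
      gcongr
  have hQs : |(p - 2) * Q / s| ≤ |p - 2| * (n * T + 2 * K) := by
    rw [abs_div, abs_mul, abs_of_pos s0, div_le_iff₀ s0, mul_assoc]
    gcongr
    linarith
  have hn1 : (1:ℝ) ≤ n := by exact_mod_cast hn
  have hmain : K ≤ -(lap v z + (p - 2) * Q / s) := by
    have h1 := (abs_le.1 hQs).2
    have h2 : |p - 2| * (n * T + 2 * K) ≤ T / 2 + K := by
      have := mul_le_mul_of_nonneg_right hpn hT0
      have := mul_le_mul_of_nonneg_right hp hKp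
      linarith
    have h3 := mul_le_mul_of_nonneg_left hn1 hKp
    rw [hlap]
    linarith
  obtain ⟨hN1, hN2⟩ := hN z hz
  have hs1 : 1 ≤ s := by
    have h1 : 1 / R ≤ K := by linarith
    have h2 : 1 ≤ K * R := by rwa [div_le_iff₀ hR] at h1
    rw [hsN]
    have h3 := mul_le_mul_of_nonneg_left hN1 (sq_nonneg K)
    have h4 : 1 ≤ K ^ 2 * R ^ 2 := by rw [← mul_pow]; exact one_le_pow₀ h2
    linarith
  have hs2 : s ≤ K ^ 2 * B := by
    rw [hsN, hB]
    have h3 := mul_le_mul_of_nonneg_left hN2 (sq_nonneg K)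
    have h4 : 1 ≤ K ^ 2 := one_le_pow₀ hK1
    linarith
  have hσ : s ^ (-(1/4) : ℝ) ≤ s ^ ((p - 2) / 2) :=
    rpow_le_rpow_of_exponent_le hs1 (by linarith [(abs_le.1 hp).1])
  have hF1 : s ^ (-(1/4) : ℝ) * K ≤ F := by
    calc _ ≤ s ^ ((p - 2) / 2) * -(lap v z + (p - 2) * Q / s) :=
          mul_le_mul hσ hmain hKp (by positivity)
      _ = f z := by rw [← heq]; ring
      _ ≤ F := (le_abs_self _).trans (hf z hzb')
  have hF0 : 0 < F := lt_of_lt_of_le (by positivity) hF1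
  have hF2 : K ≤ F * s ^ ((1/4) : ℝ) := by
    rw [rpow_neg s0.le, inv_mul_le_iff₀ (by positivity)] at hF1
    linarith
  have hF3 : K ^ 4 ≤ F ^ 4 * s := by
    have := pow_le_pow_left₀ hKp hF2 4
    rw [mul_pow, ← rpow_natCast (s ^ ((1/4) : ℝ)), ← rpow_mul s0.le] at this
    norm_num at this
    exact this
  have hF4 : K ^ 4 ≤ F ^ 4 * (K ^ 2 * B) := hF3.trans (by gcongr)
  have hF5 : K ^ 2 ≤ F ^ 4 * B := by
    have : K ^ 2 * K ^ 2 ≤ K ^ 2 * (F ^ 4 * B) := by linarith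
    exact le_of_mul_le_mul_left this (by positivity)
  have hF6 : (F ^ 2 * B) ^ 2 < K ^ 2 := pow_lt_pow_left₀ (by linarith) hFB (by norm_num)
  have hF7 : F ^ 4 * B ≤ (F ^ 2 * B) ^ 2 := by
    have : (F ^ 2 * B) ^ 2 = F ^ 4 * B * B := by ring
    rw [this]; exact le_mul_of_one_le_right (by positivity) hB1
  linarith

lemma sup_bound (hn : 1 ≤ n) {x₀ : Euc n} {R p F M0 : ℝ} (hR : 0 < R) (hp : |p - 2| ≤ 1 / 2) (hpn : |p - 2| * n ≤ 1 / 2) :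
    ∃ K : ℝ, ∀ ε : ℝ, 0 < ε → ε < 1 → ∀ f u : Euc n → ℝ, ContDiffOn ℝ 2 u (ball x₀ (2 * R)) →
      ContinuousOn u (closedBall x₀ (2 * R)) → SolvesReg p ε f u (ball x₀ (2 * R)) →
      (∀ x ∈ ball x₀ (2 * R), |f x| ≤ F) → (∀ x ∈ sphere x₀ (2 * R), |u x| ≤ M0) →
      ∀ x ∈ closedBall x₀ (2 * R), |u x| ≤ K := by
  obtain ⟨K, hK⟩ := sup_upper (x₀ := x₀) (F := F) (M0 := M0) hn hR hp hpn
  refine ⟨K, fun ε hε hε1 f u hu huc hs hf hM x hx => ?_⟩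
  have h1 := hK ε hε hε1 f u hu huc hs hf (fun y hy => (le_abs_self _).trans (hM y hy)) x hx
  have h2 := hK ε hε hε1 (fun x => - f x) (fun x => - u x) hu.neg huc.neg ?_ (fun y hy => by simpa using hf y hy)
    (fun y hy => (neg_le_abs _).trans (hM y hy)) x hx
  · rw [abs_le]; constructor <;> linarith
  · intro y hy
    show _ = -(f y)
    rw [← hs y hy, neg_inj, ← Finset.sum_neg_distrib]
    refine Finset.sum_congr rfl fun i _ => ?_
    have hg : ∀ w, gradient (fun x => - u x) w = - gradient u w := fun w => by
      ext l; rw [gradient_apply', pd_neg]; simp [gradient_apply']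
    simp only [hg, norm_neg, smul_neg]
    simp [fderiv_fun_neg]
end mp

section w1
variable {n : ℕ}

lemma ball_int {x₀ : Euc n} {r : ℝ} {F : Euc n → ℝ} (hF : Continuous F) : IntegrableOn F (ball x₀ r) :=
  (hF.continuousOn.integrableOn_compact (isCompact_closedBall x₀ r)).mono_set ball_subset_closedBall

lemma ball_mono {x₀ : Euc n} {r : ℝ} {F G : Euc n → ℝ} (hF : Continuous F) (hG : Continuous G)
    (h : ∀ x ∈ ball x₀ r, F x ≤ G x) : ∫ x in ball x₀ r, F x ≤ ∫ x in ball x₀ r, G x :=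
  setIntegral_mono_on (ball_int hF) (ball_int hG) measurableSet_ball h

lemma ball_full {x₀ : Euc n} {r : ℝ} {F : Euc n → ℝ} (h : ∀ x ∉ ball x₀ r, F x = 0) :
    ∫ x in ball x₀ r, F x = ∫ x, F x := setIntegral_eq_integral_of_forall_compl_eq_zero h

lemma sum_pow_le {ι : Type*} [Fintype ι] {m : ℕ} (hm : Even m) (hm0 : m ≠ 0) (a : ι → ℝ) :
    (∑ i, a i) ^ m ≤ (Fintype.card ι : ℝ) ^ m * ∑ i, a i ^ m := by
  by_cases h : Nonempty ι
  · obtain ⟨k, -, hk⟩ := Finset.exists_max_image Finset.univ (fun i => |a i|) Finset.univ_nonempty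
    have h1 : |∑ i, a i| ≤ Fintype.card ι * |a k| := by
      refine (Finset.abs_sum_le_sum_abs _ _).trans ?_
      refine (Finset.sum_le_sum fun i hi => hk i hi).trans (le_of_eq ?_)
      simp
    rw [← hm.pow_abs]
    refine (pow_le_pow_left₀ (abs_nonneg _) h1 m).trans ?_
    rw [mul_pow, hm.pow_abs]
    gcongr
    exact Finset.single_le_sum (f := fun i => a i ^ m) (fun i _ => hm.pow_nonneg _) (Finset.mem_univ k)
  · have := not_nonempty_iff.1 h
    simp [hm0]

lemma add_pow_le2 {m : ℕ} (hm : Even m) (hm0 : m ≠ 0) (a b : ℝ) : (a + b) ^ m ≤ 2 ^ m * (a ^ m + b ^ m) := by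
  have := sum_pow_le hm hm0 ![a, b]
  simpa using this

lemma add_pow_le3 {m : ℕ} (hm : Even m) (hm0 : m ≠ 0) (a b c : ℝ) : (a + b + c) ^ m ≤ 3 ^ m * (a ^ m + b ^ m + c ^ m) := by
  have := sum_pow_le hm hm0 ![a, b, c]
  simpa [Fin.sum_univ_three] using this

lemma young1 (M : ℕ) {A δ : ℝ} (hA : 0 ≤ A) (hδ : 0 < δ) {x : ℝ} (hx : 0 ≤ x) :
    A * x ^ (M + 1) ≤ δ * x ^ (M + 2) + A * (A / δ) ^ (M + 1) := by
  rcases le_total x (A / δ) with h | h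
  · have : 0 ≤ δ * x ^ (M + 2) := by positivity
    have h2 : A * x ^ (M + 1) ≤ A * (A / δ) ^ (M + 1) := by gcongr
    linarith
  · have h1 : A ≤ δ * x := by rwa [div_le_iff₀' hδ] at h
    have h2 : A * x ^ (M + 1) ≤ δ * x * x ^ (M + 1) := by gcongr
    have h3 : 0 ≤ A * (A / δ) ^ (M + 1) := by positivity
    have h4 : δ * x * x ^ (M + 1) = δ * x ^ (M + 2) := by ring
    linarith

lemma young2 (M : ℕ) {x y : ℝ} (hx : 0 ≤ x) (hy : 0 ≤ y) : x ^ (M + 1) * y ≤ x ^ (M + 2) + y ^ (M + 2) := by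
  rcases le_total x y with h | h
  · have : x ^ (M + 1) * y ≤ y ^ (M + 1) * y := by gcongr
    have h3 : 0 ≤ x ^ (M + 2) := by positivity
    have h4 : y ^ (M + 1) * y = y ^ (M + 2) := by ring
    linarith
  · have : x ^ (M + 1) * y ≤ x ^ (M + 1) * x := by gcongr
    have h3 : 0 ≤ y ^ (M + 2) := by positivity
    have h4 : x ^ (M + 1) * x = x ^ (M + 2) := by ring
    linarith

/-- cutoff data -/
structure Cut (x₀ : Euc n) (r N : ℝ) (φ : Euc n → ℝ) : Prop where
  cc : Cc φ
  nn : ∀ x, 0 ≤ φ x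
  le : ∀ x, φ x ≤ 1
  sup : tsupport φ ⊆ ball x₀ r
  N0 : 0 ≤ N
  d1 : ∀ i x, |pd i φ x| ≤ N
  d2 : ∀ i j x, |pd i (pd j φ) x| ≤ N

lemma Cut.z {x₀ : Euc n} {r N : ℝ} {φ : Euc n → ℝ} (h : Cut x₀ r N φ) {x : Euc n} (hx : x ∉ ball x₀ r) : φ x = 0 :=
  image_eq_zero_of_notMem_tsupport fun h2 => hx (h.sup h2)

def XX (m : ℕ) (φ u : Euc n → ℝ) (x : Euc n) : ℝ := ∑ i, (φ x * pd i u x) ^ m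
def YY (m : ℕ) (φ u : Euc n → ℝ) (x : Euc n) : ℝ := ∑ i, ∑ j, (φ x ^ 2 * pd i (pd j u) x) ^ m
def ZZ (m : ℕ) (p ε : ℝ) (f φ u : Euc n → ℝ) (x : Euc n) : ℝ := (φ x ^ 2 * (f x * sg ε u x ^ ((2 - p) / 2))) ^ m

lemma XX_cont (m : ℕ) {φ u : Euc n → ℝ} (hφ : Continuous φ) (hu : ContDiff ℝ 2 u) : Continuous (XX m φ u) := by
  unfold XX
  exact continuous_finsetSum _ fun i _ => (hφ.mul (cont_pd (hu.of_le (by norm_num)) i)).pow m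

lemma YY_cont (m : ℕ) {φ u : Euc n → ℝ} (hφ : Continuous φ) (hu : ContDiff ℝ 2 u) : Continuous (YY m φ u) := by
  unfold YY
  exact continuous_finsetSum _ fun i _ => continuous_finsetSum _ fun j _ =>
    ((hφ.pow 2).mul (cont_pd (contDiff_pd hu (by norm_num) j) i)).pow m

lemma ZZ_cont (m : ℕ) {p ε : ℝ} (hε : 0 < ε) {f φ u : Euc n → ℝ} (hf : Continuous f) (hφ : Continuous φ) (hu : ContDiff ℝ 2 u) :
    Continuous (ZZ m p ε f φ u) := by
  unfold ZZ
  exact ((hφ.pow 2).mul (hf.mul (contDiff_sgr (m := 1) hε hu (by norm_num) _).continuous)).pow m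

lemma XX_ge {m : ℕ} (hm : Even m) (φ u : Euc n → ℝ) (x : Euc n) (i : Fin n) : (φ x * pd i u x) ^ m ≤ XX m φ u x :=
  Finset.single_le_sum (f := fun i => (φ x * pd i u x) ^ m) (fun i _ => hm.pow_nonneg _) (Finset.mem_univ i)

lemma XX_nn {m : ℕ} (hm : Even m) (φ u : Euc n → ℝ) (x : Euc n) : 0 ≤ XX m φ u x :=
  Finset.sum_nonneg fun i _ => hm.pow_nonneg _

lemma YY_nn {m : ℕ} (hm : Even m) (φ u : Euc n → ℝ) (x : Euc n) : 0 ≤ YY m φ u x :=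
  Finset.sum_nonneg fun i _ => Finset.sum_nonneg fun j _ => hm.pow_nonneg _

lemma YY_ge {m : ℕ} (hm : Even m) (φ u : Euc n → ℝ) (x : Euc n) (i j : Fin n) :
    (φ x ^ 2 * pd i (pd j u) x) ^ m ≤ YY m φ u x :=
  (Finset.single_le_sum (f := fun j => (φ x ^ 2 * pd i (pd j u) x) ^ m) (fun j _ => hm.pow_nonneg _) (Finset.mem_univ j)).trans
  (Finset.single_le_sum (f := fun i => ∑ j, (φ x ^ 2 * pd i (pd j u) x) ^ m) (fun i _ => Finset.sum_nonneg fun j _ => hm.pow_nonneg _) (Finset.mem_univ i))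

lemma estc (M : ℕ) (hM : Even M) {x₀ : Euc n} {r N : ℝ} {φ : Euc n → ℝ} (hφ : Cut x₀ r N φ) {δ M0 : ℝ} (hδ : 0 < δ) (hM0 : 0 ≤ M0) :
    ∃ C : ℝ, ∀ u : Euc n → ℝ, ContDiff ℝ 2 u → (∀ x, |u x| ≤ M0) →
      ∫ x in ball x₀ r, XX (M + 2) φ u x ≤ δ * (∫ x in ball x₀ r, YY (M + 2) φ u x) + C := by
  set d := min (1 / 2) (δ / 2) / (n + 1) with hd
  have hd0 : 0 < d := by positivity
  set A := M0 * ((M + 2) * N + (M + 1)) with hA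
  have hA0 : 0 ≤ A := by have := hφ.N0; positivity
  set C0 := A * (A / d) ^ (M + 1) with hC0
  have hm : Even (M + 2) := hM.add even_two
  refine ⟨2 * n * (∫ x in ball x₀ r, C0), fun u hu hb => ?_⟩
  have hXc := XX_cont (M + 2) hφ.cc.cont hu
  have hYc := YY_cont (M + 2) hφ.cc.cont hu
  have key : ∀ i, ∫ x in ball x₀ r, (φ x * pd i u x) ^ (M + 2) ≤
      d * (∫ x in ball x₀ r, XX (M + 2) φ u x) + d * (∫ x in ball x₀ r, YY (M + 2) φ u x) + ∫ x in ball x₀ r, C0 := by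
    intro i
    have hui : ContDiff ℝ 1 (pd i u) := contDiff_pd hu (by norm_num) i
    have hφ1 : ContDiff ℝ 1 φ := hφ.cc.1.of_le (by norm_cast)
    have hg : ContDiff ℝ 1 (fun x => φ x ^ (M + 2) * pd i u x ^ (M + 1)) := (hφ1.pow _).mul (hui.pow _)
    have hgc : HasCompactSupport (fun x => φ x ^ (M + 2) * pd i u x ^ (M + 1)) :=
      HasCompactSupport.mul_right (hφ.cc.2.comp_left (g := fun t => t ^ (M + 2)) (by simp))
    have h1 := ibp (hu.of_le (by norm_num)) hg hgc i
    have hpg : ∀ x, pd i (fun x => φ x ^ (M + 2) * pd i u x ^ (M + 1)) x =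
        (M + 2) * φ x ^ (M + 1) * pd i φ x * pd i u x ^ (M + 1) + φ x ^ (M + 2) * ((M + 1) * pd i u x ^ M * pd i (pd i u) x) := by
      intro x
      have d1 : DifferentiableAt ℝ φ x := hφ.cc.diff x
      have d2 : DifferentiableAt ℝ (pd i u) x := hui.differentiable (by norm_num) x
      rw [pd_mul (d1.fun_pow _) (d2.fun_pow _), pd_pow _ d1, pd_pow _ d2]
      push_cast
      simp
    have h2 : ∫ x in ball x₀ r, (φ x * pd i u x) ^ (M + 2) = ∫ x in ball x₀ r, -(u x * pd i (fun x => φ x ^ (M + 2) * pd i u x ^ (M + 1)) x) := by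
      rw [ball_full (fun x hx => by rw [hφ.z hx]; simp), ball_full, integral_neg, h1, neg_neg]
      · congr 1; ext x; ring
      · intro x hx
        rw [hpg, hφ.z hx]; simp
    rw [h2, ← integral_const_mul, ← integral_const_mul, ← integral_add (ball_int (by fun_prop)) (ball_int (by fun_prop)),
      ← integral_add (ball_int (by fun_prop)) (ball_int (by fun_prop))]
    refine ball_mono ?_ (by fun_prop) fun x _ => ?_
    · exact (hu.continuous.mul (cont_pd hg i)).neg
    rw [hpg]
    set a := |φ x * pd i u x| with ha
    set b := |φ x ^ 2 * pd i (pd i u) x| with hb'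
    have ha0 : 0 ≤ a := abs_nonneg _
    have hb0 : 0 ≤ b := abs_nonneg _
    have hz0 : 0 ≤ max a b := le_max_of_le_left ha0
    have e1 : a ^ (M + 1) ≤ (max a b) ^ (M + 1) := by gcongr; exact le_max_left _ _
    have e2 : a ^ M * b ≤ (max a b) ^ (M + 1) := by
      rw [pow_succ]; gcongr
      · exact le_max_left _ _
      · exact le_max_right _ _
    have e3 : (max a b) ^ (M + 2) ≤ XX (M + 2) φ u x + YY (M + 2) φ u x := by
      have k1 := XX_ge hm φ u x i
      have k2 := YY_ge hm φ u x i i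
      have k3 := XX_nn hm φ u x
      have k4 := YY_nn hm φ u x
      rw [← hm.pow_abs] at k1 k2
      rcases max_choice a b with h | h <;> rw [h] <;> linarith
    have e4 : -(u x * ((M + 2) * φ x ^ (M + 1) * pd i φ x * pd i u x ^ (M + 1) + φ x ^ (M + 2) * ((M + 1) * pd i u x ^ M * pd i (pd i u) x)))
        ≤ M0 * ((M + 2) * N * a ^ (M + 1) + (M + 1) * (a ^ M * b)) := by
      refine (neg_le_abs _).trans ?_
      rw [abs_mul]
      refine mul_le_mul (hb x) ?_ (abs_nonneg _) hM0
      refine (abs_add_le _ _).trans (add_le_add ?_ (le_of_eq ?_))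
      · have : (M + 2) * φ x ^ (M + 1) * pd i φ x * pd i u x ^ (M + 1) = (M + 2) * pd i φ x * (φ x * pd i u x) ^ (M + 1) := by ring
        rw [this, abs_mul, abs_mul, abs_pow, abs_of_nonneg (by positivity : (0:ℝ) ≤ M + 2)]
        gcongr
        exact hφ.d1 i x
      · have : φ x ^ (M + 2) * ((M + 1) * pd i u x ^ M * pd i (pd i u) x) = (M + 1) * ((φ x * pd i u x) ^ M * (φ x ^ 2 * pd i (pd i u) x)) := by ring
        rw [this, abs_mul, abs_mul, abs_pow, abs_of_nonneg (by positivity : (0:ℝ) ≤ M + 1)]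
    have e5 : M0 * ((M + 2) * N * a ^ (M + 1) + (M + 1) * (a ^ M * b)) ≤ A * (max a b) ^ (M + 1) := by
      have := hφ.N0
      calc _ ≤ M0 * ((M + 2) * N * (max a b) ^ (M + 1) + (M + 1) * (max a b) ^ (M + 1)) := by gcongr
        _ = _ := by rw [hA]; ring
    have e6 := young1 M hA0 hd0 hz0
    have e7 := mul_le_mul_of_nonneg_left e3 hd0.le
    linarith
  have hsum : ∫ x in ball x₀ r, XX (M + 2) φ u x = ∑ i, ∫ x in ball x₀ r, (φ x * pd i u x) ^ (M + 2) := by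
    unfold XX
    exact integral_finsetSum _ fun i _ => ball_int ((hφ.cc.cont.mul (cont_pd (hu.of_le (by norm_num)) i)).pow _)
  set X := ∫ x in ball x₀ r, XX (M + 2) φ u x
  set Y := ∫ x in ball x₀ r, YY (M + 2) φ u x
  set D := ∫ x in ball x₀ r, C0
  have hX0 : 0 ≤ X := integral_nonneg fun x => XX_nn hm φ u x
  have hY0 : 0 ≤ Y := integral_nonneg fun x => YY_nn hm φ u x
  have hs : X ≤ n * (d * X + d * Y + D) := by
    conv_lhs => rw [hsum]
    refine (Finset.sum_le_sum fun i _ => key i).trans (le_of_eq ?_)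
    simp
    ring
  have hnd : n * d ≤ min (1 / 2) (δ / 2) := by
    rw [hd, mul_div_assoc', div_le_iff₀ (by positivity)]
    have : 0 < min (1 / 2) (δ / 2) := by positivity
    linarith
  have i1 := mul_le_mul_of_nonneg_right (hnd.trans (min_le_left _ _)) hX0
  have i2 := mul_le_mul_of_nonneg_right (hnd.trans (min_le_right _ _)) hY0
  linarith
end w1

section w2
variable {n : ℕ}

def QU (u : Euc n → ℝ) (x : Euc n) : ℝ := ∑ i, ∑ j, pd i u x * pd j u x * pd i (pd j u) x

lemma QU_le {ε : ℝ} (hε : 0 < ε) (u : Euc n → ℝ) (x : Euc n) : |QU u x| ≤ sg ε u x * ∑ i, ∑ j, |pd i (pd j u) x| := by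
  unfold QU
  rw [Finset.mul_sum]
  refine (Finset.abs_sum_le_sum_abs _ _).trans (Finset.sum_le_sum fun i _ => ?_)
  rw [Finset.mul_sum]
  refine (Finset.abs_sum_le_sum_abs _ _).trans (Finset.sum_le_sum fun j _ => ?_)
  rw [abs_mul]
  gcongr
  rw [abs_mul]
  have h1 := sq_le_sg hε u x i
  have h2 := sq_le_sg hε u x j
  nlinarith [sq_nonneg (|pd i u x| - |pd j u x|), sq_abs (pd i u x), sq_abs (pd j u x)]

lemma even_pow_le {m : ℕ} (hm : Even m) {a b : ℝ} (h : |a| ≤ b) : a ^ m ≤ b ^ m := by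
  rw [← hm.pow_abs]; exact pow_le_pow_left₀ (abs_nonneg _) h m

def LL (φ u : Euc n → ℝ) (i j : Fin n) (x : Euc n) : ℝ :=
  (2 * pd i φ x * pd j φ x + 2 * φ x * pd i (pd j φ) x) * u x + 2 * pd j φ x * (φ x * pd i u x) + 2 * pd i φ x * (φ x * pd j u x)

lemma pd_pd_phiu {x₀ : Euc n} {r N : ℝ} {φ : Euc n → ℝ} (hφ : Cut x₀ r N φ) {u : Euc n → ℝ} (hu : ContDiff ℝ 2 u) (i j : Fin n) (x : Euc n) :
    pd i (pd j (fun y => φ y ^ 2 * u y)) x = φ x ^ 2 * pd i (pd j u) x + LL φ u i j x := by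
  have dφ := hφ.cc.diff
  have dφj := (hφ.cc.pd j).diff
  have du : Differentiable ℝ u := hu.differentiable (by norm_num)
  have duj : Differentiable ℝ (pd j u) := (contDiff_pd (m := 1) hu (by norm_num) j).differentiable (by norm_num)
  have h1 : pd j (fun y => φ y ^ 2 * u y) = fun y => (2 * (φ y * pd j φ y)) * u y + φ y ^ 2 * pd j u y := by
    ext y
    rw [pd_mul ((dφ y).fun_pow 2) (du y), pd_pow 2 (dφ y)]; push_cast; ring
  have a1 : DifferentiableAt ℝ (fun y => φ y * pd j φ y) x := (dφ x).fun_mul (dφj x)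
  have a2 : DifferentiableAt ℝ (fun y => 2 * (φ y * pd j φ y)) x := a1.const_mul 2
  rw [h1, pd_add (a2.fun_mul (du x)) (((dφ x).fun_pow 2).fun_mul (duj x)), pd_mul a2 (du x),
    pd_const_mul 2 a1, pd_mul (dφ x) (dφj x), pd_mul ((dφ x).fun_pow 2) (duj x), pd_pow 2 (dφ x), LL]
  push_cast; ring

lemma LL_le {m : ℕ} (hm : Even m) (hm0 : m ≠ 0) {x₀ : Euc n} {r N : ℝ} {φ : Euc n → ℝ} (hφ : Cut x₀ r N φ) (M0 : ℝ) :
    ∃ C : ℝ, 0 ≤ C ∧ ∀ u : Euc n → ℝ, (∀ x, |u x| ≤ M0) → ∀ i j x, LL φ u i j x ^ m ≤ C * (1 + XX m φ u x) := by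
  have hN := hφ.N0
  refine ⟨3 ^ m * (((2 * N * N + 2 * 1 * N) * M0) ^ m + 2 * (2 * N) ^ m), by have := hm.pow_nonneg ((2 * N * N + 2 * 1 * N) * M0); positivity, fun u hu i j x => ?_⟩
  refine (add_pow_le3 hm hm0 _ _ _).trans ?_
  have b1 : ((2 * pd i φ x * pd j φ x + 2 * φ x * pd i (pd j φ) x) * u x) ^ m ≤ ((2 * N * N + 2 * 1 * N) * M0) ^ m := by
    apply even_pow_le hm
    rw [abs_mul]
    refine mul_le_mul ?_ (hu x) (abs_nonneg _) (by positivity)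
    refine (abs_add_le _ _).trans (add_le_add ?_ ?_)
    · rw [abs_mul, abs_mul, abs_two]; gcongr <;> apply hφ.d1
    · rw [abs_mul, abs_mul, abs_two, abs_of_nonneg (hφ.nn x)]
      have := hφ.nn x
      gcongr
      · exact hφ.le x
      · exact hφ.d2 i j x
  have b2 : ∀ i j, (2 * pd j φ x * (φ x * pd i u x)) ^ m ≤ (2 * N) ^ m * XX m φ u x := fun i j => by
    rw [mul_pow]
    refine mul_le_mul (even_pow_le hm ?_) (XX_ge hm φ u x i) (hm.pow_nonneg _) (by positivity)
    rw [abs_mul, abs_two]; gcongr; apply hφ.d1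
  have hX := XX_nn hm φ u x
  rw [mul_assoc (3 ^ m)]
  refine mul_le_mul_of_nonneg_left ?_ (by positivity)
  have b3 := b2 i j
  have b4 := b2 j i
  have : 0 ≤ ((2 * N * N + 2 * 1 * N) * M0) ^ m := hm.pow_nonneg _
  have : 0 ≤ ((2 * N * N + 2 * 1 * N) * M0) ^ m * XX m φ u x := by positivity
  have : 0 ≤ (2 * N) ^ m := by positivity
  linarith

lemma esta (hn : n ≠ 0) (M : ℕ) (hM1 : 1 ≤ M) (hM : Even M) : ∃ C1 : ℝ, 0 < C1 ∧ ∀ (x₀ : Euc n) (r N : ℝ) (φ : Euc n → ℝ), Cut x₀ r N φ →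
    ∀ M0 : ℝ, ∃ C2 : ℝ, 0 ≤ C2 ∧ ∀ p ε : ℝ, |p - 2| ≤ 1 → 0 < ε → ∀ f u : Euc n → ℝ, Continuous f → ContDiff ℝ 2 u →
      (∀ x, |u x| ≤ M0) → (∀ x ∈ ball x₀ r, -(∑ i, pd i (AA p ε u i) x) = f x) →
      ∫ x in ball x₀ r, YY (M + 2) φ u x ≤ C1 * (∫ x in ball x₀ r, ZZ (M + 2) p ε f φ u x)
        + C1 * |p - 2| * (∫ x in ball x₀ r, YY (M + 2) φ u x) + C2 * ((∫ x in ball x₀ r, (1:ℝ)) + ∫ x in ball x₀ r, XX (M + 2) φ u x) := by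
  obtain ⟨K, hK, hcz⟩ := cz n hn M hM1 hM
  have hm : Even (M + 2) := hM.add even_two
  have hm0 : M + 2 ≠ 0 := by omega
  set m := M + 2 with hmdef
  set D : ℝ := (n * n) ^ m with hD
  have hn' : (1:ℝ) ≤ n := by exact_mod_cast Nat.one_le_iff_ne_zero.2 hn
  have hD1 : 1 ≤ D := one_le_pow₀ (by nlinarith)
  set E : ℝ := 2 ^ m * (n * (n * K)) with hE
  have hE0 : 0 ≤ E := by positivity
  refine ⟨E * (2 ^ m * 2 ^ m * D), by positivity, fun x₀ r N φ hφ M0 => ?_⟩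
  obtain ⟨CL, hCL0, hCL⟩ := LL_le hm hm0 hφ M0
  refine ⟨E * (2 ^ m * (n ^ m * (n * CL))) + 2 ^ m * (n * (n * CL)), by positivity, fun p ε hp hε f u hf hu hub hs => ?_⟩
  set v : Euc n → ℝ := fun y => φ y ^ 2 * u y with hv
  have hφ2 : ContDiff ℝ 2 φ := hφ.cc.1.of_le (by norm_cast)
  have hvC : ContDiff ℝ 2 v := (hφ2.pow 2).mul hu
  have hvc : HasCompactSupport v := HasCompactSupport.mul_right (hφ.cc.2.comp_left (g := fun t => t ^ 2) (by simp))
  have hpc : ∀ i j, Continuous (pd i (pd j v)) := fun i j => cont_pd (contDiff_pd hvC (by norm_num) j) i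
  have hz : ∀ x ∉ ball x₀ r, ∀ i j, pd i (pd j v) x = 0 := fun x hx i j => by
    have : x ∉ tsupport v := fun h => hx (hφ.sup ((closure_mono (by
      intro y hy
      rw [Function.mem_support] at hy ⊢
      intro h0; apply hy; simp [hv, h0] : Function.support v ⊆ Function.support φ)) h))
    exact image_eq_zero_of_notMem_tsupport fun h => this (tsupport_pd_subset v j (tsupport_pd_subset _ i h))
  have hXc := XX_cont m hφ.cc.cont hu
  have hYc := YY_cont m hφ.cc.cont hu
  have hZc := ZZ_cont (p := p) m hε hf hφ.cc.cont hu
  have hlc : Continuous (lap v) := by unfold lap; exact continuous_finsetSum _ fun i _ => hpc i i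
  set X := ∫ x in ball x₀ r, XX m φ u x
  set Y := ∫ x in ball x₀ r, YY m φ u x
  set Z := ∫ x in ball x₀ r, ZZ m p ε f φ u x
  set V := ∫ x in ball x₀ r, (1:ℝ)
  have hsc : ∀ i, Continuous (fun x => ∑ j, pd i (pd j v) x ^ m) := fun i => continuous_finsetSum _ fun j _ => (hpc i j).pow m
  have hsc2 : ∀ i j, Continuous (fun x => pd i (pd j v) x ^ m) := fun i j => (hpc i j).pow m
  have s1 : Y ≤ E * (∫ x in ball x₀ r, lap v x ^ m) + 2 ^ m * (n * (n * CL)) * (V + X) := by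
    have t1 : Y ≤ ∫ x in ball x₀ r, (2 ^ m * (∑ i, ∑ j, pd i (pd j v) x ^ m) + 2 ^ m * (n * (n * CL)) * (1 + XX m φ u x)) := by
      refine ball_mono hYc ?_ fun x _ => ?_
      · refine (continuous_const.mul (continuous_finsetSum _ fun i _ => continuous_finsetSum _ fun j _ => (hpc i j).pow m)).add (by fun_prop)
      · have : ∀ i j, (φ x ^ 2 * pd i (pd j u) x) ^ m ≤ 2 ^ m * pd i (pd j v) x ^ m + 2 ^ m * (CL * (1 + XX m φ u x)) := fun i j => by
          have e1 := pd_pd_phiu hφ hu i j x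
          have e2 : φ x ^ 2 * pd i (pd j u) x = pd i (pd j v) x + (- LL φ u i j x) := by rw [e1]; ring
          rw [e2]
          refine (add_pow_le2 hm hm0 _ _).trans ?_
          rw [mul_add, hm.neg_pow]
          have := hCL u hub i j x
          gcongr
        unfold YY
        refine (Finset.sum_le_sum fun i _ => Finset.sum_le_sum fun j _ => this i j).trans (le_of_eq ?_)
        simp only [Finset.sum_add_distrib, ← Finset.mul_sum, Finset.sum_const, Finset.card_univ, Fintype.card_fin, nsmul_eq_mul]
        ring
    rw [integral_add (ball_int ?_) (ball_int (by fun_prop)), integral_const_mul, integral_const_mul, integral_add (ball_int (by fun_prop)) (ball_int hXc),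
      integral_finsetSum _ (fun i _ => ball_int (hsc i))] at t1
    · refine t1.trans (add_le_add ?_ le_rfl)
      rw [hE, mul_assoc]
      gcongr
      have : ∀ i, ∫ x in ball x₀ r, ∑ j, pd i (pd j v) x ^ m ≤ n * (K * ∫ x in ball x₀ r, lap v x ^ m) := fun i => by
        rw [integral_finsetSum _ (fun j _ => ball_int (hsc2 i j))]
        have : ∀ j, ∫ x in ball x₀ r, pd i (pd j v) x ^ m ≤ K * ∫ x in ball x₀ r, lap v x ^ m := fun j => by
          rw [ball_full (fun x hx => by rw [hz x hx]; simp [hm0]), ball_full (fun x hx => by simp [lap, hz x hx, hm0])]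
          exact hcz v hvC hvc i j
        refine (Finset.sum_le_sum fun j _ => this j).trans (le_of_eq ?_)
        simp
      refine (Finset.sum_le_sum fun j _ => this j).trans (le_of_eq ?_)
      simp; ring
    · exact (continuous_const.mul (continuous_finsetSum _ fun i _ => continuous_finsetSum _ fun j _ => (hpc i j).pow m))
  have s2 : ∫ x in ball x₀ r, lap v x ^ m ≤ 2 ^ m * 2 ^ m * D * Z + 2 ^ m * 2 ^ m * D * |p - 2| * Y + 2 ^ m * (n ^ m * (n * CL)) * (V + X) := by
    rw [← integral_add (ball_int (by fun_prop)) (ball_int hXc), ← integral_const_mul, ← integral_const_mul, ← integral_const_mul, ← integral_add (ball_int (by fun_prop)) (ball_int (by fun_prop)), ← integral_add (ball_int (by fun_prop)) (ball_int (by fun_prop))]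
    refine ball_mono (hlc.pow m) (by fun_prop) fun x hx => ?_
    have s0 := sg_pos hε u x
    have e1 : lap v x = φ x ^ 2 * lap u x + ∑ i, LL φ u i i x := by
      simp only [lap, hv, pd_pd_phiu hφ hu, Finset.sum_add_distrib, Finset.mul_sum]
    have e2 : φ x ^ 2 * lap u x = -(φ x ^ 2 * (f x * sg ε u x ^ ((2 - p) / 2))) + -((p - 2) * (φ x ^ 2 * (QU u x / sg ε u x))) := by
      have h1 := hs x hx
      rw [nondiv hε hu] at h1
      have h2 : sg ε u x ^ ((p - 2) / 2) * sg ε u x ^ ((2 - p) / 2) = 1 := by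
        rw [← rpow_add s0, show (p - 2) / 2 + (2 - p) / 2 = 0 by ring, rpow_zero]
      rw [← h1, QU]
      linear_combination (-(φ x ^ 2 * (lap u x + (p - 2) * (∑ i, ∑ j, pd i u x * pd j u x * pd i (pd j u) x) / sg ε u x))) * h2
    have e3 : ((p - 2) * (φ x ^ 2 * (QU u x / sg ε u x))) ^ m ≤ |p - 2| * (D * YY m φ u x) := by
      rw [mul_pow]
      have k1 : (p - 2) ^ m ≤ |p - 2| := by
        rw [← hm.pow_abs]; exact pow_le_of_le_one (abs_nonneg _) hp hm0
      have k2 : (φ x ^ 2 * (QU u x / sg ε u x)) ^ m ≤ (∑ i, ∑ j, |φ x ^ 2 * pd i (pd j u) x|) ^ m := by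
        apply even_pow_le hm
        have : ∑ i, ∑ j, |φ x ^ 2 * pd i (pd j u) x| = φ x ^ 2 * ∑ i, ∑ j, |pd i (pd j u) x| := by
          simp only [Finset.mul_sum, abs_mul, abs_of_nonneg (sq_nonneg (φ x))]
        rw [this, abs_mul, abs_div, abs_of_nonneg (sq_nonneg (φ x)), abs_of_pos s0]
        gcongr
        rw [div_le_iff₀ s0, mul_comm]
        exact QU_le hε u x
      have k3 : (∑ i, ∑ j, |φ x ^ 2 * pd i (pd j u) x|) ^ m ≤ D * YY m φ u x := by
        refine (sum_pow_le hm hm0 _).trans ?_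
        have : ∀ i, (∑ j, |φ x ^ 2 * pd i (pd j u) x|) ^ m ≤ n ^ m * ∑ j, (φ x ^ 2 * pd i (pd j u) x) ^ m := fun i => by
          refine (sum_pow_le hm hm0 _).trans (le_of_eq ?_)
          simp only [hm.pow_abs, Fintype.card_fin]
        rw [Fintype.card_fin, hD, mul_pow, mul_assoc]
        gcongr
        unfold YY
        rw [Finset.mul_sum]
        exact Finset.sum_le_sum fun i _ => this i
      exact mul_le_mul k1 (k2.trans k3) (hm.pow_nonneg _) (abs_nonneg _)
    have e4 : (φ x ^ 2 * lap u x) ^ m ≤ 2 ^ m * (D * ZZ m p ε f φ u x + |p - 2| * (D * YY m φ u x)) := by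
      rw [e2]
      refine (add_pow_le2 hm hm0 _ _).trans ?_
      rw [hm.neg_pow, hm.neg_pow]
      have hz0 : 0 ≤ ZZ m p ε f φ u x := hm.pow_nonneg _
      gcongr
      exact le_mul_of_one_le_left hz0 hD1
    have e5 : (∑ i, LL φ u i i x) ^ m ≤ n ^ m * (n * CL) * (1 + XX m φ u x) := by
      refine (sum_pow_le hm hm0 _).trans ?_
      rw [Fintype.card_fin, mul_assoc]
      gcongr
      refine (Finset.sum_le_sum fun i _ => hCL u hub i i x).trans (le_of_eq ?_)
      simp; ring
    rw [e1]
    refine (add_pow_le2 hm hm0 _ _).trans ?_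
    have := mul_le_mul_of_nonneg_left (add_le_add e4 e5) (by positivity : (0:ℝ) ≤ 2 ^ m)
    refine this.trans (le_of_eq ?_)
    ring
  have := mul_le_mul_of_nonneg_left s2 hE0
  linarith
end w2

section w3
variable {n : ℕ}

lemma rpow_le_one_add {s a : ℝ} (hs : 0 < s) (h0 : 0 ≤ a) (h1 : a ≤ 1) : s ^ a ≤ 1 + s := by
  rcases le_total s 1 with h | h
  · exact (rpow_le_one hs.le h h0).trans (by linarith)
  · exact (rpow_le_rpow_of_exponent_le h h1).trans (by rw [rpow_one]; linarith)

lemma abs_pd_le_sg {ε : ℝ} (hε : 0 < ε) (u : Euc n → ℝ) (x : Euc n) (i : Fin n) : |pd i u x| ≤ sg ε u x ^ ((1:ℝ) / 2) := by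
  rw [← Real.sqrt_eq_rpow]
  exact Real.abs_le_sqrt (sq_le_sg hε u x i)

lemma phi_sg_le {M : ℕ} (hM : Even M) {ε : ℝ} (hε1 : ε < 1) {φ : Euc n → ℝ} (u : Euc n → ℝ) (x : Euc n) (h0 : 0 ≤ φ x) (h1 : φ x ≤ 1) :
    φ x ^ 2 * (1 + sg ε u x) ≤ (2 + n) * (1 + XX (M + 2) φ u x) := by
  have hm : Even (M + 2) := hM.add even_two
  have hX := XX_nn hm φ u x
  have h2 : φ x ^ 2 ≤ 1 := pow_le_one₀ h0 h1
  have h3 : ∑ i, (φ x * pd i u x) ^ 2 ≤ n + XX (M + 2) φ u x := by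
    have : ∀ i, (φ x * pd i u x) ^ 2 ≤ 1 + (φ x * pd i u x) ^ (M + 2) := fun i => by
      set y := φ x * pd i u x
      have hy := hm.pow_nonneg y
      rcases le_total |y| 1 with h | h
      · have := (sq_le_one_iff_abs_le_one y).2 h
        linarith
      · have h4 : (1:ℝ) ≤ y ^ M := by rw [← hM.pow_abs]; exact one_le_pow₀ h
        have : y ^ (M + 2) = y ^ M * y ^ 2 := by ring
        nlinarith [sq_nonneg y]
    refine (Finset.sum_le_sum fun i _ => this i).trans (le_of_eq ?_)
    simp [Finset.sum_add_distrib, XX]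
  have h4 : φ x ^ 2 * (1 + sg ε u x) = φ x ^ 2 * (1 + ε) + ∑ i, (φ x * pd i u x) ^ 2 := by
    simp only [sg, mul_pow, ← Finset.mul_sum]; ring
  have h5 : φ x ^ 2 * (1 + ε) ≤ 2 := by nlinarith [sq_nonneg (φ x)]
  have h6 : 0 ≤ (n:ℝ) * XX (M + 2) φ u x := by positivity
  rw [h4]; linarith

lemma estb (M : ℕ) (hM : Even M) (x₀ : Euc n) (r N : ℝ) (φ : Euc n → ℝ) (hφ : Cut x₀ r N φ) (F : ℝ) (hF : 0 ≤ F) :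
    ∃ C2 : ℝ, 0 ≤ C2 ∧ ∀ p ε : ℝ, |p - 2| * (M + 2) ≤ 1 → |p - 2| * (M + 2) * (n * n) ≤ 1 / 2 → 0 < ε → ε < 1 → ∀ f u : Euc n → ℝ, ContDiff ℝ 1 f →
      (∀ x, |f x| ≤ F) → (∀ i x, |pd i f x| ≤ F) → ContDiff ℝ 2 u →
      (∀ x ∈ ball x₀ r, -(∑ i, pd i (AA p ε u i) x) = f x) →
      ∫ x in ball x₀ r, ZZ (M + 2) p ε f φ u x ≤ 
        2 * (M + 2) * |p - 2| * (∫ x in ball x₀ r, YY (M + 2) φ u x) + C2 * ((∫ x in ball x₀ r, (1:ℝ)) + ∫ x in ball x₀ r, XX (M + 2) φ u x) := by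
  have hm : Even (M + 2) := hM.add even_two
  have hN := hφ.N0
  refine ⟨2 * (n * (((M + 1) * F ^ M * F + F ^ (M + 1) * (M + 2) * (2 * N)) * (2 + n))), by positivity,
    fun p ε hp1 hp2 hε hε1 f u hf hfb hfd hu hs => ?_⟩
  set a : ℝ := (2 - p) / 2 * (M + 2) with ha
  set t : Euc n → ℝ := fun x => sg ε u x ^ ((2 - p) / 2) with ht
  have hs0 := sg_pos hε u
  have hφ1 : ContDiff ℝ 1 φ := hφ.cc.1.of_le (by norm_cast)
  have hAc : ∀ i, ContDiff ℝ 1 (AA p ε u i) := fun i => (contDiff_sgr hε hu (by norm_num) _).mul (contDiff_pd hu (by norm_num) i)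
  set ψ : Euc n → ℝ := fun x => φ x ^ (2 * M + 4) * (f x ^ (M + 1) * sg ε u x ^ a) with hψ
  have hsa : ContDiff ℝ 1 (fun x => sg ε u x ^ a) := contDiff_sgr hε hu (by norm_num) a
  have hψC : ContDiff ℝ 1 ψ := (hφ1.pow _).mul ((hf.pow _).mul hsa)
  have hψc : HasCompactSupport ψ := HasCompactSupport.mul_right (hφ.cc.2.comp_left (g := fun t => t ^ (2 * M + 4)) (by simp))
  have hta : ∀ x, sg ε u x ^ a = t x ^ (M + 2) := fun x => by
    rw [ht, ha, rpow_mul (hs0 x).le, ← rpow_natCast]; push_cast; rfl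
  have hσt : ∀ x, sg ε u x ^ ((p - 2) / 2) * t x = 1 := fun x => by
    rw [ht, ← rpow_add (hs0 x), show (p - 2) / 2 + (2 - p) / 2 = 0 by ring, rpow_zero]
  have hpψ : ∀ i x, AA p ε u i x * pd i ψ x =
      ((M + 1) * f x ^ M * pd i f x * φ x ^ (2 * M + 4) + f x ^ (M + 1) * ((2 * M + 4) * φ x ^ (2 * M + 3) * pd i φ x)) * (t x ^ (M + 1) * pd i u x)
      + a * (φ x ^ 2 * (f x * t x)) ^ (M + 1) * (φ x ^ 2 * ((pd i u x * pd i (sg ε u) x) / sg ε u x)) := fun i x => by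
    have d1 := hφ.cc.diff x
    have d2 := hf.differentiable (by norm_num) x
    have d3 := (contDiff_sg (m := 1) ε hu (by norm_num)).differentiable (by norm_num) x
    have d4 := hsa.differentiable (by norm_num) x
    rw [hψ, pd_mul (d1.fun_pow _) ((d2.fun_pow _).fun_mul d4), pd_mul (d2.fun_pow _) d4, pd_pow _ d1, pd_pow _ d2, pd_rpow a d3 (hs0 x), AA,
      rpow_sub_one (hs0 x).ne', hta]
    have hσ := hσt x
    simp only [Nat.add_sub_cancel, show 2 * M + 4 - 1 = 2 * M + 3 by omega]
    push_cast
    have e : sg ε u x ^ ((p - 2) / 2) * t x ^ (M + 2) = t x ^ (M + 1) := by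
      rw [show t x ^ (M + 2) = t x * t x ^ (M + 1) by ring, ← mul_assoc, hσ, one_mul]
    linear_combination (pd i u x * ((2 * M + 4) * φ x ^ (2 * M + 3) * pd i φ x * f x ^ (M + 1) + φ x ^ (2 * M + 4) * ((M + 1) * f x ^ M * pd i f x
      + f x ^ (M + 1) * (a * pd i (sg ε u) x / sg ε u x)))) * e
  have h1 : ∫ x in ball x₀ r, ZZ (M + 2) p ε f φ u x = ∫ x in ball x₀ r, ∑ i, AA p ε u i x * pd i ψ x := by
    have hzψ : ∀ x ∉ ball x₀ r, ψ x = 0 := fun x hx => by simp [hψ, hφ.z hx]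
    have hzψ' : ∀ x ∉ ball x₀ r, ∀ i, AA p ε u i x * pd i ψ x = 0 := fun x hx i => by rw [hpψ]; simp [hφ.z hx]
    have e1 : ∫ x in ball x₀ r, ZZ (M + 2) p ε f φ u x = ∫ x in ball x₀ r, ∑ i, -(pd i (AA p ε u i) x * ψ x) := by
      refine setIntegral_congr_fun measurableSet_ball fun x hx => ?_
      rw [Finset.sum_neg_distrib, ← Finset.sum_mul, ← neg_mul, hs x hx, ZZ, hψ]
      simp only [hta]
      ring
    have c1 : ∀ i, Continuous (fun x => -(pd i (AA p ε u i) x * ψ x)) := fun i => ((cont_pd (hAc i) i).mul hψC.continuous).neg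
    have c2 : ∀ i, Continuous (fun x => AA p ε u i x * pd i ψ x) := fun i => (hAc i).continuous.mul (cont_pd hψC i)
    rw [e1, integral_finsetSum _ (fun i _ => ball_int (c1 i)), integral_finsetSum _ (fun i _ => ball_int (c2 i))]
    refine Finset.sum_congr rfl fun i _ => ?_
    rw [ball_full (fun x hx => by rw [hzψ x hx]; simp), ball_full (fun x hx => hzψ' x hx i), ibp (hAc i) hψC hψc i, integral_neg]
  have hXc := XX_cont (M + 2) hφ.cc.cont hu
  have hYc := YY_cont (M + 2) hφ.cc.cont hu
  have hZc := ZZ_cont (p := p) (M + 2) hε hf.continuous hφ.cc.cont hu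
  set G := ((M + 1) * F ^ M * F + F ^ (M + 1) * (M + 2) * (2 * N)) * (2 + (n:ℝ)) with hG
  have h2 : ∫ x in ball x₀ r, ∑ i, AA p ε u i x * pd i ψ x ≤ ∫ x in ball x₀ r, 
      (n * G * (1 + XX (M + 2) φ u x) + |p - 2| * (M + 2) * ((n * n) * ZZ (M + 2) p ε f φ u x + YY (M + 2) φ u x)) := by
    refine ball_mono (continuous_finsetSum _ fun i _ => ((hAc i).continuous.mul (cont_pd hψC i))) (by fun_prop) fun x _ => ?_
    have s0 := hs0 x
    have hφ0 := hφ.nn x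
    have hφ1 := hφ.le x
    have ht0 : 0 < t x := rpow_pos_of_pos s0 _
    simp only [hpψ, Finset.sum_add_distrib]
    refine add_le_add ?_ ?_
    · have : ∀ i, ((M + 1) * f x ^ M * pd i f x * φ x ^ (2 * M + 4) + f x ^ (M + 1) * ((2 * M + 4) * φ x ^ (2 * M + 3) * pd i φ x)) * (t x ^ (M + 1) * pd i u x)
          ≤ G * (1 + XX (M + 2) φ u x) := fun i => by
        have k1 : |t x ^ (M + 1) * pd i u x| ≤ 1 + sg ε u x := by
          rw [abs_mul, abs_of_pos (by positivity)]
          calc _ ≤ t x ^ (M + 1) * sg ε u x ^ ((1:ℝ) / 2) := by gcongr; exact abs_pd_le_sg hε u x i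
            _ = sg ε u x ^ ((2 - p) / 2 * (M + 1) + 1 / 2) := by
              rw [rpow_add s0, rpow_mul s0.le, ← rpow_natCast (t x)]; push_cast; rfl
            _ ≤ _ := by
              have := abs_le.1 (show |(p - 2) * (M + 1)| ≤ 1 by
                rw [abs_mul, abs_of_nonneg (by positivity : (0:ℝ) ≤ M + 1)]
                have := abs_nonneg (p - 2)
                linarith)
              exact rpow_le_one_add s0 (by linarith) (by linarith)
        have k2 : |(M + 1) * f x ^ M * pd i f x * φ x ^ (2 * M + 4) + f x ^ (M + 1) * ((2 * M + 4) * φ x ^ (2 * M + 3) * pd i φ x)| ≤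
            ((M + 1) * F ^ M * F + F ^ (M + 1) * (M + 2) * (2 * N)) * φ x ^ 2 := by
          refine (abs_add_le _ _).trans ?_
          rw [add_mul (_ * F ^ M * F)]
          refine add_le_add ?_ ?_
          · rw [abs_mul, abs_mul, abs_mul, abs_pow, abs_pow, abs_of_nonneg (by positivity : (0:ℝ) ≤ M + 1), abs_of_nonneg hφ0]
            have : φ x ^ (2 * M + 4) ≤ φ x ^ 2 := pow_le_pow_of_le_one hφ0 hφ1 (by omega)
            have k3 := hfb x
            have k4 := hfd i x
            refine mul_le_mul ?_ this (by positivity) (by positivity)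
            gcongr
          · rw [abs_mul, abs_mul, abs_mul, abs_pow, abs_pow, abs_of_nonneg (by positivity : (0:ℝ) ≤ 2 * M + 4), abs_of_nonneg hφ0]
            have : φ x ^ (2 * M + 3) ≤ φ x ^ 2 := pow_le_pow_of_le_one hφ0 hφ1 (by omega)
            have k3 := hfb x
            have k4 := hφ.d1 i x
            calc _ ≤ F ^ (M + 1) * ((2 * M + 4) * φ x ^ 2 * N) := by gcongr
              _ = _ := by ring
        refine (le_abs_self _).trans ?_
        rw [abs_mul]
        calc _ ≤ (((M + 1) * F ^ M * F + F ^ (M + 1) * (M + 2) * (2 * N)) * φ x ^ 2) * (1 + sg ε u x) := by gcongr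
          _ = ((M + 1) * F ^ M * F + F ^ (M + 1) * (M + 2) * (2 * N)) * (φ x ^ 2 * (1 + sg ε u x)) := by ring
          _ ≤ ((M + 1) * F ^ M * F + F ^ (M + 1) * (M + 2) * (2 * N)) * ((2 + n) * (1 + XX (M + 2) φ u x)) := by
            exact mul_le_mul_of_nonneg_left (phi_sg_le hM hε1 u x hφ0 hφ1) (by positivity)
          _ = _ := by rw [hG]; ring
      refine (Finset.sum_le_sum fun i _ => this i).trans (le_of_eq ?_)
      simp; ring
    · rw [← Finset.mul_sum, ← Finset.mul_sum, ← Finset.sum_div]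
      have e1 : ∑ i, pd i u x * pd i (sg ε u) x = 2 * QU u x := by
        simp only [pd_sg ε hu, QU, Finset.mul_sum]
        exact Finset.sum_congr rfl fun i _ => Finset.sum_congr rfl fun j _ => by ring
      rw [e1]
      refine (le_abs_self _).trans ?_
      have e2 : |φ x ^ 2 * (2 * QU u x / sg ε u x)| ≤ 2 * ∑ i, ∑ j, |φ x ^ 2 * pd i (pd j u) x| := by
        have : ∑ i, ∑ j, |φ x ^ 2 * pd i (pd j u) x| = φ x ^ 2 * ∑ i, ∑ j, |pd i (pd j u) x| := by
          simp only [Finset.mul_sum, abs_mul, abs_of_nonneg (sq_nonneg (φ x))]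
        rw [this, abs_mul, abs_div, abs_of_nonneg (sq_nonneg (φ x)), abs_of_pos s0, mul_left_comm]
        gcongr
        rw [div_le_iff₀ s0, abs_mul, abs_two]
        linarith [QU_le hε u x]
      have e3 : |a| = |p - 2| * (M + 2) / 2 := by
        rw [ha, abs_mul, abs_div, abs_two, abs_of_nonneg (by positivity : (0:ℝ) ≤ M + 2), abs_sub_comm]; ring
      rw [abs_mul, abs_mul, e3, abs_pow]
      set b := |φ x ^ 2 * (f x * t x)| with hb
      have hb0 : 0 ≤ b := abs_nonneg _
      have e4 : b ^ (M + 1) * ∑ i, ∑ j, |φ x ^ 2 * pd i (pd j u) x| ≤ (n * n) * ZZ (M + 2) p ε f φ u x + YY (M + 2) φ u x := by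
        simp only [Finset.mul_sum]
        have : ∀ i j, b ^ (M + 1) * |φ x ^ 2 * pd i (pd j u) x| ≤ ZZ (M + 2) p ε f φ u x + (φ x ^ 2 * pd i (pd j u) x) ^ (M + 2) := fun i j => by
          refine (young2 M hb0 (abs_nonneg _)).trans (le_of_eq ?_)
          rw [hb, hm.pow_abs, hm.pow_abs]; rfl
        refine (Finset.sum_le_sum fun i _ => Finset.sum_le_sum fun j _ => this i j).trans (le_of_eq ?_)
        simp only [Finset.sum_add_distrib, Finset.sum_const, Finset.card_univ, Fintype.card_fin, nsmul_eq_mul, YY]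
        ring
      calc _ ≤ |p - 2| * (M + 2) / 2 * b ^ (M + 1) * (2 * ∑ i, ∑ j, |φ x ^ 2 * pd i (pd j u) x|) := by gcongr
        _ = |p - 2| * (M + 2) * (b ^ (M + 1) * ∑ i, ∑ j, |φ x ^ 2 * pd i (pd j u) x|) := by ring
        _ ≤ _ := by gcongr
  rw [integral_add (ball_int (by fun_prop)) (ball_int (by fun_prop)), integral_const_mul, integral_const_mul, integral_add (ball_int (by fun_prop)) (ball_int hXc),
    integral_add (ball_int (by fun_prop)) (ball_int hYc), integral_const_mul, ← h1] at h2
  have hZ0 : 0 ≤ ∫ x in ball x₀ r, ZZ (M + 2) p ε f φ u x := integral_nonneg fun x => hm.pow_nonneg _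
  have := mul_le_mul_of_nonneg_right hp2 hZ0
  linarith

lemma estW (hn : n ≠ 0) (M : ℕ) (hM1 : 1 ≤ M) (hM : Even M) : ∃ c : ℝ, 0 < c ∧ ∀ p : ℝ, |p - 2| < c →
    ∀ (x₀ : Euc n) (r N : ℝ) (φ : Euc n → ℝ), Cut x₀ r N φ → ∀ F M0 : ℝ, 0 ≤ F → 0 ≤ M0 → ∃ C : ℝ, ∀ ε : ℝ, 0 < ε → ε < 1 →
      ∀ f u : Euc n → ℝ, ContDiff ℝ 1 f →
      (∀ x, |f x| ≤ F) → (∀ i x, |pd i f x| ≤ F) → ContDiff ℝ 2 u → (∀ x, |u x| ≤ M0) →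
      (∀ x ∈ ball x₀ r, -(∑ i, pd i (AA p ε u i) x) = f x) →
      (∫ x in ball x₀ r, XX (M + 2) φ u x) + ∫ x in ball x₀ r, YY (M + 2) φ u x ≤ C := by
  obtain ⟨C1, hC1, ha⟩ := esta hn M hM1 hM
  have hm : Even (M + 2) := hM.add even_two
  refine ⟨1 / (8 * (C1 + 1) * (M + 2) * (n * n + 1)), by positivity, fun p hp x₀ r N φ hφ F M0 hF hM0 => ?_⟩
  rw [lt_div_iff₀ (by positivity)] at hp
  set d := |p - 2|
  have hd : 0 ≤ d := abs_nonneg _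
  have q1 : 0 ≤ d * M := by positivity
  have q2 : 0 ≤ d * (M + 2) * (n * n) := by positivity
  have q3 : 0 ≤ d * (M + 2) * C1 := by positivity
  have q4 : 0 ≤ d * (M + 2) * C1 * (n * n) := by positivity
  have q5 : 0 ≤ d * C1 * M := by positivity
  have q6 : 0 ≤ d * C1 := by positivity
  have hp' : 8 * (d * (M + 2) * C1) + 8 * (d * (M + 2)) + 8 * (d * (M + 2) * (n * n)) + 8 * (d * (M + 2) * C1 * (n * n)) < 1 := by linarith
  have p1 : d ≤ 1 := by linarith
  have p2 : d * (M + 2) ≤ 1 := by linarith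
  have p3 : d * (M + 2) * (n * n) ≤ 1 / 2 := by linarith
  have p4 : C1 * (2 * (M + 2) * d) + C1 * d ≤ 1 / 2 := by linarith
  obtain ⟨C2, hC2, ha⟩ := ha x₀ r N φ hφ M0
  obtain ⟨C3, hC3, hb⟩ := estb M hM x₀ r N φ hφ F hF
  set K := C2 + C1 * C3 with hK
  have hK0 : 0 ≤ K := by positivity
  obtain ⟨C4, hc⟩ := estc M hM hφ (δ := 1 / (4 * (K + 1))) (M0 := M0) (by positivity) hM0
  set V := ∫ x in ball x₀ r, (1:ℝ)
  refine ⟨2 * (4 * K * V + 4 * K * C4) + |C4|, fun ε hε hε1 f u hf hfb hfd hu hub hs => ?_⟩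
  have ha := ha p ε p1 hε f u hf.continuous hu hub hs
  have hb := hb p ε p2 p3 hε hε1 f u hf hfb hfd hu hs
  have hc := hc u hu hub
  have hX0 : 0 ≤ ∫ x in ball x₀ r, XX (M + 2) φ u x := integral_nonneg fun x => XX_nn hm φ u x
  have hY0 : 0 ≤ ∫ x in ball x₀ r, YY (M + 2) φ u x := integral_nonneg fun x => YY_nn hm φ u x
  set X := ∫ x in ball x₀ r, XX (M + 2) φ u x
  set Y := ∫ x in ball x₀ r, YY (M + 2) φ u x
  set Z := ∫ x in ball x₀ r, ZZ (M + 2) p ε f φ u x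
  have r1 := mul_le_mul_of_nonneg_left hb hC1.le
  have r2 := mul_le_mul_of_nonneg_right p4 hY0
  have r3 : Y ≤ 2 * K * (V + X) := by
    have : K * (V + X) = C2 * (V + X) + C1 * (C3 * (V + X)) := by rw [hK]; ring
    linarith
  have r4 : 2 * K * X ≤ 2 * K * (1 / (4 * (K + 1)) * Y + C4) := by gcongr
  have r5 : 2 * K * (1 / (4 * (K + 1)) * Y) ≤ 1 / 2 * Y := by
    rw [← mul_assoc]
    gcongr
    rw [mul_one_div, div_le_iff₀ (by positivity)]
    linarith
  have r6 : Y ≤ 4 * K * V + 4 * K * C4 := by linarith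
  have r7 : 1 / (4 * (K + 1)) * Y ≤ 1 * Y := by
    gcongr
    rw [div_le_iff₀ (by positivity)]
    linarith
  have r8 := le_abs_self C4
  linarith
end w3

section k1
variable {n : ℕ}

def hh (r t : ℝ) : ℝ := |t| ^ r * t

lemma hh_deriv {r : ℝ} (hr : 0 ≤ r) (t : ℝ) : HasDerivAt (hh r) ((r + 1) * |t| ^ r) t := by
  rcases hr.eq_or_lt with rfl | hr
  · have : hh 0 = fun t => t := by ext t; simp [hh]
    rw [this]; simpa using hasDerivAt_id' t
  rcases lt_trichotomy t 0 with h | rfl | h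
  · have h1 := ((hasDerivAt_id t).neg.rpow_const (p := r + 1) (Or.inl (by simp; exact h.ne))).neg
    have h2 : hh r =ᶠ[𝓝 t] fun t => -((-t) ^ (r + 1)) := by
      filter_upwards [Iio_mem_nhds h] with y hy
      rw [hh, abs_of_neg hy, rpow_add_one (by simpa using (ne_of_lt hy))]; ring
    refine (h1.congr_of_eventuallyEq h2).congr_deriv ?_
    rw [abs_of_neg h]; simp; ring
  · rw [hasDerivAt_iff_tendsto_slope]
    have : slope (hh r) 0 =ᶠ[𝓝[≠] 0] fun t => |t| ^ r := by
      filter_upwards [self_mem_nhdsWithin] with y hy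
      simp only [slope_def_field, hh]
      have : y ≠ 0 := hy
      field_simp; simp
    rw [Filter.tendsto_congr' this]
    have hc : Continuous (fun t : ℝ => |t| ^ r) := by fun_prop (disch := exact hr.le)
    have := (hc.tendsto 0).mono_left (nhdsWithin_le_nhds (s := {0}ᶜ))
    simpa [hr.ne'] using this
  · have h1 := ((hasDerivAt_id t).rpow_const (p := r + 1) (Or.inl h.ne'))
    have h2 : hh r =ᶠ[𝓝 t] fun t => t ^ (r + 1) := by
      filter_upwards [Ioi_mem_nhds h] with y hy
      rw [hh, abs_of_pos hy, rpow_add_one (ne_of_gt hy)]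
    refine (h1.congr_of_eventuallyEq h2).congr_deriv ?_
    rw [abs_of_pos h]; simp

lemma abs_rpow_cont {r : ℝ} (hr : 0 ≤ r) : Continuous (fun t : ℝ => |t| ^ r) :=
  continuous_abs.rpow_const fun _ => Or.inr hr

lemma hh_contDiff {r : ℝ} (hr : 0 ≤ r) : ContDiff ℝ 1 (hh r) := by
  rw [contDiff_one_iff_deriv]
  refine ⟨fun t => (hh_deriv hr t).differentiableAt, ?_⟩
  have : deriv (hh r) = fun t => (r + 1) * |t| ^ r := funext fun t => (hh_deriv hr t).deriv
  rw [this]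
  exact continuous_const.mul (abs_rpow_cont hr)

/-- pointwise Young -/
lemma pt1 {y a r e P w φ δ N β q : ℝ} (hφ : 0 ≤ φ) (hq : 1 ≤ q) (hβ : |β| ≤ 2 * q) (hδ : 0 ≤ δ) (hr : |r| ≤ 6 * δ) (he : |e| ≤ 2 * δ)
    (hP : |P| ≤ N) :
    (2 * q - 1) * φ ^ 2 * (y * a) - q * φ ^ 2 * (y ^ 2 / 24 + a ^ 2 / 48) - 2000 * (q * φ ^ 2 * δ ^ 2) - 60 * (N ^ 2 * w ^ 2) ≤
      (y + r) * (2 * φ * P * w + φ ^ 2 * β * e + φ ^ 2 * (2 * q - 1) * a) := by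
  have hN : 0 ≤ N := (abs_nonneg _).trans hP
  have hq0 : 0 ≤ q := by linarith
  have t1 : -(y * (2 * φ * P * w)) ≤ φ ^ 2 * y ^ 2 / 48 + 48 * (N ^ 2 * w ^ 2) := by
    have h1 : (P * w) ^ 2 ≤ N ^ 2 * w ^ 2 := by
      rw [mul_pow]
      exact mul_le_mul_of_nonneg_right (sq_le_sq' (by linarith [(abs_le.1 hP).1]) (abs_le.1 hP).2) (sq_nonneg w)
    nlinarith [sq_nonneg (φ * y / 48 + P * w)]
  have t2 : -(y * (φ ^ 2 * β * e)) ≤ q * φ ^ 2 * (y ^ 2 / 48 + 192 * δ ^ 2) := by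
    have h1 : |y * (φ ^ 2 * β * e)| ≤ φ ^ 2 * (|y| * (2 * q) * (2 * δ)) := by
      rw [abs_mul, abs_mul, abs_mul, abs_of_nonneg (sq_nonneg φ)]
      calc _ ≤ |y| * (φ ^ 2 * (2 * q) * (2 * δ)) := by gcongr
        _ = _ := by ring
    have h2 : |y| * (2 * q) * (2 * δ) ≤ q * (y ^ 2 / 48 + 192 * δ ^ 2) := by
      have : |y| * 4 * δ ≤ y ^ 2 / 48 + 192 * δ ^ 2 := by
        nlinarith [sq_nonneg (|y| / 48 - 2 * δ), sq_abs y]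
      nlinarith
    have h3 := mul_le_mul_of_nonneg_left h2 (sq_nonneg φ)
    linarith [neg_le_abs (y * (φ ^ 2 * β * e))]
  have t3 : -(r * (2 * φ * P * w)) ≤ 6 * (q * φ ^ 2 * δ ^ 2) + 6 * (N ^ 2 * w ^ 2) := by
    have h1 : |r * (2 * φ * P * w)| ≤ 6 * δ * (2 * φ * N * |w|) := by
      rw [abs_mul, abs_mul, abs_mul, abs_mul, abs_two, abs_of_nonneg hφ]
      gcongr
    have h2 : 6 * δ * (2 * φ * N * |w|) ≤ 6 * (φ ^ 2 * δ ^ 2) + 6 * (N ^ 2 * w ^ 2) := by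
      rw [← sq_abs w]
      nlinarith [sq_nonneg (φ * δ - N * |w|)]
    have h3 : 1 * (φ ^ 2 * δ ^ 2) ≤ q * (φ ^ 2 * δ ^ 2) := by gcongr
    linarith [neg_le_abs (r * (2 * φ * P * w))]
  have t4 : -(r * (φ ^ 2 * β * e)) ≤ 24 * (q * φ ^ 2 * δ ^ 2) := by
    have h1 : |r * (φ ^ 2 * β * e)| ≤ 6 * δ * (φ ^ 2 * (2 * q) * (2 * δ)) := by
      rw [abs_mul, abs_mul, abs_mul, abs_of_nonneg (sq_nonneg φ)]
      gcongr
    linarith [neg_le_abs (r * (φ ^ 2 * β * e))]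
  have t5 : -(r * (φ ^ 2 * (2 * q - 1) * a)) ≤ q * φ ^ 2 * (a ^ 2 / 48 + 1728 * δ ^ 2) := by
    have h1 : |r * (φ ^ 2 * (2 * q - 1) * a)| ≤ 6 * δ * (φ ^ 2 * (2 * q) * |a|) := by
      rw [abs_mul, abs_mul, abs_mul, abs_of_nonneg (sq_nonneg φ), abs_of_nonneg (by linarith : 0 ≤ 2 * q - 1)]
      have h0 : 0 ≤ 2 * q - 1 := by linarith
      gcongr
      linarith
    have h2 : 12 * δ * |a| ≤ a ^ 2 / 48 + 1728 * δ ^ 2 := by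
      nlinarith [sq_nonneg (|a| / 48 - 6 * δ), sq_abs a]
    have h3 := mul_le_mul_of_nonneg_left h2 (by positivity : 0 ≤ q * φ ^ 2)
    linarith [neg_le_abs (r * (φ ^ 2 * (2 * q - 1) * a))]
  have t6 : 0 ≤ (q - 1) * (φ ^ 2 * y ^ 2) := mul_nonneg (by linarith) (by positivity)
  have t7 : 0 ≤ q * φ ^ 2 * δ ^ 2 := by positivity
  have t8 : 0 ≤ N ^ 2 * w ^ 2 := by positivity
  linarith

lemma pt2 {y a r e P v : Fin n → ℝ} {w φ δ N β q t : ℝ} (hφ : 0 ≤ φ) (hq : 1 ≤ q) (hβ : |β| ≤ 2 * q) (hδ : 0 ≤ δ) (hr : ∀ l, |r l| ≤ 6 * δ)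
    (he : ∀ l, |e l| ≤ 2 * δ) (hP : ∀ l, |P l| ≤ N) (ht : |t| ≤ 1 / 2) (hv : ∑ l, v l ^ 2 ≤ 1)
    (hy : ∀ l, y l = a l + t * (∑ m, v m * a m) * v l) :
    q / 4 * (φ ^ 2 * ∑ l, a l ^ 2) ≤
      (∑ l, (y l + r l) * (2 * φ * P l * w + φ ^ 2 * β * e l + φ ^ 2 * (2 * q - 1) * a l)) + n * (2000 * (q * φ ^ 2 * δ ^ 2) + 60 * (N ^ 2 * w ^ 2)) := by
  set S := ∑ m, v m * a m with hS
  set A := ∑ l, a l ^ 2 with hA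
  have hA0 : 0 ≤ A := Finset.sum_nonneg fun l _ => sq_nonneg _
  have hSA : S ^ 2 ≤ A := by
    have := Finset.sum_mul_sq_le_sq_mul_sq Finset.univ v a
    nlinarith
  obtain ⟨ht1, ht2⟩ := abs_le.1 ht
  have hya : A / 2 ≤ ∑ l, y l * a l := by
    have : ∑ l, y l * a l = A + t * S ^ 2 := by
      have e1 : t * S ^ 2 = ∑ l, t * S * (v l * a l) := by rw [← Finset.mul_sum, ← hS]; ring
      rw [e1, hA, ← Finset.sum_add_distrib]
      exact Finset.sum_congr rfl fun l _ => by rw [hy]; ring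
    rw [this]; nlinarith [sq_nonneg S]
  have hyy : ∑ l, y l ^ 2 ≤ 3 * A := by
    have : ∀ l, y l ^ 2 ≤ 2 * a l ^ 2 + 1 / 2 * A * v l ^ 2 := fun l => by
      rw [hy]
      have h1 : (t * S * v l) ^ 2 ≤ 1 / 4 * A * v l ^ 2 := by
        rw [mul_pow, mul_pow]; gcongr
        nlinarith
      nlinarith [sq_nonneg (a l - t * S * v l)]
    refine (Finset.sum_le_sum fun l _ => this l).trans ?_
    rw [Finset.sum_add_distrib, ← Finset.mul_sum, ← Finset.mul_sum]
    nlinarith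
  have h1 := Finset.sum_le_sum fun l (_ : l ∈ Finset.univ) => pt1 (y := y l) (a := a l) (w := w) hφ hq hβ hδ (hr l) (he l) (hP l)
  simp only [Finset.sum_sub_distrib, ← Finset.mul_sum, Finset.sum_add_distrib, ← Finset.sum_div, Finset.sum_const, Finset.card_univ, Fintype.card_fin, nsmul_eq_mul] at h1
  have h2 := mul_le_mul_of_nonneg_left hya (by have : 0 ≤ 2 * q - 1 := by linarith
                                               positivity : 0 ≤ (2 * q - 1) * φ ^ 2)
  have h3 := mul_le_mul_of_nonneg_left hyy (by have : 0 ≤ q := by linarith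
                                               positivity : 0 ≤ q * φ ^ 2)
  have h4 : 0 ≤ (q - 1) * (φ ^ 2 * A) := mul_nonneg (by linarith) (by positivity)
  have h5 : 0 ≤ φ ^ 2 * A := by positivity
  nlinarith

lemma swap {G ψ : Euc n → ℝ} (hG : ContDiff ℝ 1 G) (hψ : ContDiff ℝ 1 ψ) (hc : HasCompactSupport ψ) (i l : Fin n) :
    ∫ x, pd l G x * pd i ψ x = ∫ x, pd i G x * pd l ψ x := by
  have hk : ∀ k, ∫ x, pd l G x * pd i (JJ k ψ) x = ∫ x, pd i G x * pd l (JJ k ψ) x := fun k => by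
    have c := JJ_Cc k hψ.continuous hc
    have s : ∀ {φ : Euc n → ℝ}, Cc φ → ContDiff ℝ 1 φ := fun h => h.1.of_le (by norm_cast)
    have h1 := ibp hG (s (c.pd i)) (c.pd i).2 l
    have h2 := ibp hG (s (c.pd l)) (c.pd l).2 i
    have h3 : pd l (pd i (JJ k ψ)) = pd i (pd l (JJ k ψ)) := funext fun x => pd_comm (c.1.of_le (by norm_cast)) l i x
    rw [h3] at h1
    linarith
  have ht : ∀ i l, Filter.Tendsto (fun k => ∫ x, pd l G x * pd i (JJ k ψ) x) Filter.atTop (𝓝 (∫ x, pd l G x * pd i ψ x)) := fun i l => by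
    obtain ⟨C, hC0, hC⟩ := hcs_bdd (cont_pd hψ i) (hcs_pd hc i)
    have hK : IsCompact (cthickening 1 (tsupport ψ)) := hc.isCompact.cthickening
    obtain ⟨D, hD⟩ := hK.exists_bound_of_continuousOn (cont_pd hG l).continuousOn
    have hsub : ∀ k x, JJ k (pd i ψ) x ≠ 0 → x ∈ cthickening 1 (tsupport ψ) := by
      intro k x hx
      refine cthickening_mono ?_ _ (cthickening_subset_of_subset _ (tsupport_pd_subset _ i) (JJ_tsupport k _ (subset_tsupport _ hx)))
      rw [div_le_one (by positivity)]; linarith [(Nat.cast_nonneg k : (0:ℝ) ≤ k)]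
    simp only [JJ_pd _ hψ hc]
    refine tendsto_int hK (fun k => (cont_pd hG l).mul (JJ_Cc k (cont_pd hψ i) (hcs_pd hc i)).cont) (C := |D| * (3 * C)) (fun k x => ?_) (fun k x hx => ?_) (fun x => ?_)
    · by_cases h0 : JJ k (pd i ψ) x = 0
      · rw [h0]; simp; positivity
      · rw [abs_mul]
        have h1 := hD x (hsub k x h0)
        have h2 := JJ_bdd k (cont_pd hψ i) hC x
        exact mul_le_mul (h1.trans (le_abs_self D)) h2 (abs_nonneg _) (abs_nonneg _)
    · exact hsub k x fun h => hx (by rw [h]; simp)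
    · exact (JJ_tendsto (cont_pd hψ i) x).const_mul _
  exact tendsto_nhds_unique (ht i l) ((ht l i).congr fun k => (hk k).symm)
end k1

section k2
variable {n : ℕ}

lemma AA_contDiff {p ε : ℝ} (hε : 0 < ε) {u : Euc n → ℝ} (hu : ContDiff ℝ 3 u) (l : Fin n) : ContDiff ℝ 2 (AA p ε u l) := by
  unfold AA
  exact (contDiff_sgr hε hu (by norm_num) _).mul (contDiff_pd hu (by norm_num) l)

lemma cint {F : Euc n → ℝ} (hF : Continuous F) {ψ : Euc n → ℝ} (hψ : Continuous ψ) (hc : HasCompactSupport ψ) : Integrable (fun x => F x * ψ x) :=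
  (hF.mul hψ).integrable_of_hasCompactSupport hc.mul_left

lemma weak {p ε : ℝ} (hε : 0 < ε) {u f : Euc n → ℝ} (hu : ContDiff ℝ 3 u) (hf : ContDiff ℝ 2 f) {x₀ : Euc n} {r : ℝ}
    (he : ∀ x ∈ ball x₀ r, -(∑ l, pd l (AA p ε u l) x) = f x) {ψ : Euc n → ℝ} (hψ : ContDiff ℝ 1 ψ)
    (hc : HasCompactSupport ψ) (hs : tsupport ψ ⊆ ball x₀ r) (i j : Fin n) :
    ∫ x, ∑ l, pd j (pd i (AA p ε u l)) x * pd l ψ x = ∫ x, pd j (pd i f) x * ψ x := by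
  have hA := fun l => AA_contDiff (p := p) hε hu l
  have hA1 : ∀ l i, ContDiff ℝ 1 (pd i (AA p ε u l)) := fun l i => contDiff_pd (hA l) (by norm_num) i
  have hf1 : ContDiff ℝ 1 (pd i f) := contDiff_pd hf (by norm_num) i
  have h1 : ∀ x, -(∑ l, pd l (pd i (AA p ε u l)) x * pd j ψ x) = pd i f x * pd j ψ x := fun x => by
    by_cases hx : x ∈ tsupport ψ
    · have : (fun y => -(∑ l, pd l (AA p ε u l) y)) =ᶠ[𝓝 x] f := by
        filter_upwards [isOpen_ball.mem_nhds (hs hx)] with y hy using he y hy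
      have h2 := pd_congr (i := i) this
      rw [pd_neg, pd_sum (fun l _ => (hA1 l l).differentiable (by norm_num) x)] at h2
      rw [← h2, ← Finset.sum_mul, neg_mul]
      simp only [fun l => pd_comm (hA l) i l x]
    · have : pd j ψ x = 0 := by
        by_contra h
        exact hx (tsupport_pd_subset ψ j (subset_tsupport _ h))
      simp [this]
  have h2 : ∫ x, pd i f x * pd j ψ x = -∑ l, ∫ x, pd l (pd i (AA p ε u l)) x * pd j ψ x := by
    rw [← integral_finsetSum _ fun l _ => cint (cont_pd (hA1 l i) l) (cont_pd hψ j) (hcs_pd hc j), ← integral_neg]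
    exact integral_congr_ae (Filter.Eventually.of_forall fun x => (h1 x).symm)
  rw [ibp hf1 hψ hc] at h2
  rw [integral_finsetSum _ fun l _ => cint (cont_pd (hA1 l i) j) (cont_pd hψ l) (hcs_pd hc l)]
  simp only [fun l => swap (hA1 l i) hψ hc j l] at h2
  linarith

def DD (u : Euc n → ℝ) (x : Euc n) : ℝ := ∑ a, ∑ b, |pd a (pd b u) x|

lemma DD_nn (u : Euc n → ℝ) (x : Euc n) : 0 ≤ DD u x := Finset.sum_nonneg fun _ _ => Finset.sum_nonneg fun _ _ => abs_nonneg _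
lemma DD_row (u : Euc n → ℝ) (x : Euc n) (a : Fin n) : ∑ b, |pd a (pd b u) x| ≤ DD u x :=
  Finset.single_le_sum (f := fun a => ∑ b, |pd a (pd b u) x|) (fun _ _ => Finset.sum_nonneg fun _ _ => abs_nonneg _) (Finset.mem_univ a)
lemma DD_le (u : Euc n → ℝ) (x : Euc n) (a b : Fin n) : |pd a (pd b u) x| ≤ DD u x :=
  (Finset.single_le_sum (f := fun b => |pd a (pd b u) x|) (fun _ _ => abs_nonneg _) (Finset.mem_univ b)).trans (DD_row u x a)

lemma sg_half {ε : ℝ} (hε : 0 < ε) (u : Euc n → ℝ) (x : Euc n) : 0 < sg ε u x ^ ((1:ℝ)/2) ∧ (sg ε u x ^ ((1:ℝ)/2)) ^ 2 = sg ε u x := by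
  have h0 := sg_pos hε u x
  refine ⟨rpow_pos_of_pos h0 _, ?_⟩
  rw [← rpow_natCast, ← rpow_mul h0.le]; norm_num

lemma pd_sg_le {ε : ℝ} (hε : 0 < ε) {u : Euc n → ℝ} (hu : ContDiff ℝ 2 u) (x : Euc n) (i : Fin n) :
    |pd i (sg ε u) x| ≤ 2 * sg ε u x ^ ((1:ℝ)/2) * DD u x := by
  rw [pd_sg ε hu, abs_mul, abs_two, mul_assoc]
  refine mul_le_mul_of_nonneg_left ((Finset.abs_sum_le_sum_abs _ _).trans ?_) (by norm_num)
  refine le_trans ?_ (mul_le_mul_of_nonneg_left (DD_row u x i) (sg_half hε u x).1.le)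
  rw [Finset.mul_sum]
  refine Finset.sum_le_sum fun m _ => ?_
  rw [abs_mul]
  exact mul_le_mul_of_nonneg_right (abs_pd_le_sg hε u x m) (abs_nonneg _)

lemma AA2 {p ε : ℝ} (hε : 0 < ε) (hp : |p - 2| ≤ 1 / 2) {u : Euc n → ℝ} (hu : ContDiff ℝ 3 u) (i j : Fin n) (x : Euc n) (l : Fin n) :
    ∃ r, |r| ≤ 6 * (DD u x ^ 2 / sg ε u x ^ ((1:ℝ)/2)) ∧
      pd j (pd i (AA p ε u l)) x = sg ε u x ^ ((p - 2) / 2) * (pd l (pd j (pd i u)) x + (p - 2) *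
        (∑ m, pd m u x / sg ε u x ^ ((1:ℝ)/2) * pd m (pd j (pd i u)) x) * (pd l u x / sg ε u x ^ ((1:ℝ)/2)) + r) := by
  have hu2 : ContDiff ℝ 2 u := hu.of_le (by norm_num)
  have h1 : ∀ m, ContDiff ℝ 2 (pd m u) := fun m => contDiff_pd hu (by norm_num) m
  have h2 : ∀ m a, ContDiff ℝ 1 (pd a (pd m u)) := fun m a => contDiff_pd (h1 m) (by norm_num) a
  have d1 : ∀ m y, DifferentiableAt ℝ (pd m u) y := fun m y => (h1 m).differentiable (by norm_num) y
  have d2 : ∀ m a y, DifferentiableAt ℝ (pd a (pd m u)) y := fun m a y => (h2 m a).differentiable (by norm_num) y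
  have hsg : ContDiff ℝ 2 (sg ε u) := contDiff_sg ε hu (by norm_num)
  have ds : ∀ y, DifferentiableAt ℝ (sg ε u) y := fun y => hsg.differentiable (by norm_num) y
  have s0 := sg_pos hε u
  have dsr : ∀ (r : ℝ) y, DifferentiableAt ℝ (fun y => sg ε u y ^ r) y := fun r y => (ds y).rpow_const (Or.inl (s0 y).ne')
  have comm3 : ∀ m, pd j (pd i (pd m u)) x = pd m (pd j (pd i u)) x := fun m => by
    have : pd i (pd m u) = pd m (pd i u) := funext fun y => pd_comm hu2 i m y
    rw [this, pd_comm (h1 i)]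
  have dsi : pd i (sg ε u) = fun y => 2 * ∑ m, pd m u y * pd i (pd m u) y := funext fun y => pd_sg ε hu2 i y
  have hsi : ContDiff ℝ 1 (pd i (sg ε u)) := contDiff_pd hsg (by norm_num) i
  have e2 : pd j (pd i (sg ε u)) x = 2 * (∑ m, pd j (pd m u) x * pd i (pd m u) x) + 2 * ∑ m, pd m u x * pd m (pd j (pd i u)) x := by
    rw [dsi, pd_const_mul _ (DifferentiableAt.fun_sum fun m _ => (d1 m x).fun_mul (d2 m i x)),
      pd_sum (fun m _ => (d1 m x).fun_mul (d2 m i x)), ← mul_add, ← Finset.sum_add_distrib]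
    congr 1
    exact Finset.sum_congr rfl fun m _ => by rw [pd_mul (d1 m x) (d2 m i x), comm3]
  set b := (p - 2) / 2 with hb
  have e1 : pd i (AA p ε u l) = fun y => (b * (sg ε u y ^ (b - 1) * pd i (sg ε u) y)) * pd l u y + sg ε u y ^ b * pd i (pd l u) y := funext fun y => by
    unfold AA
    rw [pd_mul (dsr _ y) (d1 l y), pd_rpow _ (ds y) (s0 y)]; ring
  have dsi' := hsi.differentiable (by norm_num) x
  have e3 : pd j (pd i (AA p ε u l)) x = b * ((b - 1) * sg ε u x ^ (b - 1 - 1) * pd j (sg ε u) x * pd i (sg ε u) x + sg ε u x ^ (b - 1) * pd j (pd i (sg ε u)) x) * pd l u x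
      + b * (sg ε u x ^ (b - 1) * pd i (sg ε u) x) * pd j (pd l u) x + (b * sg ε u x ^ (b - 1) * pd j (sg ε u) x * pd i (pd l u) x + sg ε u x ^ b * pd l (pd j (pd i u)) x) := by
    rw [e1, pd_add ((((dsr _ x).fun_mul dsi').const_mul b).fun_mul (d1 l x)) ((dsr _ x).fun_mul (d2 l i x)),
      pd_mul (((dsr _ x).fun_mul dsi').const_mul b) (d1 l x), pd_const_mul _ ((dsr _ x).fun_mul dsi'), pd_mul (dsr _ x) dsi',
      pd_mul (dsr _ x) (d2 l i x), pd_rpow _ (ds x) (s0 x), pd_rpow _ (ds x) (s0 x), comm3]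
  obtain ⟨σ0, σ2⟩ := sg_half hε u x
  have bi := pd_sg_le hε hu2 x i
  have bj := pd_sg_le hε hu2 x j
  have bl := abs_pd_le_sg hε u x l
  have bli := DD_le u x i l
  have blj := DD_le u x j l
  have hD := DD_nn u x
  rw [rpow_sub_one (s0 x).ne', rpow_sub_one (s0 x).ne', e2] at e3
  set σ := sg ε u x ^ ((1:ℝ)/2) with hσ
  set D := DD u x with hDD
  have bm : |∑ m, pd j (pd m u) x * pd i (pd m u) x| ≤ D ^ 2 := by
    refine (Finset.abs_sum_le_sum_abs _ _).trans ?_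
    have : ∀ m ∈ Finset.univ, |pd j (pd m u) x * pd i (pd m u) x| ≤ |pd j (pd m u) x| * D := fun m _ => by
      rw [abs_mul]; exact mul_le_mul_of_nonneg_left (DD_le u x i m) (abs_nonneg _)
    refine (Finset.sum_le_sum this).trans ?_
    rw [← Finset.sum_mul, sq]
    exact mul_le_mul_of_nonneg_right (DD_row u x j) hD
  have hw : ∑ m, pd m u x / σ * pd m (pd j (pd i u)) x = (∑ m, pd m u x * pd m (pd j (pd i u)) x) / σ := by
    rw [Finset.sum_div]; exact Finset.sum_congr rfl fun m _ => by ring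
  rw [hw]
  set W := ∑ m, pd m u x * pd m (pd j (pd i u)) x
  set Z := ∑ m, pd j (pd m u) x * pd i (pd m u) x
  set B := sg ε u x ^ b
  rw [← σ2] at e3
  clear_value b
  refine ⟨b / σ ^ 2 * (pd i (sg ε u) x * pd j (pd l u) x + pd j (sg ε u) x * pd i (pd l u) x + 2 * Z * pd l u x) +
    b * (b - 1) / σ ^ 4 * (pd i (sg ε u) x * pd j (sg ε u) x * pd l u x), ?_, ?_⟩
  · have hb1 : |b| ≤ 1 / 4 := by rw [hb, abs_div, abs_two]; linarith
    have hb2 : |b - 1| ≤ 5 / 4 := (abs_sub _ _).trans (by rw [abs_one]; linarith)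
    have q1 : |pd i (sg ε u) x * pd j (pd l u) x| ≤ 2 * σ * D * D := by
      rw [abs_mul]; exact mul_le_mul bi blj (abs_nonneg _) (by positivity)
    have q2 : |pd j (sg ε u) x * pd i (pd l u) x| ≤ 2 * σ * D * D := by
      rw [abs_mul]; exact mul_le_mul bj bli (abs_nonneg _) (by positivity)
    have q3 : |2 * Z * pd l u x| ≤ 2 * D ^ 2 * σ := by
      rw [abs_mul, abs_mul, abs_two]; exact mul_le_mul (by linarith) bl (abs_nonneg _) (by positivity)
    have q4 : |pd i (sg ε u) x * pd j (sg ε u) x * pd l u x| ≤ 2 * σ * D * (2 * σ * D) * σ := by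
      rw [abs_mul, abs_mul]
      exact mul_le_mul (mul_le_mul bi bj (abs_nonneg _) (by positivity)) bl (abs_nonneg _) (by positivity)
    refine (abs_add_le _ _).trans ?_
    rw [abs_mul, abs_mul, abs_div, abs_div, abs_mul, abs_of_pos (pow_pos σ0 2), abs_of_pos (pow_pos σ0 4)]
    calc _ ≤ 1 / 4 / σ ^ 2 * (2 * σ * D * D + 2 * σ * D * D + 2 * D ^ 2 * σ) + 1 / 4 * (5 / 4) / σ ^ 4 * (2 * σ * D * (2 * σ * D) * σ) := by
          gcongr
          exact (abs_add_three _ _ _).trans (by linarith)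
      _ = 11 / 4 * (D ^ 2 / σ) := by field_simp; ring
      _ ≤ _ := by gcongr; norm_num
  · rw [e3]
    have : p - 2 = 2 * b := by rw [hb]; ring
    rw [this]
    field_simp
    ring
end k2

section k3
variable {n : ℕ}

lemma pd_test {ε β r : ℝ} (hε : 0 < ε) (hr : 0 ≤ r) {u w φ : Euc n → ℝ} (hu : ContDiff ℝ 2 u) (hw : ContDiff ℝ 1 w) (hφ : ContDiff ℝ 1 φ) (m : ℕ)
    (l : Fin n) (x : Euc n) :
    pd l (fun x => φ x ^ m * sg ε u x ^ β * hh r (w x)) x = sg ε u x ^ β * |w x| ^ r *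
      (m * φ x ^ (m - 1) * pd l φ x * w x + φ x ^ m * β * (pd l (sg ε u) x / sg ε u x * w x) + φ x ^ m * (r + 1) * pd l w x) := by
  have s0 := sg_pos hε u x
  have ds : DifferentiableAt ℝ (sg ε u) x := (contDiff_sg (m := 1) ε hu (by norm_num)).differentiable (by norm_num) x
  have dφ := hφ.differentiable (by norm_num) x
  have dw := hw.differentiable (by norm_num) x
  have dh : DifferentiableAt ℝ (fun x => hh r (w x)) x := (hh_deriv hr (w x)).differentiableAt.comp x dw
  have dsr : DifferentiableAt ℝ (fun x => sg ε u x ^ β) x := ds.rpow_const (Or.inl s0.ne')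
  rw [pd_mul ((dφ.fun_pow m).fun_mul dsr) dh, pd_mul (dφ.fun_pow m) dsr, pd_pow m dφ, pd_rpow _ ds s0,
    pd_comp (hh_deriv hr (w x)) dw, rpow_sub_one s0.ne', hh]
  field_simp

lemma test_contDiff {ε β r : ℝ} (hε : 0 < ε) (hr : 0 ≤ r) {u w φ : Euc n → ℝ} (hu : ContDiff ℝ 2 u) (hw : ContDiff ℝ 1 w) (hφ : ContDiff ℝ 1 φ) (m : ℕ) :
    ContDiff ℝ 1 (fun x => φ x ^ m * sg ε u x ^ β * hh r (w x)) :=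
  ((hφ.pow m).mul (contDiff_sgr hε hu (by norm_num) β)).mul ((hh_contDiff hr).comp hw)

lemma DD_cont {u : Euc n → ℝ} (hu : ContDiff ℝ 2 u) : Continuous (DD u) :=
  continuous_finsetSum _ fun a _ => continuous_finsetSum _ fun b _ => (cont_pd (contDiff_pd hu (by norm_num) b) a).abs

lemma sgr_cont {ε : ℝ} (hε : 0 < ε) {u : Euc n → ℝ} (hu : ContDiff ℝ 1 u) (r : ℝ) : Continuous (fun x => sg ε u x ^ r) :=
  (contDiff_sgr (m := 0) hε hu (by norm_num) r).continuous

lemma cacc {p ε q γ N h ρ : ℝ} (hε : 0 < ε) (hp : |p - 2| ≤ 1 / 2) {u f φ : Euc n → ℝ} {x₀ : Euc n} (hu : ContDiff ℝ 3 u) (hf : ContDiff ℝ 2 f)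
    (he : ∀ x ∈ ball x₀ ρ, -(∑ l, pd l (AA p ε u l) x) = f x) (hφ : ContDiff ℝ 1 φ) (φ0 : ∀ x, 0 ≤ φ x) (hc : HasCompactSupport φ)
    (hs : tsupport φ ⊆ ball x₀ ρ) (hN : ∀ l x, |pd l φ x| ≤ N) (hz : ∀ x ∉ ball x₀ h, φ x = 0) (hq : 1 ≤ q) (i j : Fin n)
    (hβ : |γ - (p - 2) / 2| ≤ 2 * q) :
    ∫ x in ball x₀ h, q / 4 * (sg ε u x ^ γ * |pd j (pd i u) x| ^ (2 * q - 2) * (φ x ^ 2 * ∑ l, pd l (pd j (pd i u)) x ^ 2)) ≤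
    ∫ x in ball x₀ h, (|pd j (pd i f) x| * (φ x ^ 2 * sg ε u x ^ (γ - (p - 2) / 2) * (|pd j (pd i u) x| ^ (2 * q - 2) * |pd j (pd i u) x|)) +
      sg ε u x ^ γ * |pd j (pd i u) x| ^ (2 * q - 2) * (n * (2000 * (q * φ x ^ 2 * (DD u x ^ 2 / sg ε u x ^ ((1:ℝ)/2)) ^ 2) + 60 * (N ^ 2 * pd j (pd i u) x ^ 2)))) := by
  have hu2 : ContDiff ℝ 2 u := hu.of_le (by norm_num)
  have hu1 : ContDiff ℝ 1 u := hu.of_le (by norm_num)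
  have hw : ContDiff ℝ 1 (pd j (pd i u)) := contDiff_pd (contDiff_pd (m := 2) hu (by norm_num) i) (by norm_num) j
  have hr : 0 ≤ 2 * q - 2 := by linarith
  have s0 := sg_pos hε u
  set β := γ - (p - 2) / 2 with hβd
  set w := pd j (pd i u) with hwd
  set ψ := fun x => φ x ^ 2 * sg ε u x ^ β * hh (2 * q - 2) (w x) with hψd
  have hψ : ContDiff ℝ 1 ψ := test_contDiff hε hr hu2 hw hφ 2
  have hsub : tsupport ψ ⊆ tsupport φ := by
    refine closure_mono fun x hx => ?_
    intro h0; apply hx; simp [ψ, h0]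
  have hψc : HasCompactSupport ψ := hc.of_isClosed_subset (isClosed_tsupport _) hsub
  have hwk := weak hε hu hf he hψ hψc (hsub.trans hs) i j
  have hψz : ∀ x ∉ ball x₀ h, ψ x = 0 := fun x hx => by simp [ψ, hz x hx]
  have hdz : ∀ x ∉ ball x₀ h, ∀ l, pd l ψ x = 0 := fun x hx l => by
    rw [hψd, pd_test hε hr hu2 hw hφ, hz x hx]; simp
  rw [← ball_full (x₀ := x₀) (r := h) (fun x hx => by simp [hdz x hx]), ← ball_full (x₀ := x₀) (r := h) (fun x hx => by simp [hψz x hx])] at hwk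
  choose r hrb hre using fun x l => AA2 hε hp hu i j x l
  have cw := hw.continuous
  have cH : Continuous (fun x => |w x| ^ (2 * q - 2)) := (abs_rpow_cont hr).comp cw
  have cs := fun r => sgr_cont hε hu1 r
  have cD := DD_cont hu2
  have cf : Continuous (pd j (pd i f)) := cont_pd (contDiff_pd hf (by norm_num) i) j
  have cwl : ∀ l, Continuous (pd l w) := fun l => cont_pd hw l
  have cB : Continuous fun x => ∑ l, pd j (pd i (AA p ε u l)) x * pd l ψ x :=
    continuous_finsetSum _ fun l _ => (cont_pd (contDiff_pd (AA_contDiff hε hu l) (by norm_num) i) j).mul (cont_pd hψ l)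
  have cE : Continuous fun x => sg ε u x ^ γ * |w x| ^ (2 * q - 2) * (n * (2000 * (q * φ x ^ 2 * (DD u x ^ 2 / sg ε u x ^ ((1:ℝ)/2)) ^ 2) + 60 * (N ^ 2 * w x ^ 2))) := by
    have cφ := hφ.continuous
    refine ((cs γ).mul cH).mul (continuous_const.mul ?_)
    refine Continuous.add (continuous_const.mul (Continuous.mul (by fun_prop) (Continuous.pow (Continuous.div (by fun_prop) (cs _) fun x => (sg_half hε u x).1.ne') 2))) (by fun_prop)
  have cA : Continuous fun x => |pd j (pd i f) x| * (φ x ^ 2 * sg ε u x ^ β * (|w x| ^ (2 * q - 2) * |w x|)) :=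
    cf.abs.mul (((hφ.continuous.pow 2).mul (cs β)).mul (cH.mul cw.abs))
  have cL : Continuous fun x => q / 4 * (sg ε u x ^ γ * |w x| ^ (2 * q - 2) * (φ x ^ 2 * ∑ l, pd l w x ^ 2)) :=
    continuous_const.mul (((cs γ).mul cH).mul ((hφ.continuous.pow 2).mul (continuous_finsetSum _ fun l _ => (cwl l).pow 2)))
  have step1 := ball_mono (x₀ := x₀) (r := h) cL (cB.add cE) (fun x _ => by
    have hP := fun l => hN l x
    obtain ⟨σ0, σ2⟩ := sg_half hε u x
    have hD := DD_nn u x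
    have hδ : 0 ≤ DD u x ^ 2 / sg ε u x ^ ((1:ℝ)/2) := by positivity
    have hv : ∑ l, (pd l u x / sg ε u x ^ ((1:ℝ)/2)) ^ 2 ≤ 1 := by
      simp only [div_pow, σ2]
      rw [← Finset.sum_div, div_le_one (s0 x), sg]; linarith
    have hee : ∀ l, |pd l (sg ε u) x / sg ε u x * w x| ≤ 2 * (DD u x ^ 2 / sg ε u x ^ ((1:ℝ)/2)) := fun l => by
      rw [abs_mul, abs_div, abs_of_pos (s0 x)]
      calc _ ≤ 2 * sg ε u x ^ ((1:ℝ)/2) * DD u x / sg ε u x * DD u x := by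
            have := s0 x
            gcongr
            · exact pd_sg_le hε hu2 x l
            · exact DD_le u x j i
        _ = _ := by
            set σ := sg ε u x ^ ((1:ℝ)/2)
            rw [← σ2]; field_simp
    have key := pt2 (a := fun l => pd l w x) (r := r x) (e := fun l => pd l (sg ε u) x / sg ε u x * w x) (P := fun l => pd l φ x) (w := w x)
      (φ0 x) hq hβ hδ (hrb x) hee hP hp hv (fun l => rfl)
    have hG : 0 ≤ sg ε u x ^ γ * |w x| ^ (2 * q - 2) := mul_nonneg (rpow_nonneg (s0 x).le _) (rpow_nonneg (abs_nonneg _) _)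
    have key2 := mul_le_mul_of_nonneg_left key hG
    have e1 : ∑ l, pd j (pd i (AA p ε u l)) x * pd l ψ x = sg ε u x ^ γ * |w x| ^ (2 * q - 2) * ∑ l, (pd l w x + (p - 2) *
        (∑ m, pd m u x / sg ε u x ^ ((1:ℝ)/2) * pd m w x) * (pd l u x / sg ε u x ^ ((1:ℝ)/2)) + r x l) *
        (2 * φ x * pd l φ x * w x + φ x ^ 2 * β * (pd l (sg ε u) x / sg ε u x * w x) + φ x ^ 2 * (2 * q - 1) * pd l w x) := by
      rw [Finset.mul_sum]
      refine Finset.sum_congr rfl fun l _ => ?_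
      have : sg ε u x ^ γ = sg ε u x ^ ((p - 2) / 2) * sg ε u x ^ β := by
        rw [← rpow_add (s0 x)]; congr 1; rw [hβd]; ring
      rw [hre, hψd, pd_test hε hr hu2 hw hφ, this]
      push_cast
      ring
    simp only [Pi.add_apply, e1]
    linarith)
  simp only [Pi.add_apply] at step1
  rw [integral_add (ball_int cB) (ball_int cE), hwk] at step1
  refine step1.trans ?_
  rw [integral_add (ball_int cA) (ball_int cE)]
  refine add_le_add_left ?_ _
  refine ball_mono (cf.mul hψ.continuous) cA fun x _ => ?_
  refine (le_abs_self _).trans ?_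
  rw [abs_mul]
  refine mul_le_mul_of_nonneg_left (le_of_eq ?_) (abs_nonneg _)
  simp only [ψ, hh]
  rw [abs_mul, abs_mul, abs_mul, abs_of_nonneg (sq_nonneg _), abs_of_nonneg (rpow_nonneg (s0 x).le _), abs_of_nonneg (rpow_nonneg (abs_nonneg (w x)) _)]
end k3

section k4
variable {n : ℕ}

def Lam (u : Euc n → ℝ) (x : Euc n) : ℝ := 1 + ∑ i, |pd i u x| + DD u x

lemma Lam_cont {u : Euc n → ℝ} (hu : ContDiff ℝ 2 u) : Continuous (Lam u) :=
  (continuous_const.add (continuous_finsetSum _ fun i _ => (cont_pd (hu.of_le (by norm_num)) i).abs)).add (DD_cont hu)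

lemma Lam_one (u : Euc n → ℝ) (x : Euc n) : 1 ≤ Lam u x := by
  have := DD_nn u x
  have : 0 ≤ ∑ i, |pd i u x| := Finset.sum_nonneg fun _ _ => abs_nonneg _
  unfold Lam; linarith

lemma DD_Lam (u : Euc n → ℝ) (x : Euc n) : DD u x ≤ Lam u x := by
  have : 0 ≤ ∑ i, |pd i u x| := Finset.sum_nonneg fun _ _ => abs_nonneg _
  unfold Lam; linarith

lemma sg_Lam {ε : ℝ} (hε : ε < 1) (u : Euc n → ℝ) (x : Euc n) : sg ε u x ≤ Lam u x ^ 2 := by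
  have h0 := DD_nn u x
  have h1 : 0 ≤ ∑ i, |pd i u x| := Finset.sum_nonneg fun _ _ => abs_nonneg _
  have h2 : ∑ i, pd i u x ^ 2 ≤ (∑ i, |pd i u x|) ^ 2 := by
    simp only [← sq_abs (pd _ u x)]
    exact Finset.sum_sq_le_sq_sum_of_nonneg fun i _ => abs_nonneg _
  unfold sg Lam
  nlinarith

/-- the right-hand side density -/
def EE (k ε q : ℝ) (u w : Euc n → ℝ) (x : Euc n) : ℝ := sg ε u x ^ (k * q - 1) * |w x| ^ (2 * q - 2 * (1 / k)) * Lam u x ^ (2 * (1 / k) + 2)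

lemma EE_cont {k ε q : ℝ} (hε : 0 < ε) (hq : 1 / k ≤ q) {u w : Euc n → ℝ} (hu : ContDiff ℝ 2 u) (hw : Continuous w) : Continuous (EE k ε q u w) :=
  ((sgr_cont hε (hu.of_le (by norm_num)) _).mul ((abs_rpow_cont (by linarith)).comp hw)).mul
    ((Lam_cont hu).rpow_const fun x => Or.inl (by linarith [Lam_one u x]))

lemma EE_core {s a L D κ S t r : ℝ} (hs : 0 < s) (ha : 0 ≤ a) (haD : a ≤ D) (hDL : D ≤ L) (hL : 1 ≤ L) (hsL : s ≤ L ^ 2)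
    (hS : 0 ≤ t) (ht : 0 ≤ r) (hrt : 0 ≤ 2 * t + r) (h : 2 * t + r ≤ S) (hκ : 0 ≤ κ) (A : ℝ) :
    s ^ (A + t) * a ^ (κ + r) ≤ s ^ A * a ^ κ * L ^ S := by
  have hL0 : 0 < L := by linarith
  rw [rpow_add hs, rpow_add_of_nonneg ha hκ ht]
  have h1 : s ^ t ≤ L ^ (2 * t) := by
    rw [rpow_mul hL0.le]; exact rpow_le_rpow hs.le (by exact_mod_cast hsL) hS
  have h2 : a ^ r ≤ L ^ r := rpow_le_rpow ha (haD.trans hDL) ht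
  have h3 : s ^ t * a ^ r ≤ L ^ S := by
    calc _ ≤ L ^ (2 * t) * L ^ r := by gcongr
      _ = L ^ (2 * t + r) := (rpow_add hL0 _ _).symm
      _ ≤ _ := rpow_le_rpow_of_exponent_le hL h
  calc _ = s ^ A * a ^ κ * (s ^ t * a ^ r) := by ring
    _ ≤ _ := by gcongr

lemma EE_bounds {k ε q p : ℝ} (hk0 : 0 < k) (hk1 : k ≤ 1) (hε : 0 < ε) (hε1 : ε < 1) (hp : |p - 2| ≤ 1 / 2) (hq : 1 / k ≤ q) (u : Euc n → ℝ) (i j : Fin n) (x : Euc n) :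
    sg ε u x ^ (k * q) * |pd j (pd i u) x| ^ (2 * q - 2) * (DD u x ^ 2 / sg ε u x ^ ((1:ℝ)/2)) ^ 2 ≤ EE k ε q u (pd j (pd i u)) x ∧
    sg ε u x ^ (k * q - (p - 2) / 2) * (|pd j (pd i u) x| ^ (2 * q - 2) * |pd j (pd i u) x|) ≤ EE k ε q u (pd j (pd i u)) x ∧
    sg ε u x ^ (k * q) * |pd j (pd i u) x| ^ (2 * q - 2) * pd j (pd i u) x ^ 2 ≤ EE k ε q u (pd j (pd i u)) x := by
  have s0 := sg_pos hε u x
  have hL := Lam_one u x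
  have hS : 1 ≤ 1 / k := by rw [le_div_iff₀ hk0]; linarith
  obtain ⟨hp1, hp2⟩ := abs_le.1 hp
  have hD := DD_nn u x
  have hDL := DD_Lam u x
  have haD := DD_le u x j i
  have hsL := sg_Lam hε1 u x
  unfold EE
  set a := |pd j (pd i u) x|
  have ha : 0 ≤ a := abs_nonneg _
  refine ⟨?_, ?_, ?_⟩
  · have h1 := EE_core s0 ha haD hDL hL hsL (le_refl 0) (r := 2 * (1 / k) - 2) (S := 2 * (1 / k) - 2) (κ := 2 * q - 2 * (1 / k)) (by linarith) (by linarith) (by linarith) (by linarith) (k * q - 1)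
    rw [add_zero, show 2 * q - 2 * (1 / k) + (2 * (1 / k) - 2) = 2 * q - 2 by ring] at h1
    have h2 : (DD u x ^ 2 / sg ε u x ^ ((1:ℝ)/2)) ^ 2 = DD u x ^ 4 / sg ε u x := by
      rw [div_pow, (sg_half hε u x).2]; ring
    have h3 : sg ε u x ^ (k * q) = sg ε u x ^ (k * q - 1) * sg ε u x := by rw [rpow_sub_one s0.ne']; field_simp
    have h4 : Lam u x ^ (2 * (1 / k) + 2) = Lam u x ^ (2 * (1 / k) - 2) * Lam u x ^ 4 := by
      rw [← rpow_natCast, ← rpow_add (by linarith)]; congr 1; push_cast; ring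
    rw [h2, h3, h4]
    calc _ = sg ε u x ^ (k * q - 1) * a ^ (2 * q - 2) * DD u x ^ 4 := by field_simp
      _ ≤ sg ε u x ^ (k * q - 1) * a ^ (2 * q - 2 * (1 / k)) * Lam u x ^ (2 * (1 / k) - 2) * Lam u x ^ 4 := by gcongr
      _ = _ := by ring
  · have h1 := EE_core s0 ha haD hDL hL hsL (t := 1 - (p - 2) / 2) (r := 2 * (1 / k) - 1) (S := 2 * (1 / k) + 2) (κ := 2 * q - 2 * (1 / k)) (by linarith) (by linarith) (by linarith) (by linarith) (by linarith) (k * q - 1)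
    have h2 : a ^ (2 * q - 2) * a = a ^ (2 * q - 2 * (1 / k) + (2 * (1 / k) - 1)) := by
      rw [show 2 * q - 2 * (1 / k) + (2 * (1 / k) - 1) = 2 * q - 2 + 1 by ring, rpow_add_of_nonneg ha (by linarith) (by norm_num), rpow_one]
    rw [h2]
    convert h1 using 3
    ring
  · have h1 := EE_core s0 ha haD hDL hL hsL (t := 1) (r := 2 * (1 / k)) (S := 2 * (1 / k) + 2) (κ := 2 * q - 2 * (1 / k)) (by linarith) (by linarith) (by linarith) (by linarith) (by linarith) (k * q - 1)
    have h2 : a ^ (2 * q - 2) * a ^ 2 = a ^ (2 * q - 2 * (1 / k) + 2 * (1 / k)) := by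
      rw [show 2 * q - 2 * (1 / k) + 2 * (1 / k) = 2 * q - 2 + (2:ℕ) by push_cast; ring, rpow_add_of_nonneg ha (by linarith) (by norm_num), rpow_natCast]
    rw [← sq_abs (pd j (pd i u) x), mul_assoc, h2]
    convert h1 using 3
    ring

lemma cacc2 {p ε q k N F h ρ : ℝ} (hk0 : 0 < k) (hk1 : k ≤ 1) (hε : 0 < ε) (hε1 : ε < 1) (hp : |p - 2| ≤ 1 / 2) {u f φ : Euc n → ℝ} {x₀ : Euc n} (hu : ContDiff ℝ 3 u) (hf : ContDiff ℝ 2 f)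
    (he : ∀ x ∈ ball x₀ ρ, -(∑ l, pd l (AA p ε u l) x) = f x) (hφ : ContDiff ℝ 1 φ) (φ0 : ∀ x, 0 ≤ φ x) (φ1 : ∀ x, φ x ≤ 1) (hc : HasCompactSupport φ)
    (hs : tsupport φ ⊆ ball x₀ ρ) (hN : ∀ l x, |pd l φ x| ≤ N) (hz : ∀ x ∉ ball x₀ h, φ x = 0) (hdz : ∀ l, ∀ x ∉ ball x₀ h, pd l φ x = 0)
    (hq : 1 / k ≤ q) (i j : Fin n) (hF : ∀ x, |pd j (pd i f) x| ≤ F) :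
    ∫ x, ∑ l, pd l (fun x => φ x ^ 1 * sg ε u x ^ (k * q / 2) * hh (q - 1) (pd j (pd i u) x)) x ^ 2 ≤
      q ^ 2 * (12 * F + 25000 * n * (1 + N ^ 2)) * ∫ x in ball x₀ h, EE k ε q u (pd j (pd i u)) x := by
  have hS : 1 ≤ 1 / k := by rw [le_div_iff₀ hk0]; linarith
  have hq1 : 1 ≤ q := by linarith
  have hkq : 1 ≤ k * q := by rw [div_le_iff₀ hk0] at hq; linarith
  have hkq2 : k * q ≤ q := by nlinarith
  have hF0 : 0 ≤ F := (abs_nonneg _).trans (hF x₀)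
  have hu2 : ContDiff ℝ 2 u := hu.of_le (by norm_num)
  have hw : ContDiff ℝ 1 (pd j (pd i u)) := contDiff_pd (contDiff_pd (m := 2) hu (by norm_num) i) (by norm_num) j
  obtain ⟨hp1, hp2⟩ := abs_le.1 hp
  have C1 := cacc (γ := k * q) hε hp hu hf he hφ φ0 hc hs hN hz hq1 i j (abs_le.2 ⟨by linarith, by linarith⟩)
  have bd := EE_bounds hk0 hk1 hε hε1 hp hq u i j
  have cE := EE_cont (k := k) hε hq hu2 hw.continuous
  have s0 := sg_pos hε u
  have hr : 0 ≤ 2 * q - 2 := by linarith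
  set w := pd j (pd i u) with hwd
  have cw := hw.continuous
  have cH : Continuous (fun x => |w x| ^ (2 * q - 2)) := (abs_rpow_cont hr).comp cw
  have cs := fun r => sgr_cont hε (hu2.of_le (by norm_num) : ContDiff ℝ 1 u) r
  have cD := DD_cont hu2
  have cf : Continuous (pd j (pd i f)) := cont_pd (contDiff_pd hf (by norm_num) i) j
  have cφ := hφ.continuous
  have cwl : ∀ l, Continuous (pd l w) := fun l => cont_pd hw l
  have cT : Continuous fun x => sg ε u x ^ (k * q) * |w x| ^ (2 * q - 2) * (φ x ^ 2 * ∑ l, pd l w x ^ 2) :=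
    (((cs _).mul cH).mul ((cφ.pow 2).mul (continuous_finsetSum _ fun l _ => (cwl l).pow 2)))
  have E0 : ∀ x, 0 ≤ EE k ε q u w x := fun x => by
    have := bd x
    exact le_trans (mul_nonneg (mul_nonneg (rpow_nonneg (s0 x).le _) (rpow_nonneg (abs_nonneg _) _)) (sq_nonneg _)) this.2.2
  have φ2 : ∀ x, φ x ^ 2 ≤ 1 := fun x => pow_le_one₀ (φ0 x) (φ1 x)
  have C2 : ∫ x in ball x₀ h, q / 4 * (sg ε u x ^ (k * q) * |w x| ^ (2 * q - 2) * (φ x ^ 2 * ∑ l, pd l w x ^ 2)) ≤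
      ∫ x in ball x₀ h, (F + n * (2000 * q + 60 * N ^ 2)) * EE k ε q u w x := by
    refine C1.trans (ball_mono ?_ (continuous_const.mul cE) fun x _ => ?_)
    · refine (cf.abs.mul (((cφ.pow 2).mul (cs _)).mul (cH.mul cw.abs))).add (((cs _).mul cH).mul (continuous_const.mul ?_))
      exact Continuous.add (continuous_const.mul (Continuous.mul (by fun_prop) (Continuous.pow (Continuous.div (by fun_prop) (cs _) fun x => (sg_half hε u x).1.ne') 2))) (by fun_prop)
    · obtain ⟨b1, b2, b3⟩ := bd x
      have hE := E0 x
      have hG : 0 ≤ sg ε u x ^ (k * q) * |w x| ^ (2 * q - 2) := mul_nonneg (rpow_nonneg (s0 x).le _) (rpow_nonneg (abs_nonneg _) _)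
      have hG2 : 0 ≤ sg ε u x ^ (k * q - (p - 2) / 2) * (|w x| ^ (2 * q - 2) * |w x|) :=
        mul_nonneg (rpow_nonneg (s0 x).le _) (mul_nonneg (rpow_nonneg (abs_nonneg _) _) (abs_nonneg _))
      have i1 : |pd j (pd i f) x| * (φ x ^ 2 * sg ε u x ^ (k * q - (p - 2) / 2) * (|w x| ^ (2 * q - 2) * |w x|)) ≤ F * EE k ε q u w x := by
        refine mul_le_mul (hF x) ?_ (by rw [mul_assoc]; exact mul_nonneg (sq_nonneg _) hG2) hF0
        rw [mul_assoc]
        exact (mul_le_of_le_one_left hG2 (φ2 x)).trans b2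
      have i2 : φ x ^ 2 * (sg ε u x ^ (k * q) * |w x| ^ (2 * q - 2) * (DD u x ^ 2 / sg ε u x ^ ((1:ℝ)/2)) ^ 2) ≤ EE k ε q u w x :=
        (mul_le_of_le_one_left (mul_nonneg hG (sq_nonneg _)) (φ2 x)).trans b1
      have i3 := mul_le_mul_of_nonneg_left i2 (by positivity : 0 ≤ n * (2000 * q))
      have i4 := mul_le_mul_of_nonneg_left b3 (by positivity : 0 ≤ n * (60 * N ^ 2))
      linarith
  rw [integral_const_mul, integral_const_mul] at C2
  have E1 : 0 ≤ ∫ x in ball x₀ h, EE k ε q u w x := integral_nonneg E0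
  set T := ∫ x in ball x₀ h, sg ε u x ^ (k * q) * |w x| ^ (2 * q - 2) * (φ x ^ 2 * ∑ l, pd l w x ^ 2) with hT
  set I := ∫ x in ball x₀ h, EE k ε q u w x with hI
  have C3 : T ≤ (4 * F + n * (8000 + 240 * N ^ 2)) * I := by
    have h1 : (F + n * (2000 * q + 60 * N ^ 2)) * I ≤ q / 4 * ((4 * F + n * (8000 + 240 * N ^ 2)) * I) := by
      have : 0 ≤ (q - 1) * ((F + n * (60 * N ^ 2)) * I) := mul_nonneg (by linarith) (by positivity)
      linarith
    exact le_of_mul_le_mul_left (C2.trans h1) (by positivity)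
  have hr1 : 0 ≤ q - 1 := by linarith
  have hηd : ∀ l x, pd l (fun x => φ x ^ 1 * sg ε u x ^ (k * q / 2) * hh (q - 1) (w x)) x ^ 2 = sg ε u x ^ (k * q) * |w x| ^ (2 * q - 2) *
      (pd l φ x * w x + φ x * (k * q / 2) * (pd l (sg ε u) x / sg ε u x * w x) + φ x * q * pd l w x) ^ 2 := fun l x => by
    have a1 : (sg ε u x ^ (k * q / 2)) ^ 2 = sg ε u x ^ (k * q) := by
      rw [← rpow_natCast, ← rpow_mul (s0 x).le]; congr 1; push_cast; ring
    have a2 : (|w x| ^ (q - 1)) ^ 2 = |w x| ^ (2 * q - 2) := by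
      rw [← rpow_natCast, ← rpow_mul (abs_nonneg _)]; congr 1; push_cast; ring
    rw [pd_test hε hr1 hu2 hw hφ, mul_pow, mul_pow, a1, a2]
    simp
  rw [← ball_full (x₀ := x₀) (r := h) (fun x hx => by simp only [hηd, hz x hx, hdz _ x hx]; simp)]
  have cη : Continuous fun x => ∑ l, pd l (fun x => φ x ^ 1 * sg ε u x ^ (k * q / 2) * hh (q - 1) (w x)) x ^ 2 :=
    continuous_finsetSum _ fun l _ => (cont_pd (test_contDiff hε hr1 hu2 hw hφ 1) l).pow 2
  have cE' : Continuous fun x => 3 * n * (N ^ 2 + q ^ 2) * EE k ε q u w x := continuous_const.mul cE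
  have cT' : Continuous fun x => 3 * q ^ 2 * (sg ε u x ^ (k * q) * |w x| ^ (2 * q - 2) * (φ x ^ 2 * ∑ l, pd l w x ^ 2)) := continuous_const.mul cT
  have C4 := ball_mono (x₀ := x₀) (r := h) cη (cE'.add cT') (fun x _ => by
    simp only [Pi.add_apply, hηd]
    obtain ⟨b1, b2, b3⟩ := bd x
    have hG : 0 ≤ sg ε u x ^ (k * q) * |w x| ^ (2 * q - 2) := mul_nonneg (rpow_nonneg (s0 x).le _) (rpow_nonneg (abs_nonneg _) _)
    have one : ∀ l ∈ Finset.univ, sg ε u x ^ (k * q) * |w x| ^ (2 * q - 2) *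
      (pd l φ x * w x + φ x * (k * q / 2) * (pd l (sg ε u) x / sg ε u x * w x) + φ x * q * pd l w x) ^ 2 ≤
        3 * (N ^ 2 + q ^ 2) * EE k ε q u w x + sg ε u x ^ (k * q) * |w x| ^ (2 * q - 2) * (3 * q ^ 2 * φ x ^ 2) * pd l w x ^ 2 := fun l _ => by
      have hee : |pd l (sg ε u) x / sg ε u x * w x| ≤ 2 * (DD u x ^ 2 / sg ε u x ^ ((1:ℝ)/2)) := by
        rw [abs_mul, abs_div, abs_of_pos (s0 x)]
        obtain ⟨σ0, σ2⟩ := sg_half hε u x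
        have hD := DD_nn u x
        calc _ ≤ 2 * sg ε u x ^ ((1:ℝ)/2) * DD u x / sg ε u x * DD u x := by
              have := s0 x
              gcongr
              · exact pd_sg_le hε hu2 x l
              · exact DD_le u x j i
          _ = _ := by
              set σ := sg ε u x ^ ((1:ℝ)/2)
              rw [← σ2]; field_simp
      set e := pd l (sg ε u) x / sg ε u x * w x
      set δ := DD u x ^ 2 / sg ε u x ^ ((1:ℝ)/2)
      have e2 : e ^ 2 ≤ 4 * δ ^ 2 := by
        have := sq_le_sq' (by linarith [(abs_le.1 hee).1]) (abs_le.1 hee).2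
        linarith
      have p2 : pd l φ x ^ 2 ≤ N ^ 2 := sq_le_sq' (by linarith [(abs_le.1 (hN l x)).1]) (abs_le.1 (hN l x)).2
      have t1 : (pd l φ x * w x) ^ 2 ≤ N ^ 2 * w x ^ 2 := by rw [mul_pow]; exact mul_le_mul_of_nonneg_right p2 (sq_nonneg _)
      have t2 : (φ x * (k * q / 2) * e) ^ 2 ≤ q ^ 2 * δ ^ 2 := by
        rw [mul_pow, mul_pow]
        calc _ ≤ 1 * (q / 2) ^ 2 * (4 * δ ^ 2) := by
              gcongr
              exact φ2 x
          _ = _ := by ring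
      have t3 : (pd l φ x * w x + φ x * (k * q / 2) * e + φ x * q * pd l w x) ^ 2 ≤
          3 * (N ^ 2 * w x ^ 2 + q ^ 2 * δ ^ 2 + q ^ 2 * φ x ^ 2 * pd l w x ^ 2) := by
        have : ∀ a b c : ℝ, (a + b + c) ^ 2 ≤ 3 * (a ^ 2 + b ^ 2 + c ^ 2) := fun a b c => by nlinarith [sq_nonneg (a - b), sq_nonneg (b - c), sq_nonneg (a - c)]
        refine (this _ _ _).trans ?_
        have e3 : (φ x * q * pd l w x) ^ 2 = q ^ 2 * φ x ^ 2 * pd l w x ^ 2 := by ring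
        linarith
      have t4 := mul_le_mul_of_nonneg_left t3 hG
      have t5 := mul_le_mul_of_nonneg_left b1 (by positivity : 0 ≤ 3 * q ^ 2)
      have t6 := mul_le_mul_of_nonneg_left b3 (by positivity : 0 ≤ 3 * N ^ 2)
      linarith
    refine (Finset.sum_le_sum one).trans (le_of_eq ?_)
    rw [Finset.sum_add_distrib, Finset.sum_const, Finset.card_univ, Fintype.card_fin, nsmul_eq_mul, ← Finset.mul_sum]
    ring)
  refine C4.trans ?_
  simp only [Pi.add_apply]
  rw [integral_add (ball_int cE') (ball_int cT'), integral_const_mul, integral_const_mul, ← hT, ← hI]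
  have C5 := mul_le_mul_of_nonneg_left C3 (by positivity : 0 ≤ 3 * q ^ 2)
  have q2 : 1 ≤ q ^ 2 := one_le_pow₀ hq1
  have C6 : 0 ≤ (q ^ 2 - 1) * (3 * n * N ^ 2 * I) := mul_nonneg (by linarith) (by positivity)
  have C7 : 0 ≤ q ^ 2 * n * I := by positivity
  have C8 : 0 ≤ q ^ 2 * n * N ^ 2 * I := by positivity
  linarith
end k4

section k5
variable {n : ℕ}

lemma smT_deriv : ∃ c : ℝ, 0 ≤ c ∧ ∀ t, |deriv Real.smoothTransition t| ≤ c ∧ (t ≤ 0 → deriv Real.smoothTransition t = 0) := by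
  have h0 : ∀ t : ℝ, t ≤ 0 → deriv Real.smoothTransition t = 0 := fun t ht =>
    IsLocalMin.deriv_eq_zero (Filter.Eventually.of_forall fun s => by
      rw [Real.smoothTransition.zero_of_nonpos ht]; exact Real.smoothTransition.nonneg s)
  have h1 : ∀ t : ℝ, 1 ≤ t → deriv Real.smoothTransition t = 0 := fun t ht =>
    IsLocalMax.deriv_eq_zero (Filter.Eventually.of_forall fun s => by
      rw [Real.smoothTransition.one_of_one_le ht]; exact Real.smoothTransition.le_one s)
  have hc : Continuous (deriv Real.smoothTransition) :=
    (Real.smoothTransition.contDiff (n := 1)).continuous_deriv le_rfl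
  obtain ⟨c, hc⟩ := (isCompact_Icc (a := (0:ℝ)) (b := 1)).exists_bound_of_continuousOn hc.continuousOn
  refine ⟨|c|, abs_nonneg _, fun t => ⟨?_, h0 t⟩⟩
  by_cases a : t ≤ 0
  · simp [h0 t a]
  by_cases b : 1 ≤ t
  · simp [h1 t b]
  · push Not at a b
    exact (hc t ⟨a.le, b.le⟩).trans (le_abs_self _)

lemma cutA : ∃ c0 : ℝ, 0 ≤ c0 ∧ ∀ (x₀ : Euc n) (h' h : ℝ), 0 < h' → h' < h → ∃ φ : Euc n → ℝ, ContDiff ℝ 1 φ ∧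
    (∀ x, 0 ≤ φ x) ∧ (∀ x, φ x ≤ 1) ∧ (∀ x ∈ ball x₀ h', φ x = 1) ∧ (∀ x ∉ ball x₀ h, φ x = 0) ∧
    (∀ l, ∀ x ∉ ball x₀ h, pd l φ x = 0) ∧ HasCompactSupport φ ∧ tsupport φ ⊆ closedBall x₀ h ∧
    ∀ l x, |pd l φ x| ≤ c0 / (h - h') := by
  obtain ⟨c, hc, hT⟩ := smT_deriv
  refine ⟨2 * c, by positivity, fun x₀ h' h h0 hh => ?_⟩
  have hd : 0 < h ^ 2 - h' ^ 2 := by nlinarith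
  set a : Euc n → ℝ := fun x => (h ^ 2 - NN x₀ x) * (h ^ 2 - h' ^ 2)⁻¹ with ha
  have hac : ∀ {k : WithTop ℕ∞}, ContDiff ℝ k a := (contDiff_const.sub (NN_contDiff x₀)).mul contDiff_const
  have a0 : ∀ x ∉ ball x₀ h, a x ≤ 0 := fun x hx => by
    rw [mem_ball, not_lt] at hx
    have := NN_eq x₀ x
    apply mul_nonpos_of_nonpos_of_nonneg _ (inv_nonneg.2 hd.le)
    nlinarith
  have a1 : ∀ x ∈ ball x₀ h', 1 ≤ a x := fun x hx => by
    rw [mem_ball] at hx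
    have := NN_eq x₀ x
    have h3 : (0:ℝ) ≤ dist x x₀ := dist_nonneg
    simp only [ha]
    rw [← div_eq_mul_inv, le_div_iff₀ hd]
    nlinarith
  have hpd : ∀ l x, pd l (fun y => Real.smoothTransition (a y)) x = deriv Real.smoothTransition (a x) * (-(2 * (x l - x₀ l)) * (h ^ 2 - h' ^ 2)⁻¹) := by
    intro l x
    rw [pd_comp ((Real.smoothTransition.contDiff (n := 1)).differentiable (by norm_num) _).hasDerivAt
      ((hac (k := 1)).differentiable (by norm_num) x)]
    congr 1
    have h1 : DifferentiableAt ℝ (NN x₀) x := (NN_contDiff (k := 1) x₀).differentiable (by norm_num) x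
    have e : a = fun y => (h ^ 2 - h' ^ 2)⁻¹ * (h ^ 2 - NN x₀ y) := by ext y; simp only [ha]; ring
    rw [e, pd_const_mul _ (f := fun y => h ^ 2 - NN x₀ y) (by fun_prop), pd_sub (by fun_prop) h1, pd_const, pd_NN]
    ring
  have hz : ∀ x ∉ ball x₀ h, Real.smoothTransition (a x) = 0 := fun x hx =>
    Real.smoothTransition.zero_of_nonpos (a0 x hx)
  have hts : tsupport (fun y => Real.smoothTransition (a y)) ⊆ closedBall x₀ h :=
    closure_minimal (fun x hx => ball_subset_closedBall (by by_contra h2; exact hx (hz x h2))) isClosed_closedBall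
  have hpz : ∀ l, ∀ x ∉ ball x₀ h, pd l (fun y => Real.smoothTransition (a y)) x = 0 := fun l x hx => by
    rw [hpd, (hT _).2 (a0 x hx), zero_mul]
  refine ⟨fun x => Real.smoothTransition (a x), Real.smoothTransition.contDiff.comp hac, fun x => Real.smoothTransition.nonneg _,
    fun x => Real.smoothTransition.le_one _, fun x hx => Real.smoothTransition.one_of_one_le (a1 x hx), hz, hpz,
    HasCompactSupport.of_support_subset_isCompact (isCompact_closedBall x₀ h) (subset_closure.trans hts), hts, fun l x => ?_⟩
  have hq : 0 < h - h' := by linarith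
  by_cases hx : x ∈ ball x₀ h
  · rw [hpd, abs_mul, abs_mul, abs_neg, abs_mul, abs_two, abs_of_nonneg (inv_nonneg.2 hd.le)]
    have hl : |x l - x₀ l| ≤ h := by
      rw [mem_ball] at hx
      have := NN_eq x₀ x
      have h3 : (x l - x₀ l) ^ 2 ≤ NN x₀ x :=
        Finset.single_le_sum (f := fun l => (x l - x₀ l) ^ 2) (fun _ _ => sq_nonneg _) (Finset.mem_univ l)
      apply abs_le_of_sq_le_sq (by nlinarith [dist_nonneg (x := x) (y := x₀)]) (by linarith)
    have e : (h ^ 2 - h' ^ 2)⁻¹ = (h + h')⁻¹ * (h - h')⁻¹ := by rw [← mul_inv]; congr 1; ring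
    have h5 : |x l - x₀ l| * (h + h')⁻¹ ≤ 1 := by
      rw [← div_eq_mul_inv, div_le_one (by linarith)]; linarith
    calc |deriv Real.smoothTransition (a x)| * (2 * |x l - x₀ l| * (h ^ 2 - h' ^ 2)⁻¹)
        = |deriv Real.smoothTransition (a x)| * (|x l - x₀ l| * (h + h')⁻¹) * (2 * (h - h')⁻¹) := by rw [e]; ring
      _ ≤ c * 1 * (2 * (h - h')⁻¹) := by
          have : 0 < (h - h')⁻¹ := inv_pos.2 hq
          have : 0 ≤ |x l - x₀ l| * (h + h')⁻¹ := mul_nonneg (abs_nonneg _) (inv_nonneg.2 (by linarith))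
          have := (hT (a x)).1
          gcongr
      _ = _ := by ring
  · rw [hpz l x hx, abs_zero]; positivity

lemma cutB (x₀ : Euc n) {R : ℝ} (hR : 0 < R) : ∃ N φ, Cut x₀ (3 * R / 2) N φ ∧ ∀ x ∈ closedBall x₀ R, φ x = 1 := by
  let b : ContDiffBump x₀ := ⟨R, 5 * R / 4, hR, by linarith⟩
  have hb : Cc (b : Euc n → ℝ) := ⟨b.contDiff, b.hasCompactSupport⟩
  choose C1 h1 h2 using fun i => (hb.pd i).bdd
  choose C2 h3 h4 using fun i j => ((hb.pd j).pd i).bdd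
  refine ⟨∑ i, C1 i + ∑ i, ∑ j, C2 i j, b, ⟨hb, fun x => b.nonneg, fun x => b.le_one, ?_, ?_, ?_, ?_⟩, fun x hx => b.one_of_mem_closedBall hx⟩
  · rw [b.tsupport_eq]
    exact closedBall_subset_ball (show 5 * R / 4 < 3 * R / 2 by linarith)
  · exact add_nonneg (Finset.sum_nonneg fun i _ => h1 i) (Finset.sum_nonneg fun i _ => Finset.sum_nonneg fun j _ => h3 i j)
  · intro i x
    have a := Finset.single_le_sum (f := C1) (fun i _ => h1 i) (Finset.mem_univ i)
    have : 0 ≤ ∑ i, ∑ j, C2 i j := Finset.sum_nonneg fun i _ => Finset.sum_nonneg fun j _ => h3 i j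
    linarith [h2 i x]
  · intro i j x
    have a := Finset.single_le_sum (f := C2 i) (fun j _ => h3 i j) (Finset.mem_univ j)
    have a2 := Finset.single_le_sum (f := fun i => ∑ j, C2 i j) (fun i _ => Finset.sum_nonneg fun j _ => h3 i j) (Finset.mem_univ i)
    have : 0 ≤ ∑ i, C1 i := Finset.sum_nonneg fun i _ => h1 i
    linarith [h4 i j x]

end k5

section k6
variable {n : ℕ}

lemma sobo (hn : 3 ≤ n) : ∃ S : ℝ, 0 ≤ S ∧ ∀ η : Euc n → ℝ, ContDiff ℝ 1 η → HasCompactSupport η →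
    (∫ x, |η x| ^ (2 * (n:ℝ) / ((n:ℝ) - 2))) ^ (1 / (2 * (n:ℝ) / ((n:ℝ) - 2))) ≤ S * (∫ x, ∑ l, pd l η x ^ 2) ^ ((1:ℝ) / 2) := by
  have hn' : (3:ℝ) ≤ n := by exact_mod_cast hn
  set t : ℝ := 2 * (n:ℝ) / ((n:ℝ) - 2) with ht
  have t0 : 0 < t := div_pos (by linarith) (by linarith)
  refine ⟨eLpNormLESNormFDerivOfEqInnerConst (volume : Measure (Euc n)) ((2 : NNReal) : ℝ), NNReal.coe_nonneg _, fun η hη hc => ?_⟩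
  have key := eLpNorm_le_eLpNorm_fderiv_of_eq_inner (volume : Measure (Euc n)) hη hc (p := 2) (p' := t.toNNReal)
    (by norm_num) (by simp; omega) (by
      rw [finrank_euclideanSpace_fin, Real.coe_toNNReal _ t0.le, ht]
      have : (n:ℝ) - 2 ≠ 0 := by linarith
      have : (n:ℝ) ≠ 0 := by linarith
      push_cast
      field_simp)
  have hdc : Continuous (fderiv ℝ η) := hη.continuous_fderiv (by norm_num)
  have m1 : MemLp η (t.toNNReal : ℝ≥0∞) volume := hη.continuous.memLp_of_hasCompactSupport hc
  have m2 : MemLp (fderiv ℝ η) ((2 : NNReal) : ℝ≥0∞) volume := hdc.memLp_of_hasCompactSupport (hc.fderiv ℝ)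
  rw [m1.eLpNorm_eq_integral_rpow_norm (by simpa using t0) (by simp), m2.eLpNorm_eq_integral_rpow_norm (by simp) (by simp)] at key
  rw [← ENNReal.ofReal_coe_nnreal (p := eLpNormLESNormFDerivOfEqInnerConst (volume : Measure (Euc n)) ((2 : NNReal) : ℝ)), ← ENNReal.ofReal_mul (NNReal.coe_nonneg _)] at key
  have h0 : 0 ≤ (∫ x, ‖fderiv ℝ η x‖ ^ ((2 : NNReal) : ℝ≥0∞).toReal) := integral_nonneg fun x => by positivity
  rw [ENNReal.ofReal_le_ofReal_iff (by positivity)] at key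
  simp only [ENNReal.coe_toReal, Real.coe_toNNReal _ t0.le, NNReal.coe_ofNat, Real.norm_eq_abs, Real.rpow_two, norm_fderiv_sq] at key
  simpa only [one_div, NNReal.coe_ofNat] using key

lemma ball_memLp {x₀ : Euc n} {r : ℝ} {F : Euc n → ℝ} (hF : Continuous F) (p : ℝ≥0∞) : MemLp F p (volume.restrict (ball x₀ r)) := by
  obtain ⟨C, hC⟩ := (isCompact_closedBall x₀ r).exists_bound_of_continuousOn hF.continuousOn
  haveI : IsFiniteMeasure (volume.restrict (ball x₀ r)) := ⟨by simpa using measure_ball_lt_top⟩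
  exact MemLp.of_bound hF.aestronglyMeasurable C ((ae_restrict_iff' measurableSet_ball).2
    (Filter.Eventually.of_forall fun x hx => hC x (ball_subset_closedBall hx)))

lemma holdB {x₀ : Euc n} {r ν : ℝ} (hν : 2 < ν) {G H : Euc n → ℝ} (hG : Continuous G) (hH : Continuous H) (G0 : ∀ x, 0 ≤ G x) (H0 : ∀ x, 0 ≤ H x) :
    ∫ x in ball x₀ r, G x * H x ≤ (∫ x in ball x₀ r, G x ^ (ν / 2)) ^ (2 / ν) * (∫ x in ball x₀ r, H x ^ (ν / (ν - 2))) ^ ((ν - 2) / ν) := by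
  have hh : (ν / 2).HolderConjugate (ν / (ν - 2)) := by
    rw [Real.holderConjugate_iff]
    have : ν - 2 ≠ 0 := by linarith
    have : ν ≠ 0 := by linarith
    refine ⟨by linarith, ?_⟩
    field_simp
    ring
  have := integral_mul_le_Lp_mul_Lq_of_nonneg (μ := volume.restrict (ball x₀ r)) hh (f := G) (g := H)
    (Filter.Eventually.of_forall G0) (Filter.Eventually.of_forall H0) (ball_memLp hG _) (ball_memLp hH _)
  simpa only [one_div_div] using this

lemma Lam_pow {m : ℕ} (hm : Even m) (hm0 : m ≠ 0) (u : Euc n → ℝ) (x : Euc n) :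
    Lam u x ^ m ≤ 3 ^ m * (1 + (n:ℝ) ^ m * (∑ i, (pd i u x) ^ m) + (n:ℝ) ^ m * ((n:ℝ) ^ m * ∑ i, ∑ j, (pd i (pd j u) x) ^ m)) := by
  have a1 := sum_pow_le hm hm0 (fun i => |pd i u x|)
  have a2 := sum_pow_le hm hm0 (fun i => ∑ j, |pd i (pd j u) x|)
  have a3 : ∑ i, (∑ j, |pd i (pd j u) x|) ^ m ≤ (n:ℝ) ^ m * ∑ i, ∑ j, (pd i (pd j u) x) ^ m := by
    rw [Finset.mul_sum]
    refine Finset.sum_le_sum fun i _ => ?_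
    have := sum_pow_le hm hm0 (fun j => |pd i (pd j u) x|)
    simpa only [Fintype.card_fin, hm.pow_abs] using this
  simp only [Fintype.card_fin, hm.pow_abs] at a1 a2
  have a4 := add_pow_le3 hm hm0 1 (∑ i, |pd i u x|) (DD u x)
  rw [one_pow] at a4
  have a5 : (n:ℝ) ^ m * ∑ i, (∑ j, |pd i (pd j u) x|) ^ m ≤ (n:ℝ) ^ m * ((n:ℝ) ^ m * ∑ i, ∑ j, (pd i (pd j u) x) ^ m) := by gcongr
  refine a4.trans ?_
  unfold DD
  gcongr
  exact a2.trans a5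

lemma Lam_int {m : ℕ} (hm : Even m) (hm0 : m ≠ 0) {x₀ : Euc n} {R N : ℝ} (hR : 0 < R) {φ : Euc n → ℝ} (hφ : Cut x₀ (3 * R / 2) N φ)
    (h1 : ∀ x ∈ closedBall x₀ R, φ x = 1) {A : ℝ} : ∃ B, 0 ≤ B ∧ ∀ u : Euc n → ℝ, ContDiff ℝ 2 u →
      (∫ x in ball x₀ (3 * R / 2), XX m φ u x) + (∫ x in ball x₀ (3 * R / 2), YY m φ u x) ≤ A → ∫ x in ball x₀ R, Lam u x ^ m ≤ B := by
  set c : ℝ := 3 ^ m * (1 + (n:ℝ) ^ m + (n:ℝ) ^ m * (n:ℝ) ^ m) with hc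
  refine ⟨|c * ((∫ x in ball x₀ (3 * R / 2), 1) + A)|, abs_nonneg _, fun u hu h => le_trans ?_ (le_abs_self _)⟩
  have hX := XX_cont m hφ.cc.cont hu
  have hY := YY_cont m hφ.cc.cont hu
  have c0 : 0 ≤ c := by positivity
  calc ∫ x in ball x₀ R, Lam u x ^ m ≤ ∫ x in ball x₀ R, c * (1 + (XX m φ u x + YY m φ u x)) := by
        refine ball_mono ((Lam_cont hu).pow m) (continuous_const.mul (continuous_const.add (hX.add hY))) fun x hx => ?_
        have hx1 := h1 x (ball_subset_closedBall hx)
        refine (Lam_pow hm hm0 u x).trans ?_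
        have e1 : XX m φ u x = ∑ i, (pd i u x) ^ m := by simp [XX, hx1]
        have e2 : YY m φ u x = ∑ i, ∑ j, (pd i (pd j u) x) ^ m := by simp [YY, hx1]
        rw [← e1, ← e2, hc, mul_assoc]
        have := XX_nn hm φ u x
        have := YY_nn hm φ u x
        gcongr
        have hN : 0 ≤ (n:ℝ) ^ m := by positivity
        nlinarith [mul_nonneg hN hN, mul_nonneg (mul_nonneg hN hN) (XX_nn hm φ u x), mul_nonneg hN (YY_nn hm φ u x)]
    _ ≤ ∫ x in ball x₀ (3 * R / 2), c * (1 + (XX m φ u x + YY m φ u x)) := by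
        refine setIntegral_mono_set (ball_int (continuous_const.mul (continuous_const.add (hX.add hY))))
          (Filter.Eventually.of_forall fun x => ?_) (Filter.Eventually.of_forall (ball_subset_ball (by linarith)))
        have := XX_nn hm φ u x
        have := YY_nn hm φ u x
        simp only [Pi.zero_apply]; positivity
    _ = c * ((∫ x in ball x₀ (3 * R / 2), 1) + ((∫ x in ball x₀ (3 * R / 2), XX m φ u x) + (∫ x in ball x₀ (3 * R / 2), YY m φ u x))) := by
        rw [integral_const_mul, integral_add (g := fun x => XX m φ u x + YY m φ u x) (ball_int continuous_const) (ball_int (hX.add hY)), integral_add (ball_int hX) (ball_int hY)]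
    _ ≤ _ := by gcongr

end k6

section k7
variable {n : ℕ}

lemma core_hold {k ν q ε R h A : ℝ} {m : ℕ} (hk0 : 0 < k) (hν : 2 < ν) (hq : 1 / k ≤ q) (hε : 0 < ε) (hm : (2 * (1 / k) + 2) * (ν / (ν - 2)) ≤ m)
    {x₀ : Euc n} (hh : h ≤ R) {u w : Euc n → ℝ} (hu : ContDiff ℝ 2 u) (hw : Continuous w) (hA : ∫ x in ball x₀ R, Lam u x ^ m ≤ A) :
    ∫ x in ball x₀ h, EE k ε q u w x ≤
      (∫ x in ball x₀ h, (sg ε u x ^ (k / 2) * |w x|) ^ (ν * (q - 1 / k))) ^ (2 / ν) * A ^ ((ν - 2) / ν) := by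
  have hs := sg_pos hε u
  have g0 : ∀ x, 0 ≤ sg ε u x ^ (k / 2) * |w x| := fun x => mul_nonneg (rpow_nonneg (hs x).le _) (abs_nonneg _)
  have L0 : ∀ x, 0 ≤ Lam u x := fun x => zero_le_one.trans (Lam_one u x)
  have gc : Continuous fun x => sg ε u x ^ (k / 2) * |w x| := (sgr_cont hε (hu.of_le (by norm_num)) _).mul hw.abs
  have hqk : 0 ≤ q - 1 / k := by linarith
  have k1 : k * (1 / k) = 1 := by field_simp
  have e : ∀ x, EE k ε q u w x = (sg ε u x ^ (k / 2) * |w x|) ^ (2 * (q - 1 / k)) * Lam u x ^ (2 * (1 / k) + 2) := by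
    intro x
    unfold EE
    rw [Real.mul_rpow (rpow_nonneg (hs x).le _) (abs_nonneg _), ← rpow_mul (hs x).le]
    congr 3
    · linear_combination k1
    · ring
  have k2 : 0 < 2 * (1 / k) + 2 := by positivity
  simp only [e]
  refine (holdB hν (gc.rpow_const fun x => Or.inr (by linarith)) ((Lam_cont hu).rpow_const fun x => Or.inr k2.le)
    (fun x => rpow_nonneg (g0 x) _) (fun x => rpow_nonneg (L0 x) _)).trans ?_
  have e2 : ∀ x, ((sg ε u x ^ (k / 2) * |w x|) ^ (2 * (q - 1 / k))) ^ (ν / 2) = (sg ε u x ^ (k / 2) * |w x|) ^ (ν * (q - 1 / k)) := by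
    intro x
    rw [← rpow_mul (g0 x)]
    congr 1
    ring
  simp only [e2]
  have hLm : Continuous fun x => Lam u x ^ m := (Lam_cont hu).pow m
  have hLr : Continuous fun x => (Lam u x ^ (2 * (1 / k) + 2)) ^ (ν / (ν - 2)) :=
    ((Lam_cont hu).rpow_const fun x => Or.inr k2.le).rpow_const fun x => Or.inr (div_nonneg (by linarith) (by linarith))
  have h3 : ∫ x in ball x₀ h, (Lam u x ^ (2 * (1 / k) + 2)) ^ (ν / (ν - 2)) ≤ A := by
    refine le_trans (ball_mono hLr hLm fun x _ => ?_) (le_trans ?_ hA)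
    · rw [← rpow_mul (L0 x), ← rpow_natCast]
      exact rpow_le_rpow_of_exponent_le (Lam_one u x) hm
    · exact setIntegral_mono_set (ball_int hLm) (Filter.Eventually.of_forall fun x => pow_nonneg (L0 x) m)
        (Filter.Eventually.of_forall (ball_subset_ball hh))
  refine mul_le_mul_of_nonneg_left (rpow_le_rpow (setIntegral_nonneg measurableSet_ball fun x _ => rpow_nonneg (rpow_nonneg (L0 x) _) _) h3
    (div_nonneg (by linarith) (by linarith))) (rpow_nonneg (setIntegral_nonneg measurableSet_ball fun x _ => rpow_nonneg (g0 x) _) _)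

lemma core (hn : 3 ≤ n) {k ν R F A : ℝ} {m : ℕ} (hk0 : 0 < k) (hk1 : k ≤ 1) (hν : 2 < ν) (hR : 0 < R) (hF0 : 0 ≤ F) (hA0 : 0 ≤ A)
    (hm : (2 * (1 / k) + 2) * (ν / (ν - 2)) ≤ m) : ∃ C : ℝ, 0 < C ∧ ∀ (x₀ : Euc n) (p ε q h' h : ℝ) (f u : Euc n → ℝ) (i j : Fin n),
    0 < ε → ε < 1 → |p - 2| ≤ 1 / 2 → ContDiff ℝ 3 u → ContDiff ℝ 2 f → (∀ x ∈ ball x₀ (3 * R / 2), -(∑ l, pd l (AA p ε u l) x) = f x) →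
    (∀ x, |pd j (pd i f) x| ≤ F) → ∫ x in ball x₀ R, Lam u x ^ m ≤ A → 1 / k ≤ q → 0 < h' → h' < h → h < R →
    (∫ x in ball x₀ h', (sg ε u x ^ (k / 2) * |pd j (pd i u) x|) ^ (2 * (n:ℝ) / ((n:ℝ) - 2) * q)) ^ (1 / (2 * (n:ℝ) / ((n:ℝ) - 2))) ≤
      C * (q / (h - h')) * (∫ x in ball x₀ h, (sg ε u x ^ (k / 2) * |pd j (pd i u) x|) ^ (ν * (q - 1 / k))) ^ (1 / ν) := by
  obtain ⟨S, S0, hS⟩ := sobo (n := n) hn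
  obtain ⟨c0, hc0, hcut⟩ := cutA (n := n)
  have hn' : (3:ℝ) ≤ n := by exact_mod_cast hn
  set t : ℝ := 2 * (n:ℝ) / ((n:ℝ) - 2) with ht
  have t0 : 0 < t := div_pos (by linarith) (by linarith)
  set D : ℝ := R ^ 2 * (12 * F + 25000 * n) + 25000 * n * c0 ^ 2 with hD
  have D0 : 0 ≤ D := by positivity
  set E : ℝ := S * (D * A ^ ((ν - 2) / ν)) ^ ((1:ℝ) / 2) with hE
  have A1 : 0 ≤ A ^ ((ν - 2) / ν) := rpow_nonneg hA0 _
  have E0 : 0 ≤ E := by positivity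
  refine ⟨E + 1, by linarith, fun x₀ p ε q h' h f u i j hε hε1 hp hu hf he hF hA hq hh0 hhh hhR => ?_⟩
  obtain ⟨φ, φc, φ0, φ1, φo, φz, φpz, φcs, φs, φN⟩ := hcut x₀ h' h hh0 hhh
  have hs := sg_pos hε u
  have hu2 : ContDiff ℝ 2 u := hu.of_le (by norm_num)
  have hwc : ContDiff ℝ 1 (pd j (pd i u)) := contDiff_pd (contDiff_pd (k := 3) (m := 2) hu (by norm_num) i) (by norm_num) j
  set w := pd j (pd i u) with hw
  have g0 : ∀ x, 0 ≤ sg ε u x ^ (k / 2) * |w x| := fun x => mul_nonneg (rpow_nonneg (hs x).le _) (abs_nonneg _)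
  have q1 : 1 ≤ q := le_trans (by rw [le_div_iff₀ hk0]; linarith) hq
  have hd : 0 < h - h' := by linarith
  set η : Euc n → ℝ := fun x => φ x ^ 1 * sg ε u x ^ (k * q / 2) * hh (q - 1) (w x) with hη
  have ηc : ContDiff ℝ 1 η := test_contDiff hε (by linarith) hu2 hwc φc 1
  have ηz : ∀ x, φ x = 0 → η x = 0 := fun x hx => by simp [hη, hx]
  have ηs : HasCompactSupport η := φcs.mono fun x hx h2 => hx (ηz x h2)
  have b1 := hS η ηc ηs
  have b2 := cacc2 hk0 hk1 hε hε1 hp hu hf he φc φ0 φ1 φcs (φs.trans (closedBall_subset_ball (by linarith))) φN φz φpz hq i j hF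
  have b3 := core_hold hk0 hν hq hε hm hhR.le hu2 hwc.continuous hA
  set I : ℝ := ∫ x in ball x₀ h, (sg ε u x ^ (k / 2) * |w x|) ^ (ν * (q - 1 / k)) with hI
  have I0 : 0 ≤ I := setIntegral_nonneg measurableSet_ball fun x _ => rpow_nonneg (g0 x) _
  have b4 : (∫ x in ball x₀ h', (sg ε u x ^ (k / 2) * |w x|) ^ (t * q)) ≤ ∫ x, |η x| ^ t := by
    have e1 : ∀ x ∈ ball x₀ h', (sg ε u x ^ (k / 2) * |w x|) ^ (t * q) = |η x| ^ t := by
      intro x hx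
      have e3 : |η x| = (sg ε u x ^ (k / 2) * |w x|) ^ q := by
        have e4 : |w x| ^ (q - 1) * |w x| = |w x| ^ q := by
          rw [← rpow_add_one' (abs_nonneg _) (by linarith)]; congr 1; ring
        simp only [hη, φo x hx, hh, abs_mul, one_pow, one_mul, abs_one]
        rw [abs_of_nonneg (rpow_nonneg (abs_nonneg (w x)) _), e4, abs_of_nonneg (rpow_nonneg (hs x).le _),
          Real.mul_rpow (rpow_nonneg (hs x).le _) (abs_nonneg _), ← rpow_mul (hs x).le]
        congr 2; ring
      rw [e3, ← rpow_mul (g0 x), mul_comm t q]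
    rw [setIntegral_congr_fun measurableSet_ball e1]
    refine setIntegral_le_integral (Continuous.integrable_of_hasCompactSupport (ηc.continuous.abs.rpow_const fun x => Or.inr t0.le)
      (ηs.mono fun x hx h2 => hx (by simp [h2, t0.ne']))) (Filter.Eventually.of_forall fun x => rpow_nonneg (abs_nonneg _) _)
  have b5 : 12 * F + 25000 * n * (1 + (c0 / (h - h')) ^ 2) ≤ D * (1 / (h - h')) ^ 2 := by
    have : 1 ≤ R ^ 2 * (1 / (h - h')) ^ 2 := by
      rw [← mul_pow, mul_one_div]
      exact one_le_pow₀ (by rw [le_div_iff₀ hd]; linarith)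
    have h2 : 0 ≤ 12 * F + 25000 * n := by positivity
    calc _ = (12 * F + 25000 * n) * 1 + 25000 * n * c0 ^ 2 * (1 / (h - h')) ^ 2 := by ring
      _ ≤ (12 * F + 25000 * n) * (R ^ 2 * (1 / (h - h')) ^ 2) + 25000 * n * c0 ^ 2 * (1 / (h - h')) ^ 2 := by gcongr
      _ = _ := by rw [hD]; ring
  have P0 : 0 ≤ q / (h - h') := by positivity
  have b6 : ∫ x, ∑ l, pd l η x ^ 2 ≤ (q / (h - h')) ^ 2 * (D * A ^ ((ν - 2) / ν)) * I ^ (2 / ν) := by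
    refine b2.trans ?_
    calc q ^ 2 * (12 * F + 25000 * n * (1 + (c0 / (h - h')) ^ 2)) * ∫ x in ball x₀ h, EE k ε q u w x
        ≤ q ^ 2 * (D * (1 / (h - h')) ^ 2) * (I ^ (2 / ν) * A ^ ((ν - 2) / ν)) := by
          have : 0 ≤ I ^ (2 / ν) := rpow_nonneg I0 _
          exact mul_le_mul (mul_le_mul_of_nonneg_left b5 (by positivity)) b3
            (setIntegral_nonneg measurableSet_ball fun x _ => mul_nonneg (mul_nonneg (rpow_nonneg (hs x).le _) (rpow_nonneg (abs_nonneg _) _))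
              (rpow_nonneg (zero_le_one.trans (Lam_one u x)) _)) (by positivity)
      _ = _ := by ring
  calc (∫ x in ball x₀ h', (sg ε u x ^ (k / 2) * |w x|) ^ (t * q)) ^ (1 / t) ≤ (∫ x, |η x| ^ t) ^ (1 / t) :=
        rpow_le_rpow (setIntegral_nonneg measurableSet_ball fun x _ => rpow_nonneg (g0 x) _) b4 (by positivity)
    _ ≤ S * (∫ x, ∑ l, pd l η x ^ 2) ^ ((1:ℝ) / 2) := b1
    _ ≤ S * ((q / (h - h')) ^ 2 * (D * A ^ ((ν - 2) / ν)) * I ^ (2 / ν)) ^ ((1:ℝ) / 2) := by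
        refine mul_le_mul_of_nonneg_left (rpow_le_rpow (integral_nonneg fun x => Finset.sum_nonneg fun l _ => sq_nonneg _) b6 (by norm_num)) S0
    _ = E * (q / (h - h')) * I ^ (1 / ν) := by
        rw [Real.mul_rpow (by positivity) (rpow_nonneg I0 _), Real.mul_rpow (by positivity) (by positivity), ← rpow_mul I0,
          ← Real.sqrt_eq_rpow ((q / (h - h')) ^ 2), Real.sqrt_sq P0, hE, show 2 / ν * (1 / 2) = 1 / ν by ring]
        ring
    _ ≤ (E + 1) * (q / (h - h')) * I ^ (1 / ν) := by
        have : 0 ≤ I ^ (1 / ν) := rpow_nonneg I0 _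
        gcongr
        linarith

end k7

section k8
variable {n : ℕ}

lemma gfun_eq {k ε : ℝ} {i j : Fin n} {u v : Euc n → ℝ} {x : Euc n} (h : v =ᶠ[𝓝 x] u) :
    gfun k ε i j u x = sg ε v x ^ (k / 2) * |pd j (pd i v) x| := by
  have e1 : pd2 i j u x = pd j (pd i v) x := (pd_congr (pd_eventuallyEq h)).symm
  have e2 : ε + ‖gradient u x‖ ^ 2 = sg ε v x := by
    rw [normsq_gradient, sg]
    simp only [pd_congr h]
  rw [gfun, e1, e2]

lemma stmt3_aux (n : ℕ) (hn : 3 ≤ n) (k l : ℝ) (hk0 : 0 < k) (hk1 : k ≤ 1)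
    (hl : (n : ℝ) / 2 < l) (i j : Fin n) :
    ∃ c : ℝ, 0 < c ∧
      ∀ (Ω : Set (Euc n)) (x₀ : Euc n) (R p : ℝ) (f u : Euc n → ℝ),
        0 < R → closedBall x₀ (2 * R) ⊆ Ω → |p - 2| < c →
        ContDiffOn ℝ 2 f Ω →
        ContDiffOn ℝ 1 u (closedBall x₀ (2 * R)) →
        ∀ ν : ℝ, 2 * l / (l - 1) < ν →
          ∃ C : ℝ, 0 < C ∧
            ∀ ε : ℝ, ε ∈ Set.Ioo (0 : ℝ) 1 →
              ∀ uε : Euc n → ℝ,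
                ContDiffOn ℝ 3 uε (ball x₀ (2 * R)) →
                ContinuousOn uε (closedBall x₀ (2 * R)) →
                SolvesReg p ε f uε (ball x₀ (2 * R)) →
                (∀ x ∈ sphere x₀ (2 * R), uε x = u x) →
                ∀ q : ℝ, 1 / k ≤ q →
                  ∀ h' h : ℝ, 0 < h' → h' < h → h < R →
                    lpOn (gfun k ε i j uε) (2 * (n : ℝ) / ((n : ℝ) - 2) * q) (ball x₀ h') ^ q ≤
                      C * (q / (h - h')) *
                        lpOn (gfun k ε i j uε) (ν * (q - 1 / k)) (ball x₀ h) ^ (q - 1 / k) := by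
  have hn' : (3:ℝ) ≤ n := by exact_mod_cast hn
  have hl1 : 1 < l := by linarith
  obtain ⟨M0, hM0⟩ := exists_nat_ge ((2 * (1 / k) + 2) * l)
  set M : ℕ := 2 * (M0 + 1) with hMd
  have hMe : Even M := even_two_mul _
  have hm2 : Even (M + 2) := hMe.add even_two
  obtain ⟨c, c0, hc⟩ := estW (n := n) (by omega) M (by omega) hMe
  refine ⟨min c (1 / (2 * n)), lt_min c0 (by positivity), fun Ω x₀ R p f u hR hΩ hp hf hu ν hν => ?_⟩
  have hpc : |p - 2| < c := hp.trans_le (min_le_left _ _)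
  have hpn : |p - 2| * n ≤ 1 / 2 := by
    have := (hp.trans_le (min_le_right _ _)).le
    rw [le_div_iff₀ (by positivity)] at this
    linarith
  have hp2 : |p - 2| ≤ 1 / 2 := by nlinarith [abs_nonneg (p - 2)]
  have hν2 : 2 < ν := lt_trans (by rw [lt_div_iff₀ (by linarith)]; linarith) hν
  have hνl : ν / (ν - 2) ≤ l := by
    rw [div_lt_iff₀ (by linarith)] at hν
    rw [div_le_iff₀ (by linarith)]
    linarith
  have hm : (2 * (1 / k) + 2) * (ν / (ν - 2)) ≤ ((M + 2 : ℕ) : ℝ) := by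
    have h1 : (2 * (1 / k) + 2) * (ν / (ν - 2)) ≤ (2 * (1 / k) + 2) * l := by gcongr
    have h2 : (M0:ℝ) ≤ ((M + 2 : ℕ) : ℝ) := by exact_mod_cast (by omega)
    linarith
  obtain ⟨N, φ, hφ, φ1⟩ := cutB x₀ hR
  obtain ⟨F, hF⟩ := (isCompact_closedBall x₀ (2 * R)).exists_bound_of_continuousOn (hf.continuousOn.mono hΩ)
  obtain ⟨U, hU⟩ := (isCompact_closedBall x₀ (2 * R)).exists_bound_of_continuousOn hu.continuousOn
  obtain ⟨K, hK⟩ := sup_bound (n := n) (by omega) (x₀ := x₀) (F := F) (M0 := U) hR hp2 hpn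
  obtain ⟨fv, fc, fs, fe, -, -⟩ := glob (r := 2 * R) (ρ := 3 * R / 2) (k := 2) (show ((2 : ℕ∞) : WithTop ℕ∞) ≤ _ from WithTop.coe_le_coe.2 le_top) (by linarith) (by linarith)
    (hf.mono (ball_subset_closedBall.trans hΩ))
  have fc1 : ∀ a, ContDiff ℝ 1 (pd a fv) := fun a => contDiff_pd fc (by norm_num) a
  obtain ⟨F0, F00, hF0⟩ := hcs_bdd fc.continuous fs
  choose F1 F10 hF1 using fun a => hcs_bdd (fc1 a).continuous (hcs_pd fs a)
  obtain ⟨F2, F20, hF2⟩ := hcs_bdd (cont_pd (fc1 i) j) (hcs_pd (hcs_pd fs i) j)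
  have F1s : 0 ≤ ∑ a, F1 a := Finset.sum_nonneg fun a _ => F10 a
  obtain ⟨A0, hA0⟩ := hc p hpc x₀ (3 * R / 2) N φ hφ (F0 + ∑ a, F1 a) |K| (by linarith) (abs_nonneg _)
  obtain ⟨A, A00, hA⟩ := Lam_int (A := A0) hm2 (by omega) hR hφ φ1
  obtain ⟨C, C0, hC⟩ := core (n := n) hn hk0 hk1 hν2 hR F20 A00 hm
  set V : ℝ := (∫ x in ball x₀ R, (1:ℝ)) ^ (1 / ν) with hV
  have V00 : 0 ≤ ∫ x in ball x₀ R, (1:ℝ) := setIntegral_nonneg measurableSet_ball fun _ _ => zero_le_one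
  have V0 : 0 ≤ V := rpow_nonneg V00 _
  refine ⟨C * (1 + V), by positivity, fun ε hε w hw hwc hws hwb q hq h' h hh0 hhh hhR => ?_⟩
  obtain ⟨v, vc, -, ve, vl, vz⟩ := glob (r := 2 * R) (ρ := 3 * R / 2) (k := 3) (show ((3 : ℕ∞) : WithTop ℕ∞) ≤ _ from WithTop.coe_le_coe.2 le_top) (by linarith) (by linarith) hw
  have hvw : ∀ x ∈ ball x₀ (3 * R / 2), v =ᶠ[𝓝 x] w := fun x hx => by
    filter_upwards [isOpen_ball.mem_nhds hx] with y hy using ve y (ball_subset_closedBall hy)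
  have vK : ∀ x, |v x| ≤ |K| := by
    intro x
    by_cases hx : x ∈ ball x₀ (2 * R)
    · exact (vl x).trans ((hK ε hε.1 hε.2 f w (hw.of_le (by norm_num)) hwc hws (fun y hy => hF y (ball_subset_closedBall hy))
        (fun y hy => by rw [hwb y hy]; exact hU y (sphere_subset_closedBall hy)) x (ball_subset_closedBall hx)).trans (le_abs_self _))
    · rw [vz x hx, abs_zero]; exact abs_nonneg _
  have vs : ∀ x ∈ ball x₀ (3 * R / 2), -(∑ l, pd l (AA p ε v l) x) = fv x := fun x hx => by
    rw [solves_AA (hvw x hx) (hws x (ball_subset_ball (by linarith) hx)), fe x (ball_subset_closedBall hx)]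
  have v2 : ContDiff ℝ 2 v := vc.of_le (by norm_num)
  have hLA := hA v v2 (hA0 ε hε.1 hε.2 fv v (fc.of_le (by norm_num)) (fun x => (hF0 x).trans (by linarith))
    (fun a x => (hF1 a x).trans (by
      have := Finset.single_le_sum (f := F1) (fun a _ => F10 a) (Finset.mem_univ a)
      linarith)) v2 vK vs)
  have key := hC x₀ p ε q h' h fv v i j hε.1 hε.2 hp2 vc fc vs hF2 hLA hq hh0 hhh hhR
  have q1 : 0 < q := lt_of_lt_of_le (by positivity) hq
  set t : ℝ := 2 * (n:ℝ) / ((n:ℝ) - 2) with ht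
  have t0 : 0 < t := div_pos (by linarith) (by linarith)
  have ge : ∀ r ≤ R, ∀ e : ℝ, ∫ x in ball x₀ r, gfun k ε i j w x ^ e = ∫ x in ball x₀ r, (sg ε v x ^ (k / 2) * |pd j (pd i v) x|) ^ e := by
    intro r hr e
    refine setIntegral_congr_fun measurableSet_ball fun x hx => ?_
    simp only [gfun_eq (hvw x (ball_subset_ball (by linarith) hx))]
  have gn : ∀ x, 0 ≤ sg ε v x ^ (k / 2) * |pd j (pd i v) x| := fun x => mul_nonneg (rpow_nonneg (sg_pos hε.1 v x).le _) (abs_nonneg _)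
  have In : ∀ r e : ℝ, 0 ≤ ∫ x in ball x₀ r, (sg ε v x ^ (k / 2) * |pd j (pd i v) x|) ^ e := fun r e =>
    setIntegral_nonneg measurableSet_ball fun x _ => rpow_nonneg (gn x) _
  unfold lpOn
  rw [ge h' (by linarith), ge h hhR.le, ← rpow_mul (In _ _), show 1 / (t * q) * q = 1 / t by field_simp]
  refine key.trans ?_
  have P0 : 0 ≤ q / (h - h') := div_nonneg q1.le (by linarith)
  rw [mul_assoc C, mul_assoc (C * (1 + V)), mul_assoc C]
  refine mul_le_mul_of_nonneg_left ?_ C0.le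
  rw [← mul_assoc, mul_comm (1 + V), mul_assoc]
  refine mul_le_mul_of_nonneg_left ?_ P0
  rcases hq.eq_or_lt with e | hlt
  · rw [← e, sub_self, mul_zero, rpow_zero, mul_one]
    simp only [rpow_zero]
    have : (∫ x in ball x₀ h, (1:ℝ)) ^ (1 / ν) ≤ V := by
      refine rpow_le_rpow (setIntegral_nonneg measurableSet_ball fun _ _ => zero_le_one) ?_ (by positivity)
      exact setIntegral_mono_set (ball_int continuous_const) (Filter.Eventually.of_forall fun x => zero_le_one)
        (Filter.Eventually.of_forall (ball_subset_ball hhR.le))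
    linarith
  · have hd : q - 1 / k ≠ 0 := by linarith
    rw [← rpow_mul (In _ _), show 1 / (ν * (q - 1 / k)) * (q - 1 / k) = 1 / ν by
      have : ν ≠ 0 := by linarith
      rw [one_div, mul_inv, mul_assoc, inv_mul_cancel₀ hd, mul_one, one_div]]
    have := rpow_nonneg (In h (ν * (q - 1 / k))) (1 / ν)
    nlinarith

end k8

/-- Proposition 3.2 of the paper (case `n ≥ 3`): the reverse-Hölder inequality for
`g_ε` which is the starting point of the Moser iteration. Here `2* = 2n/(n-2)` and
`ŝ = 1/k`. -/
theorem stmt3 (n : ℕ) (hn : 3 ≤ n) (k l : ℝ) (hk0 : 0 < k) (hk1 : k ≤ 1)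
    (hl : (n : ℝ) / 2 < l) (i j : Fin n) :
    ∃ c : ℝ, 0 < c ∧
      ∀ (Ω : Set (Euc n)) (x₀ : Euc n) (R p : ℝ) (f u : Euc n → ℝ),
        IsOpen Ω → IsConnected Ω → x₀ ∈ Ω → 0 < R → closedBall x₀ (2 * R) ⊆ Ω →
        1 < p → |p - 2| < c →
        ContDiffOn ℝ 2 f Ω →
        ContDiffOn ℝ 1 u (closedBall x₀ (2 * R)) →
        IsWeakPSol p f u (ball x₀ (2 * R)) →
        ∀ ν : ℝ, 2 * l / (l - 1) < ν → ν < 2 * (n : ℝ) / ((n : ℝ) - 2) →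
          ∃ C : ℝ, 0 < C ∧
            ∀ ε : ℝ, ε ∈ Set.Ioo (0 : ℝ) 1 →
              ∀ uε : Euc n → ℝ,
                ContDiffOn ℝ 3 uε (ball x₀ (2 * R)) →
                ContinuousOn uε (closedBall x₀ (2 * R)) →
                SolvesReg p ε f uε (ball x₀ (2 * R)) →
                (∀ x ∈ sphere x₀ (2 * R), uε x = u x) →
                ∀ q : ℝ, 1 / k ≤ q →
                  ∀ h' h : ℝ, 0 < h' → h' < h → h < R →
                    lpOn (gfun k ε i j uε) (2 * (n : ℝ) / ((n : ℝ) - 2) * q) (ball x₀ h') ^ q ≤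
                      C * (q / (h - h')) *
                        lpOn (gfun k ε i j uε) (ν * (q - 1 / k)) (ball x₀ h) ^ (q - 1 / k) := by
  obtain ⟨c, c0, h⟩ := stmt3_aux n hn k l hk0 hk1 hl i j
  exact ⟨c, c0, fun Ω x₀ R p f u _ _ _ hR hΩ _ hp hf hu _ ν hν _ => h Ω x₀ R p f u hR hΩ hp hf hu ν hν⟩

end
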